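/- Let Q, T ≥ 2 be real numbers and fix δ > 0. For each χ ∈ O_2(Q) let 𝒯_χ be a finite set of real numbers contained in [δ/2 − T, T − δ/2] such that |t − t'| ≥ δ for all distinct t, t' ∈ 𝒯_χ. Then for every ε > 0 there exists a constant C(ε) > 0 (depending on ε alone) such that ∑_{χ ∈ O_2(Q)} ∑_{t ∈ 𝒯_χ} |L(1/2 + it, χ)|² ≤ C(ε) (δ^{-1} + 1)(QT)^{1+ε}. -/

import Mathlib

open Complex

/-- The Dirichlet L-function of a character mod `q`, extended by zero to `q = 0`. -/
noncomputable def LFun (q : ℕ) (χ : DirichletCharacter ℂ q) (s : ℂ) : ℂ :=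
  if h : q = 0 then 0
  else
    letI : NeZero q := ⟨h⟩
    DirichletCharacter.LFunction χ s

/-- `χ` mod `q` belongs to the family `O_j(Q)`: it is primitive, has multiplicative order
exactly `j`, and (being primitive) its conductor `q` satisfies `Q < q ≤ 2Q`. -/
def inFamily (j : ℕ) (Q : ℝ) (q : ℕ) (χ : DirichletCharacter ℂ q) : Prop :=
  χ.IsPrimitive ∧ orderOf χ = j ∧ Q < (q : ℝ) ∧ (q : ℝ) ≤ 2 * Q

section CharacterSums

/-- The product of the Gauss sums of a primitive character and of its inverse. -/
lemma gaussSum_mul_gaussSum_inv_of_isPrimitive {N : ℕ} [NeZero N] {R : Type*} [CommRing R]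
    [IsDomain R] {χ : DirichletCharacter R N} (hχ : χ.IsPrimitive) {e : AddChar (ZMod N) R}
    (he : e.IsPrimitive) :
    gaussSum χ e * gaussSum χ⁻¹ e = χ (-1) * N := by
  classical
  have h1 : gaussSum χ e * gaussSum χ⁻¹ e = ∑ a, ∑ b, χ b * e (a * (b + 1)) := by
    rw [gaussSum.eq_1 χ⁻¹ e, Finset.mul_sum]
    refine Finset.sum_congr rfl fun a _ => ?_
    rw [← mul_assoc, mul_comm (gaussSum χ e), ← gaussSum_mulShift_of_isPrimitive e hχ a, gaussSum,
      Finset.sum_mul]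
    refine Finset.sum_congr rfl fun b _ => ?_
    rw [AddChar.mulShift_apply, mul_assoc, ← AddChar.map_add_eq_mul]
    ring_nf
  rw [h1, Finset.sum_comm]
  simp_rw [← Finset.mul_sum]
  rw [Finset.sum_eq_single (-1 : ZMod N)]
  · simp [ZMod.card]
  · intro b _ hb
    rw [AddChar.sum_mulShift (b + 1) he, if_neg, Nat.cast_zero, mul_zero]
    rwa [← eq_neg_iff_add_eq_zero]
  · simp

lemma norm_gaussSum_of_isPrimitive {N : ℕ} [NeZero N] {χ : DirichletCharacter ℂ N}
    (hχ : χ.IsPrimitive) : ‖gaussSum χ (ZMod.stdAddChar (N := N))‖ = √N := by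
  have h1 := gaussSum_mul_gaussSum_inv_of_isPrimitive hχ (ZMod.isPrimitive_stdAddChar N)
  have h2 : star (gaussSum χ (ZMod.stdAddChar (N := N))) =
      χ (-1) * gaussSum χ⁻¹ (ZMod.stdAddChar (N := N)) := by
    have hp : (χ⁻¹).IsPrimitive := by
      rw [DirichletCharacter.isPrimitive_def, DirichletCharacter.conductor_inv]; exact hχ
    have := gaussSum_mulShift_of_isPrimitive (ZMod.stdAddChar (N := N)) hp (-1)
    rw [star_gaussSum_eq, AddChar.inv_mulShift, this, inv_inv]
  have h3 : χ (-1) * χ (-1) = 1 := by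
    rw [← map_mul]; simp
  rw [eq_comm, Real.sqrt_eq_iff_mul_self_eq (by positivity) (norm_nonneg _)]
  have h4 : gaussSum χ (ZMod.stdAddChar (N := N)) * star (gaussSum χ (ZMod.stdAddChar (N := N)))
      = N := by
    rw [h2, mul_left_comm, h1, ← mul_assoc, h3, one_mul]
  have h5 := congrArg norm h4
  rw [norm_mul, norm_star, Complex.norm_natCast] at h5
  exact h5.symm

lemma norm_geom_sum_stdAddChar_le {N : ℕ} [NeZero N] {b : ZMod N} (hb : b ≠ 0) (A B : ℕ) :
    ‖∑ d ∈ Finset.Ioc A B, ZMod.stdAddChar (N := N) (b * (d : ZMod N))‖ ≤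
      N / 2 * (1 / (b.val : ℝ) + 1 / ((N - b.val : ℕ) : ℝ)) := by
  have hN : (0 : ℝ) < N := by exact_mod_cast Nat.pos_of_ne_zero (NeZero.ne N)
  have hb0 : 0 < b.val := Nat.pos_of_ne_zero fun h => hb ((ZMod.val_eq_zero b).1 h)
  have hbN : b.val < N := ZMod.val_lt b
  have hbR : (0 : ℝ) < b.val := by exact_mod_cast hb0
  have hbR' : (0 : ℝ) < ((N - b.val : ℕ) : ℝ) := by exact_mod_cast Nat.sub_pos_of_lt hbN
  set x := ZMod.stdAddChar (N := N) b with hx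
  have hpow : ∀ d : ℕ, ZMod.stdAddChar (N := N) (b * (d : ZMod N)) = x ^ d := by
    intro d
    rw [hx, ← AddChar.map_nsmul_eq_pow, nsmul_eq_mul, mul_comm]
  have hxn : ‖x‖ = 1 := by rw [hx]; exact AddChar.norm_apply _ _
  have hxe : x = exp (I * ((2 * Real.pi * b.val / N : ℝ) : ℂ)) := by
    have h := ZMod.stdAddChar_coe (N := N) (b.val : ℤ)
    rw [Int.cast_natCast, ZMod.natCast_zmod_val] at h
    rw [hx, h]
    congr 1
    push_cast
    ring
  have hsin : 2 * (min (b.val : ℝ) ((N - b.val : ℕ) : ℝ) / N) ≤ Real.sin (Real.pi * b.val / N) := by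
    have hpi := Real.pi_pos
    have hcast : ((N - b.val : ℕ) : ℝ) = N - b.val := by
      rw [Nat.cast_sub hbN.le]
    rcases le_total (2 * (b.val : ℝ)) N with h | h
    · have := Real.mul_le_sin (x := Real.pi * b.val / N) (by positivity) (by
        rw [div_le_div_iff₀ hN two_pos]; nlinarith)
      refine le_trans ?_ this
      rw [show 2 / Real.pi * (Real.pi * (b.val : ℝ) / N) = 2 * (b.val / N) by field_simp]
      gcongr
      exact min_le_left _ _
    · have := Real.mul_le_sin (x := Real.pi * ((N - b.val : ℕ) : ℝ) / N) (by positivity) (by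
        rw [div_le_div_iff₀ hN two_pos, hcast]; nlinarith)
      have e : Real.pi * ((N - b.val : ℕ) : ℝ) / N = Real.pi - Real.pi * b.val / N := by
        rw [hcast]; field_simp
      rw [e, Real.sin_pi_sub, ← e] at this
      refine le_trans ?_ this
      rw [show 2 / Real.pi * (Real.pi * ((N - b.val : ℕ) : ℝ) / N)
        = 2 * (((N - b.val : ℕ) : ℝ) / N) by field_simp]
      gcongr
      exact min_le_right _ _
  set m := min (b.val : ℝ) ((N - b.val : ℕ) : ℝ) with hm
  have hm0 : 0 < m := lt_min hbR hbR'
  have hdist : 4 * (m / N) ≤ ‖x - 1‖ := by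
    rw [hxe, Complex.norm_exp_I_mul_ofReal_sub_one, Real.norm_eq_abs]
    refine le_trans ?_ (le_abs_self _)
    rw [show 2 * Real.pi * (b.val : ℝ) / N / 2 = Real.pi * b.val / N by ring]
    linarith
  have hx1 : x ≠ 1 := by
    intro h
    rw [h, sub_self, norm_zero] at hdist
    have : 0 < 4 * (m / N) := by positivity
    linarith
  have hsum : ‖∑ d ∈ Finset.Ioc A B, x ^ d‖ ≤ 2 / ‖x - 1‖ := by
    have hpos : 0 < ‖x - 1‖ := norm_pos_iff.2 (sub_ne_zero.2 hx1)
    rcases le_or_gt B A with h | h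
    · rw [Finset.Ioc_eq_empty_of_le h]; simp; positivity
    · have hI : Finset.Ioc A B = Finset.Ico (A + 1) (B + 1) := by
        ext; simp only [Finset.mem_Ioc, Finset.mem_Ico]; omega
      rw [hI, geom_sum_Ico hx1 (by omega), norm_div]
      gcongr
      refine (norm_sub_le _ _).trans ?_
      rw [norm_pow, norm_pow, hxn]; norm_num
  simp_rw [hpow]
  refine hsum.trans ?_
  have h1 : 2 / ‖x - 1‖ ≤ 2 / (4 * (m / N)) := by gcongr
  refine h1.trans ?_
  have h2 : 2 / (4 * (m / N)) = N / 2 * (1 / m) := by field_simp; norm_num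
  rw [h2]
  gcongr
  rcases min_cases (b.val : ℝ) ((N - b.val : ℕ) : ℝ) with h | h
  · rw [hm, h.1]; have : 0 < 1 / ((N - b.val : ℕ) : ℝ) := by positivity
    linarith
  · rw [hm, h.1]; have : 0 < 1 / (b.val : ℝ) := by positivity
    linarith

lemma sum_inv_val_le (N : ℕ) [NeZero N] :
    ∑ b ∈ (Finset.univ : Finset (ZMod N)).erase 0,
      (1 / (b.val : ℝ) + 1 / ((N - b.val : ℕ) : ℝ)) ≤ 2 * (1 + Real.log N) := by
  have h1 : ∑ b ∈ (Finset.univ : Finset (ZMod N)).erase 0,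
      (1 / (b.val : ℝ) + 1 / ((N - b.val : ℕ) : ℝ)) =
      ∑ k ∈ Finset.Ico 1 N, (1 / (k : ℝ) + 1 / ((N - k : ℕ) : ℝ)) := by
    refine Finset.sum_bij (fun b _ => b.val) ?_ ?_ ?_ ?_
    · intro b hb
      simp only [Finset.mem_erase, Finset.mem_univ, and_true] at hb
      simp only [Finset.mem_Ico]
      exact ⟨Nat.pos_of_ne_zero fun h => hb ((ZMod.val_eq_zero b).1 h), ZMod.val_lt b⟩
    · intro a _ b _ h
      exact ZMod.val_injective N h
    · intro k hk
      simp only [Finset.mem_Ico] at hk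
      have : ((k : ZMod N)).val = k := ZMod.val_natCast_of_lt hk.2
      refine ⟨(k : ZMod N), ?_, this⟩
      simp only [Finset.mem_erase, Finset.mem_univ, and_true]
      intro h
      rw [h, ZMod.val_zero] at this
      omega
    · intro b _; rfl
  have hN : 1 ≤ N := Nat.one_le_iff_ne_zero.2 (NeZero.ne N)
  have h2 : ∑ k ∈ Finset.Ico 1 N, (1 / (k : ℝ)) ≤ 1 + Real.log N := by
    have := harmonic_le_one_add_log N
    rw [harmonic_eq_sum_Icc] at this
    push_cast at this
    refine le_trans ?_ this
    simp_rw [one_div]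
    refine Finset.sum_le_sum_of_subset_of_nonneg ?_ fun _ _ _ => by positivity
    intro k hk
    simp only [Finset.mem_Ico, Finset.mem_Icc] at hk ⊢
    omega
  have h3 : ∑ k ∈ Finset.Ico 1 N, (1 / ((N - k : ℕ) : ℝ)) = ∑ k ∈ Finset.Ico 1 N, (1 / (k : ℝ)) := by
    refine Finset.sum_nbij' (fun k => N - k) (fun k => N - k) ?_ ?_ ?_ ?_ ?_ <;>
      intro k hk <;> simp only [Finset.mem_Ico] at hk ⊢
    all_goals omega
  rw [h1, Finset.sum_add_distrib, h3]
  linarith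

/-- The Pólya–Vinogradov inequality for primitive characters. -/
theorem polya_vinogradov_of_isPrimitive {N : ℕ} [NeZero N] {χ : DirichletCharacter ℂ N}
    (hχ : χ.IsPrimitive) (hN : N ≠ 1) (A B : ℕ) :
    ‖∑ d ∈ Finset.Ioc A B, χ (d : ZMod N)‖ ≤ √N * (1 + Real.log N) := by
  have hN0 : (0 : ℝ) < N := by exact_mod_cast Nat.pos_of_ne_zero (NeZero.ne N)
  have hs : 0 < √(N : ℝ) := Real.sqrt_pos.2 hN0
  have hp : (χ⁻¹).IsPrimitive := by
    rw [DirichletCharacter.isPrimitive_def, DirichletCharacter.conductor_inv]; exact hχ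
  set e := ZMod.stdAddChar (N := N) with he
  have key : (∑ d ∈ Finset.Ioc A B, χ (d : ZMod N)) * gaussSum χ⁻¹ e =
      ∑ b ∈ (Finset.univ : Finset (ZMod N)).erase 0,
        χ⁻¹ b * ∑ d ∈ Finset.Ioc A B, e (b * (d : ZMod N)) := by
    rw [Finset.sum_erase]
    · simp_rw [Finset.mul_sum]
      rw [Finset.sum_comm, Finset.sum_mul]
      refine Finset.sum_congr rfl fun d _ => ?_
      have := gaussSum_mulShift_of_isPrimitive e hp (d : ZMod N)
      rw [inv_inv] at this
      rw [← this, gaussSum]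
      refine Finset.sum_congr rfl fun b _ => ?_
      rw [AddChar.mulShift_apply, mul_comm b]
    · rw [DirichletCharacter.map_zero' _ hN, zero_mul]
  have h1 : ‖∑ d ∈ Finset.Ioc A B, χ (d : ZMod N)‖ * √N ≤ N * (1 + Real.log N) := by
    rw [← norm_gaussSum_of_isPrimitive hp, ← norm_mul, key]
    calc _ ≤ ∑ b ∈ (Finset.univ : Finset (ZMod N)).erase 0,
          (N / 2 * (1 / (b.val : ℝ) + 1 / ((N - b.val : ℕ) : ℝ))) := by
          refine norm_sum_le_of_le _ fun b hb => ?_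
          rw [norm_mul]
          have h2 := norm_geom_sum_stdAddChar_le (Finset.ne_of_mem_erase hb) A B
          have h3 := DirichletCharacter.norm_le_one χ⁻¹ b
          calc _ ≤ 1 * _ := mul_le_mul_of_nonneg_right h3 (norm_nonneg _)
            _ ≤ _ := by rw [one_mul]; exact h2
      _ = N / 2 * ∑ b ∈ (Finset.univ : Finset (ZMod N)).erase 0,
          (1 / (b.val : ℝ) + 1 / ((N - b.val : ℕ) : ℝ)) := by rw [Finset.mul_sum]
      _ ≤ N / 2 * (2 * (1 + Real.log N)) := by
          gcongr; exact sum_inv_val_le N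
      _ = _ := by ring
  have h2 : (N : ℝ) * (1 + Real.log N) = √N * (1 + Real.log N) * √N := by
    nth_rewrite 1 [← Real.mul_self_sqrt hN0.le]; ring
  rw [h2] at h1
  exact le_of_mul_le_mul_right h1 hs

lemma card_divisors_le_two_mul_sqrt (n : ℕ) : (n.divisors.card : ℝ) ≤ 2 * √n := by
  rcases Nat.eq_zero_or_pos n with rfl | hn
  · simp
  have hcard : n.divisors.card ≤ 2 * n.sqrt := by
    set s := n.divisors.filter (fun d => d ≤ n.sqrt)
    set t := n.divisors.filter (fun d => ¬ d ≤ n.sqrt)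
    have hs : s.card ≤ n.sqrt := by
      have : s ⊆ Finset.Icc 1 n.sqrt := by
        intro d hd
        simp only [s, Finset.mem_filter, Nat.mem_divisors] at hd
        simp only [Finset.mem_Icc]
        exact ⟨Nat.pos_of_dvd_of_pos hd.1.1 hn, hd.2⟩
      simpa using Finset.card_le_card this
    have ht : t.card ≤ s.card := by
      refine Finset.card_le_card_of_injOn (fun d => n / d) ?_ ?_
      · intro d hd
        simp only [t, Finset.coe_filter, Nat.mem_divisors, Set.mem_ofPred_eq] at hd
        simp only [s, Finset.coe_filter, Nat.mem_divisors, Set.mem_ofPred_eq]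
        refine ⟨⟨Nat.div_dvd_of_dvd hd.1.1, hd.1.2⟩, ?_⟩
        by_contra hc
        have h1 : (n.sqrt + 1) * (n.sqrt + 1) ≤ d * (n / d) :=
          Nat.mul_le_mul (by omega) (by omega)
        rw [Nat.mul_div_cancel' hd.1.1] at h1
        exact absurd (Nat.lt_succ_sqrt n) (by simpa using h1)
      · intro a ha b hb h
        simp only [t, Finset.coe_filter, Nat.mem_divisors, Set.mem_ofPred_eq] at ha hb
        exact (Nat.div_eq_iff_eq_of_dvd_dvd hn.ne' ha.1.1 hb.1.1).1 h
    have := Finset.card_filter_add_card_filter_not (s := n.divisors) (fun d => d ≤ n.sqrt)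
    change s.card + t.card = _ at this
    omega
  calc (n.divisors.card : ℝ) ≤ ((2 * n.sqrt : ℕ) : ℝ) := by exact_mod_cast hcard
    _ = 2 * (n.sqrt : ℝ) := by push_cast; ring
    _ ≤ 2 * √n := by gcongr; exact Real.nat_sqrt_le_real_sqrt

/-- The Pólya–Vinogradov inequality for non-principal characters. -/
theorem polya_vinogradov {n : ℕ} [NeZero n] {χ : DirichletCharacter ℂ n} (hχ : χ ≠ 1) (A B : ℕ) :
    ‖∑ d ∈ Finset.Ioc A B, χ (d : ZMod n)‖ ≤ 2 * √n * (1 + Real.log n) := by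
  have hn : 0 < n := Nat.pos_of_ne_zero (NeZero.ne n)
  have hc0 : χ.conductor ≠ 0 := DirichletCharacter.conductor_ne_zero χ
  have : NeZero χ.conductor := ⟨hc0⟩
  have hc1 : χ.conductor ≠ 1 := fun h =>
    hχ ((DirichletCharacter.eq_one_iff_conductor_eq_one (χ := χ)).2 h)
  set c := χ.conductor with hc
  set ψ := χ.primitiveCharacter with hψ
  have hψp : ψ.IsPrimitive := χ.primitiveCharacter_isPrimitive
  have hcn : c ∣ n := χ.conductor_dvd_level
  have h1 : ∀ d : ℕ, χ (d : ZMod n) =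
      ∑ e ∈ n.divisors, if e ∣ d then (ArithmeticFunction.moebius e : ℂ) * ψ (d : ZMod c) else 0 := by
    intro d
    have hg : ∑ e ∈ (n.gcd d).divisors, (ArithmeticFunction.moebius e : ℤ) =
        if n.gcd d = 1 then 1 else 0 := by
      rw [← ArithmeticFunction.coe_mul_zeta_apply, ArithmeticFunction.moebius_mul_coe_zeta,
        ArithmeticFunction.one_apply]
    have hg' : ∑ e ∈ n.divisors, (if e ∣ d then (ArithmeticFunction.moebius e : ℂ) else 0) =
        if n.gcd d = 1 then 1 else 0 := by
      rw [← Finset.sum_filter]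
      have : n.divisors.filter (fun e => e ∣ d) = (n.gcd d).divisors := by
        ext e
        simp only [Finset.mem_filter, Nat.mem_divisors, Nat.dvd_gcd_iff]
        have := (Nat.gcd_pos_of_pos_left d hn).ne'
        have := hn.ne'
        tauto
      rw [this]
      exact_mod_cast hg
    have h2 : ∑ e ∈ n.divisors, (if e ∣ d then (ArithmeticFunction.moebius e : ℂ) *
        ψ (d : ZMod c) else 0) = (if n.gcd d = 1 then 1 else 0) * ψ (d : ZMod c) := by
      rw [← hg', Finset.sum_mul]
      exact Finset.sum_congr rfl fun e _ => by split_ifs <;> simp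
    rw [h2]
    split_ifs with h
    · have hcop : IsCoprime (d : ℤ) (n : ℤ) := by
        rw [Nat.isCoprime_iff_coprime]; exact Nat.Coprime.symm h
      have := χ.primitiveCharacter_apply_of_isCoprime hcop
      rw [one_mul]
      simpa using this.symm
    · rw [zero_mul]
      have : ¬ IsCoprime (d : ℤ) (n : ℤ) := by
        rw [Nat.isCoprime_iff_coprime]; exact fun h' => h h'.symm
      simpa using (χ.apply_eq_zero_iff (d : ℤ)).2 this
  have h2 : ∀ e : ℕ, 0 < e → ∑ d ∈ Finset.Ioc A B,
      (if e ∣ d then (ArithmeticFunction.moebius e : ℂ) * ψ (d : ZMod c) else 0) =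
      ArithmeticFunction.moebius e * ψ (e : ZMod c) *
        ∑ d ∈ Finset.Ioc (A / e) (B / e), ψ (d : ZMod c) := by
    intro e he
    rw [← Finset.sum_filter, Finset.mul_sum]
    refine Finset.sum_nbij' (fun d => d / e) (fun d => e * d) ?_ ?_ ?_ ?_ ?_
    · intro d hd
      simp only [Finset.mem_filter, Finset.mem_Ioc] at hd ⊢
      obtain ⟨⟨h3, h4⟩, k, rfl⟩ := hd
      rw [Nat.mul_div_cancel_left _ he]
      exact ⟨(Nat.div_lt_iff_lt_mul he).2 (by rwa [mul_comm]), (Nat.le_div_iff_mul_le he).2 (by rwa [mul_comm])⟩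
    · intro d hd
      simp only [Finset.mem_filter, Finset.mem_Ioc] at hd ⊢
      rw [Nat.div_lt_iff_lt_mul he, Nat.le_div_iff_mul_le he] at hd
      rw [mul_comm e]
      exact ⟨hd, Dvd.intro_left d rfl⟩
    · intro d hd
      simp only [Finset.mem_filter] at hd
      exact Nat.mul_div_cancel' hd.2
    · intro d _
      exact Nat.mul_div_cancel_left _ he
    · intro d hd
      simp only [Finset.mem_filter] at hd
      obtain ⟨_, k, rfl⟩ := hd
      rw [Nat.mul_div_cancel_left _ he, Nat.cast_mul, map_mul, mul_assoc]
  have hlog : 0 ≤ 1 + Real.log c := by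
    have := Real.log_nonneg (show (1 : ℝ) ≤ c by exact_mod_cast Nat.pos_of_ne_zero hc0)
    linarith
  have hcast : (n : ℝ) = c * ((n / c : ℕ) : ℝ) := by
    rw [← Nat.cast_mul, Nat.mul_div_cancel' hcn]
  calc ‖∑ d ∈ Finset.Ioc A B, χ (d : ZMod n)‖
      = ‖∑ e ∈ n.divisors, ArithmeticFunction.moebius e * ψ (e : ZMod c) *
        ∑ d ∈ Finset.Ioc (A / e) (B / e), ψ (d : ZMod c)‖ := by
        simp_rw [h1]
        rw [Finset.sum_comm]
        congr 1
        exact Finset.sum_congr rfl fun e he => h2 e (Nat.pos_of_mem_divisors he)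
    _ = ‖∑ e ∈ (n / c).divisors, ArithmeticFunction.moebius e * ψ (e : ZMod c) *
        ∑ d ∈ Finset.Ioc (A / e) (B / e), ψ (d : ZMod c)‖ := by
        congr 1
        symm
        refine Finset.sum_subset (Nat.divisors_subset_of_dvd hn.ne' (Nat.div_dvd_of_dvd hcn)) ?_
        intro e he he'
        have : ψ (e : ZMod c) = 0 := by
          have := (ψ.apply_eq_zero_iff (e : ℤ)).2 ?_
          · simpa using this
          rw [Nat.isCoprime_iff_coprime]
          intro hcop
          apply he'
          rw [Nat.mem_divisors] at he ⊢
          refine ⟨?_, (Nat.div_pos (Nat.le_of_dvd hn hcn) (Nat.pos_of_ne_zero hc0)).ne'⟩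
          refine hcop.dvd_of_dvd_mul_left ?_
          rw [Nat.mul_div_cancel' hcn]
          exact he.1
        rw [this]; ring
    _ ≤ ∑ e ∈ (n / c).divisors, √c * (1 + Real.log c) := by
        refine norm_sum_le_of_le _ fun e _ => ?_
        rw [norm_mul, norm_mul]
        have h3 : ‖(ArithmeticFunction.moebius e : ℂ)‖ ≤ 1 := by
          rw [Complex.norm_intCast]
          exact_mod_cast ArithmeticFunction.abs_moebius_le_one
        have h4 := DirichletCharacter.norm_le_one ψ (e : ZMod c)
        have h5 := polya_vinogradov_of_isPrimitive hψp hc1 (A / e) (B / e)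
        calc _ ≤ 1 * 1 * (√c * (1 + Real.log c)) := by gcongr
          _ = _ := by ring
    _ = ((n / c).divisors.card : ℝ) * (√c * (1 + Real.log c)) := by
        rw [Finset.sum_const, nsmul_eq_mul]
    _ ≤ (2 * √((n / c : ℕ) : ℝ)) * (√c * (1 + Real.log c)) := by
        gcongr; exact card_divisors_le_two_mul_sqrt _
    _ = 2 * √n * (1 + Real.log c) := by
        rw [hcast, Real.sqrt_mul (by positivity)]; ring
    _ ≤ 2 * √n * (1 + Real.log n) := by
        have : (c : ℝ) ≤ n := by exact_mod_cast Nat.le_of_dvd hn hcn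
        have : (0 : ℝ) < c := by exact_mod_cast Nat.pos_of_ne_zero hc0
        gcongr

end CharacterSums

section QuadraticCharacters

/-- The integer-valued quadratic character with the same values as a quadratic character. -/
noncomputable def intQuadraticChar {q : ℕ} (χ : DirichletCharacter ℂ q) (hχ : χ.IsQuadratic) :
    MulChar (ZMod q) ℤ where
  toFun a := if χ a = 1 then 1 else if χ a = -1 then -1 else 0
  map_one' := by simp
  map_mul' a b := by
    rw [map_mul]
    have h : (-1 : ℂ) ≠ 1 := by norm_num
    rcases hχ a with ha | ha | ha <;> rcases hχ b with hb | hb | hb <;> simp [ha, hb, h]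
  map_nonunit' a ha := by
    change (if χ a = 1 then (1 : ℤ) else if χ a = -1 then -1 else 0) = 0
    rw [χ.map_nonunit ha]; simp

lemma intQuadraticChar_apply {q : ℕ} {χ : DirichletCharacter ℂ q} (hχ : χ.IsQuadratic)
    (a : ZMod q) :
    intQuadraticChar χ hχ a = if χ a = 1 then 1 else if χ a = -1 then -1 else 0 := rfl

lemma intQuadraticChar_cast {q : ℕ} {χ : DirichletCharacter ℂ q} (hχ : χ.IsQuadratic)
    (a : ZMod q) : ((intQuadraticChar χ hχ a : ℤ) : ℂ) = χ a := by
  have h : (-1 : ℂ) ≠ 1 := by norm_num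
  rw [intQuadraticChar_apply]
  rcases hχ a with ha | ha | ha <;> simp [ha, h]

lemma intQuadraticChar_isQuadratic {q : ℕ} {χ : DirichletCharacter ℂ q} (hχ : χ.IsQuadratic) :
    (intQuadraticChar χ hχ).IsQuadratic := by
  intro a
  rw [intQuadraticChar_apply]
  split_ifs <;> simp

lemma intQuadraticChar_comp_isPrimitive {q : ℕ} [NeZero q] {χ : DirichletCharacter ℂ q}
    (hχ : χ.IsQuadratic) (hp : χ.IsPrimitive) {F : Type*} [CommRing F] [IsDomain F]
    (hF : ringChar F ≠ 2) :
    DirichletCharacter.IsPrimitive ((intQuadraticChar χ hχ).ringHomComp (Int.castRingHom F)) := by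
  set φ : DirichletCharacter F q := (intQuadraticChar χ hχ).ringHomComp (Int.castRingHom F) with hφ
  have hne : (-1 : F) ≠ 1 := by
    exact Ring.neg_one_ne_one_of_char_ne_two hF
  have hker : φ.toUnitHom.ker = χ.toUnitHom.ker := by
    ext u
    rw [MonoidHom.mem_ker, MonoidHom.mem_ker, ← Units.val_inj, ← Units.val_inj,
      MulChar.coe_toUnitHom, MulChar.coe_toUnitHom, hφ, MulChar.ringHomComp_apply,
      intQuadraticChar_apply]
    have h : (-1 : ℂ) ≠ 1 := by norm_num
    rcases hχ u with ha | ha | ha <;> simp [ha, h, hne]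
  have hset : φ.conductorSet = χ.conductorSet := by
    ext d
    rw [DirichletCharacter.mem_conductorSet_iff, DirichletCharacter.mem_conductorSet_iff]
    constructor
    · intro hd
      have hdvd := hd.dvd
      rw [DirichletCharacter.factorsThrough_iff_ker_unitsMap hdvd] at hd ⊢
      rwa [← hker]
    · intro hd
      have hdvd := hd.dvd
      rw [DirichletCharacter.factorsThrough_iff_ker_unitsMap hdvd] at hd ⊢
      rwa [hker]
  rw [DirichletCharacter.isPrimitive_def] at hp ⊢
  rw [DirichletCharacter.conductor, hset]
  exact hp

lemma legendreSym_eq_intQuadraticChar {q : ℕ} [NeZero q] {χ : DirichletCharacter ℂ q}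
    (hχ : χ.IsQuadratic) (hp : χ.IsPrimitive) {p : ℕ} [Fact p.Prime] (hp2 : p ≠ 2) :
    legendreSym p (intQuadraticChar χ hχ (-1) * q) = intQuadraticChar χ hχ (p : ZMod q) := by
  have hpp : p.Prime := Fact.out
  by_cases hpq : p ∣ q
  · have h1 : ¬ IsUnit ((p : ℕ) : ZMod q) := by
      rw [ZMod.isUnit_iff_coprime]
      intro h
      exact hpp.one_lt.ne' (Nat.Coprime.eq_one_of_dvd h hpq)
    rw [(intQuadraticChar χ hχ).map_nonunit h1, legendreSym.eq_zero_iff]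
    have : (q : ZMod p) = 0 := (ZMod.natCast_eq_zero_iff q p).2 hpq
    push_cast
    rw [this, mul_zero]
  · let F := CyclotomicField q (ZMod p)
    have hchar : CharP F p := charP_of_injective_algebraMap (algebraMap (ZMod p) F).injective p
    have hrc : ringChar F ≠ 2 := by rwa [ringChar.eq F p]
    have hq0 : ((⟨q, Nat.pos_of_ne_zero (NeZero.ne q)⟩ : ℕ+) : ZMod p) ≠ 0 := by
      change (q : ZMod p) ≠ 0
      rwa [Ne, ZMod.natCast_eq_zero_iff]
    obtain ⟨ψ, hψ⟩ : ∃ ψ : AddChar (ZMod q) F, ψ.IsPrimitive := by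
      have : NeZero ((q : ℕ) : ZMod p) := ⟨hq0⟩
      exact ⟨_, AddChar.zmodChar_primitive_of_primitive_root q
        (IsCyclotomicExtension.zeta_spec q (ZMod p) F)⟩
    set φ : MulChar (ZMod q) F := (intQuadraticChar χ hχ).ringHomComp (Int.castRingHom F) with hφ
    have hφq : φ.IsQuadratic := (intQuadraticChar_isQuadratic hχ).comp _
    have hφp : DirichletCharacter.IsPrimitive φ := intQuadraticChar_comp_isPrimitive hχ hp hrc
    have hg : gaussSum φ ψ ^ 2 = φ (-1) * Fintype.card (ZMod q) := by
      have := gaussSum_mul_gaussSum_inv_of_isPrimitive hφp hψ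
      rw [hφq.inv] at this
      rw [sq, this, ZMod.card]
    have hpu : IsUnit ((p : ℕ) : ZMod q) := by
      rw [ZMod.isUnit_iff_coprime]
      exact (Nat.Prime.coprime_iff_not_dvd hpp).2 hpq
    have h1 := Char.card_pow_char_pow hφq ψ p 1 hpu hp2 hg
    rw [pow_one, pow_one, ZMod.card] at h1
    have h2 := legendreSym.eq_pow p (intQuadraticChar χ hχ (-1) * q)
    have h3 := congrArg (algebraMap (ZMod p) F) h2
    rw [map_intCast, map_pow, map_intCast] at h3
    push_cast at h3
    have h4 : φ (-1) = ((intQuadraticChar χ hχ (-1) : ℤ) : F) := rfl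
    have h5 : φ (p : ZMod q) = ((intQuadraticChar χ hχ (p : ZMod q) : ℤ) : F) := rfl
    rw [h4, h5] at h1
    rw [h1, legendreSym] at h3
    exact (quadraticChar_isQuadratic (ZMod p)).eq_of_eq_coe (intQuadraticChar_isQuadratic hχ) hrc h3

/-- A form of quadratic reciprocity: a primitive quadratic character is given, at odd arguments,
by a Jacobi symbol with numerator plus or minus its conductor. -/
theorem exists_sign_forall_odd_eq_jacobiSym {q : ℕ} [NeZero q] {χ : DirichletCharacter ℂ q}
    (hχ : χ.IsQuadratic) (hp : χ.IsPrimitive) :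
    ∃ s : ℤ, (s = 1 ∨ s = -1) ∧ χ (-1) = s ∧
      ∀ m : ℕ, Odd m → χ (m : ZMod q) = (jacobiSym (s * q) m : ℂ) := by
  have hs : (intQuadraticChar χ hχ (-1)) * (intQuadraticChar χ hχ (-1)) = 1 := by
    rw [← map_mul]; simp
  refine ⟨intQuadraticChar χ hχ (-1), mul_self_eq_one_iff.1 hs,
    (intQuadraticChar_cast hχ _).symm, fun m hm => ?_⟩
  rw [← intQuadraticChar_cast hχ]
  congr 1
  induction m using Nat.recOnMul with
  | zero => simp at hm
  | one => simp
  | prime p hpp =>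
    have : Fact p.Prime := ⟨hpp⟩
    have hp2 : p ≠ 2 := by rintro rfl; exact absurd hm (by decide)
    rw [← jacobiSym.legendreSym.to_jacobiSym, legendreSym_eq_intQuadraticChar hχ hp hp2]
  | mul a b iha ihb =>
    rw [Nat.odd_mul] at hm
    rw [Nat.cast_mul, map_mul, iha hm.1, ihb hm.2, jacobiSym.mul_right']
    · rintro rfl; simp at hm
    · rintro rfl; simp at hm

end QuadraticCharacters

section JacobiSums

/-- The Jacobi symbol with odd denominator `n` as a Dirichlet character mod `n`. -/
noncomputable def jacobiChar (n : ℕ) [NeZero n] : DirichletCharacter ℂ n where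
  toFun a := (jacobiSym (a.val : ℤ) n : ℂ)
  map_one' := by
    have : jacobiSym (((1 : ZMod n).val : ℕ) : ℤ) n = jacobiSym 1 n := by
      refine jacobiSym.mod_left' ?_
      rw [ZMod.val_one_eq_one_mod]; simp
    rw [this, jacobiSym.one_left]; simp
  map_mul' a b := by
    have : jacobiSym (((a * b : ZMod n).val : ℕ) : ℤ) n = jacobiSym (a.val * b.val) n := by
      refine jacobiSym.mod_left' ?_
      rw [ZMod.val_mul]; simp
    rw [this, jacobiSym.mul_left]; push_cast; rfl
  map_nonunit' a ha := by
    have h : (a.val : ℤ).gcd n ≠ 1 := by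
      intro h
      apply ha
      rw [← ZMod.natCast_zmod_val a, ZMod.isUnit_iff_coprime]
      rwa [Int.gcd_natCast_natCast] at h
    have h0 := jacobiSym.eq_zero_iff_not_coprime.2 h
    change ((jacobiSym (a.val : ℤ) n : ℤ) : ℂ) = 0
    rw [h0, Int.cast_zero]

lemma jacobiChar_apply (n : ℕ) [NeZero n] (d : ℕ) :
    jacobiChar n (d : ZMod n) = (jacobiSym d n : ℂ) := by
  have : jacobiSym (((d : ZMod n).val : ℕ) : ℤ) n = jacobiSym d n := by
    refine jacobiSym.mod_left' ?_
    rw [ZMod.val_natCast]; simp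
  change ((jacobiSym (((d : ZMod n).val : ℕ) : ℤ) n : ℤ) : ℂ) = _
  rw [this]

lemma exists_jacobiSym_eq_neg_one {n : ℕ} (hn : Odd n) (hsq : ¬ IsSquare n) :
    ∃ d : ℕ, jacobiSym d n = -1 := by
  have hn0 : n ≠ 0 := by rintro rfl; simp at hn
  obtain ⟨r, s, hrs, hr⟩ := Nat.sq_mul_squarefree n
  have hr1 : r ≠ 1 := by
    rintro rfl
    exact hsq ⟨s, by rw [← hrs]; ring⟩
  have hs0 : s ≠ 0 := by rintro rfl; simp at hrs; omega
  have hr0 : r ≠ 0 := hr.ne_zero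
  obtain ⟨p, hp, hpr⟩ := Nat.exists_prime_and_dvd hr1
  have : Fact p.Prime := ⟨hp⟩
  obtain ⟨k, m, hm, hnk⟩ := Nat.exists_eq_pow_mul_and_not_dvd hn0 p hp.ne_one
  have hk : Odd k := by
    have h1 : n.factorization p = k := by
      rw [hnk, Nat.factorization_mul (pow_ne_zero _ hp.ne_zero) (by rintro rfl; simp at hm),
        hp.factorization_pow]
      simp [Nat.factorization_eq_zero_of_not_dvd hm]
    have h2 : n.factorization p = 2 * s.factorization p + 1 := by
      rw [← hrs, Nat.factorization_mul (pow_ne_zero _ hs0) hr0, Nat.factorization_pow]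
      have h3 : r.factorization p = 1 :=
        le_antisymm (hr.natFactorization_le_one p) ((hp.dvd_iff_one_le_factorization hr0).1 hpr)
      simp [h3]
    rw [← h1, h2]; exact odd_two_mul_add_one _
  have hp2 : p ≠ 2 := by
    rintro rfl
    have : 2 ∣ n := by rw [← hrs]; exact hpr.mul_left _
    rw [← Nat.not_even_iff_odd, even_iff_two_dvd] at hn
    exact hn this
  obtain ⟨a, ha⟩ := quadraticChar_exists_neg_one (F := ZMod p) (by rwa [ZMod.ringChar_zmod_n])
  have hcop : Nat.Coprime p m := (Nat.Prime.coprime_iff_not_dvd hp).2 hm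
  obtain ⟨d, hd1, hd2⟩ := Nat.chineseRemainder hcop a.val 1
  refine ⟨d, ?_⟩
  have hm0 : m ≠ 0 := by rintro rfl; simp at hm
  have e1 : jacobiSym d p = -1 := by
    rw [← jacobiSym.legendreSym.to_jacobiSym, legendreSym, ← ha]
    congr 1
    rw [Int.cast_natCast, (ZMod.natCast_eq_natCast_iff _ _ _).2 hd1, ZMod.natCast_zmod_val]
  have e2 : jacobiSym d m = 1 := by
    have : jacobiSym d m = jacobiSym 1 m := by
      refine jacobiSym.mod_left' ?_
      exact_mod_cast hd2
    rw [this, jacobiSym.one_left]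
  rw [hnk, jacobiSym.mul_right' _ (pow_ne_zero _ hp.ne_zero) hm0, jacobiSym.pow_right, e1, e2,
    hk.neg_one_pow, mul_one]

/-- Pólya–Vinogradov for the sum of Jacobi symbols over numerators. -/
theorem abs_sum_jacobiSym_le {n : ℕ} (hn : Odd n) (hsq : ¬ IsSquare n) (A B : ℕ) :
    |((∑ d ∈ Finset.Ioc A B, jacobiSym d n : ℤ) : ℝ)| ≤ 2 * √n * (1 + Real.log n) := by
  have hn0 : n ≠ 0 := by rintro rfl; simp at hn
  have : NeZero n := ⟨hn0⟩
  obtain ⟨d, hd⟩ := exists_jacobiSym_eq_neg_one hn hsq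
  have hne : jacobiChar n ≠ 1 := by
    intro h
    have h1 := jacobiChar_apply n d
    rw [h, hd] at h1
    have hu : IsUnit ((d : ℕ) : ZMod n) := by
      by_contra hu
      rw [MulChar.map_nonunit _ hu] at h1
      norm_num at h1
    rw [MulChar.one_apply hu] at h1
    norm_num at h1
  have h := polya_vinogradov hne A B
  simp_rw [jacobiChar_apply] at h
  rw [← Int.cast_sum, Complex.norm_intCast] at h
  exact h

end JacobiSums

section Theta

lemma summable_int_pow_mul_exp {κ : ℕ} (hκ : κ ≤ 1) (x c : ℂ) (hc : 0 < c.re) :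
    Summable fun n : ℤ => (n : ℂ) ^ κ * cexp (2 * Real.pi * I * n * x - Real.pi * c * n ^ 2) := by
  have hτ : 0 < (I * c).im := by simpa using hc
  have hterm : ∀ n : ℤ, jacobiTheta₂_term n x (I * c) =
      cexp (2 * Real.pi * I * n * x - Real.pi * c * n ^ 2) := by
    intro n
    rw [jacobiTheta₂_term]
    congr 1
    linear_combination (Real.pi * n ^ 2 * c : ℂ) * I_sq
  interval_cases κ
  · simpa [hterm] using (hasSum_jacobiTheta₂_term x hτ).summable
  · have h := (hasSum_jacobiTheta₂'_term x hτ).summable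
    have h2 := h.mul_left (1 / (2 * Real.pi * I))
    refine h2.congr fun n => ?_
    rw [jacobiTheta₂'_term, hterm]
    have : (Real.pi : ℂ) ≠ 0 := by exact_mod_cast Real.pi_ne_zero
    field_simp

/-- Poisson summation for the Gaussian and its derivative. -/
lemma tsum_int_pow_mul_exp {κ : ℕ} (hκ : κ ≤ 1) (x c : ℂ) (hc : 0 < c.re) :
    ∑' n : ℤ, (n : ℂ) ^ κ * cexp (2 * Real.pi * I * n * x - Real.pi * c * n ^ 2) =
      1 / c ^ (1 / 2 : ℂ) * (1 / (I * c)) ^ κ *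
        ∑' n : ℤ, ((n : ℂ) - x) ^ κ * cexp (-Real.pi / c * (n - x) ^ 2) := by
  have hc0 : c ≠ 0 := by rintro rfl; simp at hc
  have hpi : (Real.pi : ℂ) ≠ 0 := by exact_mod_cast Real.pi_ne_zero
  have hτ : 0 < (I * c).im := by simpa using hc
  have hτ' : 0 < (-1 / (I * c)).im := by
    have : -1 / (I * c) = I * (1 / c) := by field_simp; linear_combination -I_sq
    rw [this]
    have : 0 < (1 / c).re := by
      rw [one_div, inv_re]; exact div_pos hc (normSq_pos.2 hc0)
    simpa using this
  have hterm : ∀ n : ℤ, jacobiTheta₂_term n x (I * c) =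
      cexp (2 * Real.pi * I * n * x - Real.pi * c * n ^ 2) := by
    intro n
    rw [jacobiTheta₂_term]
    congr 1
    linear_combination (Real.pi * n ^ 2 * c : ℂ) * I_sq
  have hterm' : ∀ n : ℤ, cexp (-Real.pi * I * x ^ 2 / (I * c)) *
      jacobiTheta₂_term n (x / (I * c)) (-1 / (I * c)) =
      cexp (-Real.pi / c * (n - x) ^ 2) := by
    intro n
    rw [jacobiTheta₂_term, ← Complex.exp_add]
    congr 1
    field_simp
    ring
  have hneg : -I * (I * c) = c := by linear_combination (-c) * I_sq
  interval_cases κ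
  · simp only [pow_zero, one_mul, mul_one]
    calc _ = jacobiTheta₂ x (I * c) := by
          rw [jacobiTheta₂]; exact tsum_congr fun n => (hterm n).symm
      _ = _ := by
          rw [jacobiTheta₂_functional_equation, hneg, mul_assoc, jacobiTheta₂, ← tsum_mul_left]
          simp_rw [hterm']
  · simp only [pow_one]
    have h1 : ∑' n : ℤ, (n : ℂ) * cexp (2 * Real.pi * I * n * x - Real.pi * c * n ^ 2) =
        1 / (2 * Real.pi * I) * jacobiTheta₂' x (I * c) := by
      rw [jacobiTheta₂', ← tsum_mul_left]
      refine tsum_congr fun n => ?_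
      rw [jacobiTheta₂'_term, hterm]
      field_simp
    rw [h1, jacobiTheta₂'_functional_equation, hneg]
    have h2 : jacobiTheta₂' (x / (I * c)) (-1 / (I * c)) -
        2 * Real.pi * I * x * jacobiTheta₂ (x / (I * c)) (-1 / (I * c)) =
        2 * Real.pi * I * ∑' n : ℤ, ((n : ℂ) - x) *
          jacobiTheta₂_term n (x / (I * c)) (-1 / (I * c)) := by
      rw [jacobiTheta₂', jacobiTheta₂, ← tsum_mul_left, ← tsum_mul_left,
        ← (hasSum_jacobiTheta₂'_term _ hτ').summable.tsum_sub
          ((hasSum_jacobiTheta₂_term _ hτ').summable.mul_left _)]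
      refine tsum_congr fun n => ?_
      rw [jacobiTheta₂'_term]; ring
    rw [h2]
    have h3 : ∑' n : ℤ, ((n : ℂ) - x) * cexp (-Real.pi / c * (n - x) ^ 2) =
        cexp (-Real.pi * I * x ^ 2 / (I * c)) * ∑' n : ℤ, ((n : ℂ) - x) *
          jacobiTheta₂_term n (x / (I * c)) (-1 / (I * c)) := by
      rw [← tsum_mul_left]
      refine tsum_congr fun n => ?_
      rw [← hterm' n]; ring
    rw [h3]
    field_simp

lemma norm_tsum_int_char_functional {N : ℕ} [NeZero N] {χ : DirichletCharacter ℂ N}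
    (hχ : χ.IsPrimitive) {κ : ℕ} (hκ : κ ≤ 1) {c : ℂ} (hc : 0 < c.re) :
    √N * ‖∑' n : ℤ, χ (n : ZMod N) * ((n : ℂ) ^ κ * cexp (-Real.pi * c * n ^ 2))‖ =
      ‖c‖ ^ (-(1 / 2 + κ : ℝ)) * ((N : ℝ)⁻¹) ^ κ *
      ‖∑' n : ℤ, χ⁻¹ (n : ZMod N) *
        ((n : ℂ) ^ κ * cexp (-Real.pi * (1 / (N ^ 2 * c)) * n ^ 2))‖ := by
  have hN : (N : ℂ) ≠ 0 := by exact_mod_cast NeZero.ne N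
  have hc0 : c ≠ 0 := by rintro rfl; simp at hc
  have hp : (χ⁻¹).IsPrimitive := by
    rw [DirichletCharacter.isPrimitive_def, DirichletCharacter.conductor_inv]; exact hχ
  set e := ZMod.stdAddChar (N := N) with he
  have hc' : 0 < (1 / (N ^ 2 * c)).re := by
    have h1 : (1 / (N ^ 2 * c) : ℂ) = ((1 / (N : ℝ) ^ 2 : ℝ) : ℂ) * (1 / c) := by
      push_cast; field_simp
    rw [h1, re_ofReal_mul, one_div c, inv_re]
    have : (0 : ℝ) < N := by exact_mod_cast Nat.pos_of_ne_zero (NeZero.ne N)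
    have := normSq_pos.2 hc0
    positivity
  have hchar : ∀ (n : ℤ) (b : Fin N), e (((n : ZMod N)) * ((b : ℕ) : ZMod N)) =
      cexp (2 * Real.pi * I * n * ((b : ℕ) / N : ℂ)) := by
    intro n b
    have : ((n : ZMod N)) * ((b : ℕ) : ZMod N) = ((n * (b : ℕ) : ℤ) : ZMod N) := by push_cast; rfl
    rw [this, he, ZMod.stdAddChar_coe]
    congr 1
    push_cast; ring
  have hsumFin : ∀ f : ZMod N → ℂ, ∑ b : ZMod N, f b = ∑ b : Fin N, f ((b : ℕ) : ZMod N) := by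
    intro f
    refine (Fintype.sum_equiv (ZMod.finEquiv N).toEquiv _ _ fun b => ?_).symm
    congr 1
    obtain ⟨m, rfl⟩ : ∃ m, N = m + 1 := ⟨N - 1, by have := NeZero.pos N; omega⟩
    exact Fin.cast_val_eq_self b
  have hG : gaussSum χ⁻¹ e *
      ∑' n : ℤ, χ (n : ZMod N) * ((n : ℂ) ^ κ * cexp (-Real.pi * c * n ^ 2)) =
      ∑ b : Fin N, χ⁻¹ ((b : ℕ) : ZMod N) * ∑' n : ℤ, (n : ℂ) ^ κ *
        cexp (2 * Real.pi * I * n * ((b : ℕ) / N : ℂ) - Real.pi * c * n ^ 2) := by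
    rw [← tsum_mul_left]
    simp_rw [← tsum_mul_left]
    rw [← Summable.tsum_finsetSum]
    · refine tsum_congr fun n => ?_
      have h1 := gaussSum_mulShift_of_isPrimitive e hp (n : ZMod N)
      rw [inv_inv] at h1
      rw [← mul_assoc, mul_comm (gaussSum _ _), ← h1, gaussSum, Finset.sum_mul, hsumFin]
      refine Finset.sum_congr rfl fun b _ => ?_
      rw [AddChar.mulShift_apply, hchar, sub_eq_add_neg, Complex.exp_add]
      ring_nf
    · intro b _
      exact (summable_int_pow_mul_exp hκ _ c hc).mul_left _
  have hR : ∑ b : Fin N, χ⁻¹ ((b : ℕ) : ZMod N) * ∑' n : ℤ, ((n : ℂ) - (b : ℕ) / N) ^ κ *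
        cexp (-Real.pi / c * (n - (b : ℕ) / N) ^ 2) =
      ((-1) / N) ^ κ * ∑' n : ℤ, χ⁻¹ (n : ZMod N) *
        ((n : ℂ) ^ κ * cexp (-Real.pi * (1 / (N ^ 2 * c)) * n ^ 2)) := by
    have hs : Summable fun n : ℤ => χ⁻¹ (n : ZMod N) *
        ((n : ℂ) ^ κ * cexp (-Real.pi * (1 / (N ^ 2 * c)) * n ^ 2)) := by
      have := summable_int_pow_mul_exp hκ 0 _ hc'
      refine Summable.of_norm_bounded this.norm fun n => ?_
      rw [norm_mul]
      calc _ ≤ 1 * _ := mul_le_mul_of_nonneg_right (DirichletCharacter.norm_le_one _ _)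
            (norm_nonneg _)
        _ = _ := by rw [one_mul]; congr 3; ring
    have hs3 := (Int.divModEquiv N).symm.summable_iff.2 hs
    simp only [Function.comp_def] at hs3
    have hs4 := hs3.prod_symm
    have hs5 : ∑' n : ℤ, χ⁻¹ (n : ZMod N) *
        ((n : ℂ) ^ κ * cexp (-Real.pi * (1 / (N ^ 2 * c)) * n ^ 2)) =
        ∑ b : Fin N, ∑' m : ℤ, χ⁻¹ (((Int.divModEquiv N).symm (m, b) : ℤ) : ZMod N) *
        ((((Int.divModEquiv N).symm (m, b) : ℤ) : ℂ) ^ κ * cexp (-Real.pi * (1 / (N ^ 2 * c)) *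
          (((Int.divModEquiv N).symm (m, b) : ℤ) : ℂ) ^ 2)) := by
      rw [← (Int.divModEquiv N).symm.tsum_eq, ← (Equiv.prodComm (Fin N) ℤ).tsum_eq]
      exact hs4.tsum_prod.trans (tsum_fintype _)
    rw [hs5, Finset.mul_sum]
    refine Finset.sum_congr rfl fun b _ => ?_
    rw [← (Equiv.neg ℤ).tsum_eq, ← tsum_mul_left, ← tsum_mul_left]
    refine tsum_congr fun n => ?_
    have h1 : (((Int.divModEquiv N).symm (n, b) : ℤ) : ZMod N) = ((b : ℕ) : ZMod N) := by
      simp [Int.divModEquiv_symm_apply]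
    have h2 : (((Int.divModEquiv N).symm (n, b) : ℤ) : ℂ) = N * (n + (b : ℕ) / N) := by
      simp only [Int.divModEquiv_symm_apply]; push_cast; field_simp
    have h3 : (((Equiv.neg ℤ) n : ℤ) : ℂ) - (b : ℕ) / N = (-1) * (n + (b : ℕ) / N) := by
      simp only [Equiv.neg_apply]; push_cast; ring
    rw [h1, h2, h3, mul_pow, mul_pow, div_pow, mul_pow (N : ℂ), mul_pow (N : ℂ)]
    have h4 : -(Real.pi : ℂ) * (1 / (N ^ 2 * c)) * (N ^ 2 * (n + (b : ℕ) / N) ^ 2) =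
      -Real.pi / c * ((-1) ^ 2 * (n + (b : ℕ) / N) ^ 2) := by field_simp
    rw [h4]
    field_simp
  have hfin : gaussSum χ⁻¹ e *
      ∑' n : ℤ, χ (n : ZMod N) * ((n : ℂ) ^ κ * cexp (-Real.pi * c * n ^ 2)) =
      1 / c ^ (1 / 2 : ℂ) * (1 / (I * c)) ^ κ * (((-1) / N) ^ κ * ∑' n : ℤ, χ⁻¹ (n : ZMod N) *
        ((n : ℂ) ^ κ * cexp (-Real.pi * (1 / (N ^ 2 * c)) * n ^ 2))) := by
    rw [hG, ← hR, Finset.mul_sum]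
    refine Finset.sum_congr rfl fun b _ => ?_
    rw [tsum_int_pow_mul_exp hκ _ c hc]
    ring
  have h := congrArg norm hfin
  rw [norm_mul, norm_gaussSum_of_isPrimitive hp] at h
  rw [h, norm_mul, norm_mul, norm_mul, ← mul_assoc]
  congr 2
  · have hcp : 0 < ‖c‖ := norm_pos_iff.2 hc0
    have h5 : ‖c ^ (1 / 2 : ℂ)‖ = ‖c‖ ^ (1 / 2 : ℝ) := by
      have := norm_cpow_real c (1 / 2)
      push_cast at this
      exact this
    rw [norm_div, h5, norm_pow, norm_div, norm_mul, norm_I, norm_one, one_mul, neg_add,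
      Real.rpow_add hcp, Real.rpow_neg hcp.le, Real.rpow_neg hcp.le, Real.rpow_natCast]
    simp only [one_div, inv_pow]
  · simp

/-- The sum `∑ χ(n) n ^ κ exp(-π n² c)`, a theta series attached to `χ`. -/
noncomputable def charTheta {N : ℕ} (χ : DirichletCharacter ℂ N) (κ : ℕ) (c : ℂ) : ℂ :=
  ∑' n : ℕ, χ (n : ZMod N) * ((n : ℂ) ^ κ * cexp (-Real.pi * c * n ^ 2))

lemma summable_nat_pow_mul_exp (κ : ℕ) {r : ℝ} (hr : 0 < r) :
    Summable fun n : ℕ => (n : ℝ) ^ κ * Real.exp (-r * n ^ 2) := by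
  refine Summable.of_nonneg_of_le (fun n => by positivity) (fun n => ?_)
    (Real.summable_pow_mul_exp_neg_nat_mul κ hr)
  have : (n : ℝ) ≤ (n : ℝ) ^ 2 := by exact_mod_cast Nat.le_self_pow two_ne_zero n
  exact mul_le_mul_of_nonneg_left (Real.exp_le_exp.2 (by nlinarith)) (by positivity)

lemma norm_charTheta_term_le {N : ℕ} (χ : DirichletCharacter ℂ N) (κ n : ℕ) (c : ℂ) :
    ‖χ (n : ZMod N) * ((n : ℂ) ^ κ * cexp (-Real.pi * c * n ^ 2))‖ ≤
      (n : ℝ) ^ κ * Real.exp (-(Real.pi * c.re) * n ^ 2) := by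
  rw [norm_mul, norm_mul, norm_pow, norm_natCast, norm_exp]
  have h1 : (-Real.pi * c * n ^ 2 : ℂ).re = -(Real.pi * c.re) * n ^ 2 := by
    have : (-Real.pi * c * n ^ 2 : ℂ) = ((-Real.pi * n ^ 2 : ℝ) : ℂ) * c := by push_cast; ring
    rw [this, re_ofReal_mul]; ring
  rw [h1]
  calc _ ≤ 1 * _ := mul_le_mul_of_nonneg_right (DirichletCharacter.norm_le_one _ _)
        (by positivity)
    _ = _ := one_mul _

lemma summable_charTheta {N : ℕ} (χ : DirichletCharacter ℂ N) (κ : ℕ) {c : ℂ} (hc : 0 < c.re) :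
    Summable fun n : ℕ => χ (n : ZMod N) * ((n : ℂ) ^ κ * cexp (-Real.pi * c * n ^ 2)) :=
  Summable.of_norm_bounded (summable_nat_pow_mul_exp κ (mul_pos Real.pi_pos hc))
    fun n => norm_charTheta_term_le χ κ n c

lemma tsum_int_eq_two_mul_charTheta {N : ℕ} (hN : N ≠ 1) {χ : DirichletCharacter ℂ N} {κ : ℕ}
    (hκ : χ (-1) = (-1) ^ κ) {c : ℂ} (hc : 0 < c.re) :
    ∑' n : ℤ, χ (n : ZMod N) * ((n : ℂ) ^ κ * cexp (-Real.pi * c * n ^ 2)) =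
      2 * charTheta χ κ c := by
  have h := (summable_charTheta χ κ hc).hasSum
  have hneg : ∀ n : ℕ, χ ((-(n : ℤ) : ℤ) : ZMod N) *
      (((-(n : ℤ) : ℤ) : ℂ) ^ κ * cexp (-Real.pi * c * ((-(n : ℤ) : ℤ) : ℂ) ^ 2)) =
      χ (n : ZMod N) * ((n : ℂ) ^ κ * cexp (-Real.pi * c * n ^ 2)) := by
    intro n
    have h1 : ((-(n : ℤ) : ℤ) : ZMod N) = -1 * (n : ZMod N) := by push_cast; ring
    have h2 : ((-(n : ℤ) : ℤ) : ℂ) = -1 * n := by push_cast; ring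
    have h3 : ((-1 : ℂ) ^ κ) * (-1) ^ κ = 1 := by rw [← mul_pow]; simp
    rw [h1, h2, map_mul, hκ, mul_pow, mul_pow (-1 : ℂ) _ 2]
    calc _ = ((-1 : ℂ) ^ κ * (-1) ^ κ) * (χ (n : ZMod N) * ((n : ℂ) ^ κ *
          cexp (-Real.pi * c * ((-1) ^ 2 * n ^ 2)))) := by ring
      _ = _ := by rw [h3, one_mul]; norm_num
  have h' := HasSum.of_nat_of_neg (f := fun n : ℤ => χ (n : ZMod N) *
    ((n : ℂ) ^ κ * cexp (-Real.pi * c * n ^ 2))) (by simpa using h)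
    (by simpa only [hneg] using h)
  rw [h'.tsum_eq]
  simp [DirichletCharacter.map_zero' χ hN, charTheta]
  ring

/-- The modular transformation of the theta series of a real primitive character. -/
theorem norm_charTheta_functional {N : ℕ} [NeZero N] (hN : N ≠ 1) {χ : DirichletCharacter ℂ N}
    (hχ : χ.IsPrimitive) (hreal : χ⁻¹ = χ) {κ : ℕ} (hκ1 : κ ≤ 1) (hκ : χ (-1) = (-1) ^ κ)
    {x : ℂ} (hx : 0 < x.re) :
    ‖charTheta χ κ (x / N)‖ = ‖x‖ ^ (-(1 / 2 + κ : ℝ)) * ‖charTheta χ κ (1 / (x * N))‖ := by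
  have hNp : (0 : ℝ) < N := by exact_mod_cast Nat.pos_of_ne_zero (NeZero.ne N)
  have hNc : (N : ℂ) ≠ 0 := by exact_mod_cast NeZero.ne N
  have hx0 : x ≠ 0 := by rintro rfl; simp at hx
  have h1 : 0 < (x / N).re := by
    have := div_natCast_re x N
    rw [this]; positivity
  have h2 : 0 < (1 / (x * N)).re := by
    have h : (1 / (x * N) : ℂ) = (1 / x) / N := by field_simp
    rw [h, div_natCast_re, one_div, inv_re]
    have := normSq_pos.2 hx0
    positivity
  have h := norm_tsum_int_char_functional hχ hκ1 h1
  have h3 : (1 / ((N : ℂ) ^ 2 * (x / N))) = 1 / (x * N) := by field_simp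
  rw [h3, hreal, tsum_int_eq_two_mul_charTheta hN hκ h1, tsum_int_eq_two_mul_charTheta hN hκ h2,
    norm_mul, norm_mul, norm_div, norm_natCast, Real.div_rpow (norm_nonneg _) hNp.le] at h
  have h4 : (N : ℝ) ^ (-(1 / 2 + κ : ℝ)) = (√N)⁻¹ * ((N : ℝ)⁻¹) ^ κ := by
    rw [neg_add, Real.rpow_add hNp, Real.rpow_neg hNp.le, Real.rpow_neg hNp.le,
      Real.rpow_natCast, Real.sqrt_eq_rpow, inv_pow]
  rw [h4] at h
  have hs : 0 < √(N : ℝ) := Real.sqrt_pos.2 hNp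
  have hn2 : ‖(2 : ℂ)‖ = 2 := by simp
  rw [hn2] at h
  have h5 : √(N : ℝ) * (2 * ‖charTheta χ κ (x / N)‖) = √(N : ℝ) *
      (2 * (‖x‖ ^ (-(1 / 2 + κ : ℝ)) * ‖charTheta χ κ (1 / (x * N))‖)) := by
    rw [h]; field_simp
  exact mul_left_cancel₀ two_ne_zero (mul_left_cancel₀ hs.ne' h5)

end Theta

section Mellin

open MeasureTheory Set

lemma norm_cpow_sub_one_mul_exp {a r : ℂ} {t : ℝ} (ht : 0 < t) :
    ‖(t : ℂ) ^ (a - 1) * cexp (-(r * t))‖ = t ^ (a.re - 1) * Real.exp (-(r.re * t)) := by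
  rw [norm_mul, norm_cpow_eq_rpow_re_of_pos ht, norm_exp]
  simp

lemma continuousOn_cpow_sub_one_mul_exp (a r : ℂ) :
    ContinuousOn (fun t : ℝ => (t : ℂ) ^ (a - 1) * cexp (-(r * t))) (Ioi 0) := by
  refine ContinuousOn.mul (fun t ht => ?_) (by fun_prop)
  refine ContinuousAt.continuousWithinAt ?_
  exact continuousAt_ofReal_cpow_const _ _ (Or.inr (ne_of_gt ht))

lemma integrableOn_rpow_sub_one_mul_exp {σ r : ℝ} (hσ : 0 < σ) (hr : 0 < r) :
    IntegrableOn (fun t : ℝ => t ^ (σ - 1) * Real.exp (-(r * t))) (Ioi 0) := by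
  have := integrableOn_rpow_mul_exp_neg_mul_rpow (s := σ - 1) (by linarith) zero_lt_one hr
  simpa [neg_mul] using this

lemma integrableOn_cpow_sub_one_mul_exp {a r : ℂ} (ha : 0 < a.re) (hr : 0 < r.re) :
    IntegrableOn (fun t : ℝ => (t : ℂ) ^ (a - 1) * cexp (-(r * t))) (Ioi 0) := by
  refine Integrable.mono' (integrableOn_rpow_sub_one_mul_exp ha hr)
    ((continuousOn_cpow_sub_one_mul_exp a r).aestronglyMeasurable measurableSet_Ioi) ?_
  filter_upwards [ae_restrict_mem measurableSet_Ioi] with t ht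
  exact (norm_cpow_sub_one_mul_exp ht).le

lemma hasDerivAt_integral_cpow_mul_exp {a r : ℂ} (ha : 0 < a.re) (hr : 0 < r.re) :
    HasDerivAt (fun r : ℂ => ∫ t in Ioi (0 : ℝ), (t : ℂ) ^ (a - 1) * cexp (-(r * t)))
      (∫ t in Ioi (0 : ℝ), (t : ℂ) ^ (a - 1) * (cexp (-(r * t)) * (-t))) r := by
  have hball : ∀ x ∈ Metric.ball r (r.re / 2), r.re / 2 ≤ x.re := by
    intro x hx
    rw [mem_ball_iff_norm] at hx
    have := (abs_le.1 ((abs_re_le_norm (x - r)).trans hx.le)).1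
    rw [sub_re] at this
    linarith
  refine (hasDerivAt_integral_of_dominated_loc_of_deriv_le
    (F := fun (r : ℂ) (t : ℝ) => (t : ℂ) ^ (a - 1) * cexp (-(r * t)))
    (F' := fun (r : ℂ) (t : ℝ) => (t : ℂ) ^ (a - 1) * (cexp (-(r * t)) * (-t)))
    (μ := volume.restrict (Ioi 0))
    (bound := fun t => t ^ ((a.re + 1) - 1) * Real.exp (-(r.re / 2 * t)))
    (Metric.ball_mem_nhds r (half_pos hr)) ?_ (integrableOn_cpow_sub_one_mul_exp ha hr) ?_ ?_
    (integrableOn_rpow_sub_one_mul_exp (by linarith) (half_pos hr)) ?_).2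
  · exact Filter.Eventually.of_forall fun x =>
      (continuousOn_cpow_sub_one_mul_exp a x).aestronglyMeasurable measurableSet_Ioi
  · have : ContinuousOn (fun t : ℝ => ((t : ℂ) ^ (a - 1) * cexp (-(r * t))) * (-t)) (Ioi 0) :=
      (continuousOn_cpow_sub_one_mul_exp a r).mul (by fun_prop)
    exact (this.congr fun t _ => by ring).aestronglyMeasurable measurableSet_Ioi
  · filter_upwards [ae_restrict_mem measurableSet_Ioi] with t ht x hx
    have ht' : 0 < t := ht
    rw [← mul_assoc, norm_mul, norm_cpow_sub_one_mul_exp ht, norm_neg, norm_real,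
      Real.norm_of_nonneg ht'.le, add_sub_cancel_right]
    have h1 : t ^ (a.re - 1) * t = t ^ a.re := by
      rw [← Real.rpow_add_one ht'.ne']; congr 1; ring
    calc _ = (t ^ (a.re - 1) * t) * Real.exp (-(x.re * t)) := by ring
      _ ≤ _ := by
        rw [h1]
        refine mul_le_mul_of_nonneg_left (Real.exp_le_exp.2 ?_) (by positivity)
        have := mul_le_mul_of_nonneg_right (hball x hx) ht'.le
        linarith
  · filter_upwards with t x hx
    refine HasDerivAt.const_mul _ ?_
    refine HasDerivAt.cexp ?_
    simpa using ((hasDerivAt_id x).mul_const (t : ℂ)).fun_neg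

lemma isOpen_re_pos : IsOpen {r : ℂ | 0 < r.re} := isOpen_lt continuous_const continuous_re

lemma isPreconnected_re_pos : IsPreconnected {r : ℂ | 0 < r.re} :=
  (convex_halfSpace_re_gt 0).isPreconnected

/-- The Gamma integral with a complex scaling parameter. -/
lemma integral_cpow_mul_exp_neg_complex_mul_Ioi {a r : ℂ} (ha : 0 < a.re) (hr : 0 < r.re) :
    ∫ t in Ioi (0 : ℝ), (t : ℂ) ^ (a - 1) * cexp (-(r * t)) = (1 / r) ^ a * Gamma a := by
  have h1 : AnalyticOnNhd ℂ (fun r : ℂ => ∫ t in Ioi (0 : ℝ), (t : ℂ) ^ (a - 1) * cexp (-(r * t)))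
      {r : ℂ | 0 < r.re} := by
    refine DifferentiableOn.analyticOnNhd (fun x hx => ?_) isOpen_re_pos
    exact (hasDerivAt_integral_cpow_mul_exp ha hx).differentiableAt.differentiableWithinAt
  have hinv : ∀ x : ℂ, 0 < x.re → 0 < (1 / x).re := fun x hx => by
    rw [one_div, inv_re]
    exact div_pos hx (normSq_pos.2 (by rintro rfl; simp at hx))
  have h2 : AnalyticOnNhd ℂ (fun r : ℂ => (1 / r) ^ a * Gamma a) {r : ℂ | 0 < r.re} := by
    refine DifferentiableOn.analyticOnNhd (fun x hx => ?_) isOpen_re_pos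
    have hx' : 0 < x.re := hx
    have hx0 : x ≠ 0 := by rintro rfl; simp at hx'
    refine DifferentiableAt.differentiableWithinAt ?_
    refine DifferentiableAt.mul_const ?_ _
    refine DifferentiableAt.cpow_const (by fun_prop (disch := assumption)) ?_
    exact Or.inl (hinv x hx')
  have hfreq : ∃ᶠ x in nhdsWithin (1 : ℂ) {1}ᶜ,
      (∫ t in Ioi (0 : ℝ), (t : ℂ) ^ (a - 1) * cexp (-(x * t))) = (1 / x) ^ a * Gamma a := by
    have ht : Filter.Tendsto (fun n : ℕ => ((1 + 1 / ((n : ℝ) + 1) : ℝ) : ℂ)) Filter.atTop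
        (nhdsWithin (1 : ℂ) {1}ᶜ) := by
      refine tendsto_nhdsWithin_iff.2 ⟨?_, Filter.Eventually.of_forall fun n => ?_⟩
      · have := (tendsto_const_nhds (x := (1 : ℝ))).add
          (tendsto_one_div_add_atTop_nhds_zero_nat (𝕜 := ℝ))
        rw [add_zero] at this
        exact (continuous_ofReal.tendsto 1).comp this
      · have h : (1 : ℝ) / ((n : ℝ) + 1) ≠ 0 := by positivity
        intro hmem
        have h' : ((1 + 1 / ((n : ℝ) + 1) : ℝ) : ℂ) = 1 := hmem
        rw [ofReal_eq_one] at h'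
        exact h (by linarith)
    refine ht.frequently (Filter.Frequently.of_forall fun n => ?_)
    exact Complex.integral_cpow_mul_exp_neg_mul_Ioi ha (by positivity)
  exact h1.eqOn_of_preconnected_of_frequently_eq h2 isPreconnected_re_pos
    (z₀ := 1) (by simp) hfreq hr

lemma continuousOn_charTheta {N : ℕ} (χ : DirichletCharacter ℂ N) (κ : ℕ) :
    ContinuousOn (charTheta χ κ) {c | 0 < c.re} := by
  intro c hc
  have hc' : 0 < c.re := hc
  have h : ContinuousOn (charTheta χ κ) {x | c.re / 2 < x.re} := by
    refine continuousOn_tsum (fun n => by fun_prop)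
      (summable_nat_pow_mul_exp κ (mul_pos Real.pi_pos (half_pos hc'))) fun n x hx => ?_
    refine (norm_charTheta_term_le χ κ n x).trans ?_
    have hx' : c.re / 2 < x.re := hx
    refine mul_le_mul_of_nonneg_left (Real.exp_le_exp.2 ?_) (by positivity)
    have := mul_le_mul_of_nonneg_right hx'.le (mul_nonneg Real.pi_pos.le (sq_nonneg (n : ℝ)))
    nlinarith
  refine (h.continuousAt ?_).continuousWithinAt
  exact (isOpen_lt continuous_const continuous_re).mem_nhds (half_lt_self hc')

lemma exists_norm_charTheta_le {N : ℕ} (hN : N ≠ 1) (χ : DirichletCharacter ℂ N) (κ : ℕ) {r : ℝ}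
    (hr : 0 < r) : ∃ C : ℝ, 0 ≤ C ∧ ∀ c : ℂ, r ≤ c.re →
      ‖charTheta χ κ c‖ ≤ C * Real.exp (-c.re) := by
  set u : ℕ → ℝ := fun n => (n : ℝ) ^ κ * Real.exp (-((Real.pi - 1) * r) * n ^ 2) with hu
  have hpi : 0 < Real.pi - 1 := by linarith [Real.pi_gt_three]
  have hus : Summable u := summable_nat_pow_mul_exp κ (by positivity)
  refine ⟨∑' n, u n, tsum_nonneg fun n => by positivity, fun c hc => ?_⟩
  have hc0 : 0 < c.re := hr.trans_le hc
  rw [← tsum_mul_right]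
  refine tsum_of_norm_bounded (hus.mul_right _).hasSum fun n => ?_
  rcases Nat.eq_zero_or_pos n with rfl | hn
  · simp only [Nat.cast_zero, DirichletCharacter.map_zero' χ hN, zero_mul, norm_zero]
    positivity
  · refine (norm_charTheta_term_le χ κ n c).trans ?_
    rw [hu, mul_assoc, ← Real.exp_add]
    refine mul_le_mul_of_nonneg_left (Real.exp_le_exp.2 ?_) (by positivity)
    have h1 : (1 : ℝ) ≤ (n : ℝ) ^ 2 := by
      have : (1 : ℝ) ≤ n := by exact_mod_cast hn
      nlinarith
    have h2 := mul_le_mul_of_nonneg_left hc (mul_nonneg hpi.le (sq_nonneg (n : ℝ)))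
    have h3 := mul_le_mul_of_nonneg_right h1 hc0.le
    nlinarith

lemma continuousOn_charTheta_ray {N : ℕ} (χ : DirichletCharacter ℂ N) (κ : ℕ) {z : ℂ}
    (hz : 0 < z.re) : ContinuousOn (fun v : ℝ => charTheta χ κ (z * v)) (Ioi 0) := by
  refine (continuousOn_charTheta χ κ).comp (by fun_prop) fun v hv => ?_
  have hv' : 0 < v := hv
  simpa using mul_pos hz hv'

lemma charTheta_ray_isBigO_atTop {N : ℕ} (hN : N ≠ 1) (χ : DirichletCharacter ℂ N) (κ : ℕ) {z : ℂ}
    (hz : 0 < z.re) (a : ℝ) :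
    (fun v : ℝ => charTheta χ κ (z * v)) =O[Filter.atTop] fun v => v ^ a := by
  obtain ⟨C, hC, h⟩ := exists_norm_charTheta_le hN χ κ hz
  refine Asymptotics.IsBigO.trans ?_ (isLittleO_exp_neg_mul_rpow_atTop hz a).isBigO
  refine Asymptotics.IsBigO.of_bound C ?_
  filter_upwards [Filter.eventually_ge_atTop 1] with v hv
  have h1 : (z * (v : ℂ)).re = z.re * v := by simp
  have := h (z * v) (by rw [h1]; nlinarith)
  rw [Real.norm_of_nonneg (Real.exp_pos _).le, neg_mul, ← h1]
  exact this

lemma charTheta_ray_isBigO_zero {N : ℕ} [NeZero N] (hN : N ≠ 1) {χ : DirichletCharacter ℂ N}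
    (hχ : χ.IsPrimitive) (hreal : χ⁻¹ = χ) {κ : ℕ} (hκ1 : κ ≤ 1) (hκ : χ (-1) = (-1) ^ κ)
    {z : ℂ} (hz : 0 < z.re) (a : ℝ) :
    (fun v : ℝ => charTheta χ κ (z * v)) =O[nhdsWithin 0 (Ioi 0)] fun v => v ^ a := by
  have hNp : (0 : ℝ) < N := by exact_mod_cast Nat.pos_of_ne_zero (NeZero.ne N)
  have hNc : (N : ℂ) ≠ 0 := by exact_mod_cast NeZero.ne N
  have hz0 : z ≠ 0 := by rintro rfl; simp at hz
  have hz' : 0 < (1 / (z * N ^ 2)).re := by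
    have h : (1 / (z * N ^ 2) : ℂ) = ((1 / (N : ℝ) ^ 2 : ℝ) : ℂ) * (1 / z) := by
      push_cast; field_simp
    rw [h, re_ofReal_mul, one_div z, inv_re]
    have := normSq_pos.2 hz0
    positivity
  have h1 := (charTheta_ray_isBigO_atTop hN χ κ hz' (-(a + (1 / 2 + κ)))).comp_tendsto
    tendsto_inv_nhdsGT_zero
  have h2 : (fun v : ℝ => charTheta χ κ (z * v)) =O[nhdsWithin 0 (Ioi 0)] fun v : ℝ =>
      (‖z‖ * N * v) ^ (-(1 / 2 + κ : ℝ)) * ‖charTheta χ κ (1 / (z * N ^ 2) * (v⁻¹ : ℝ))‖ := by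
    refine Asymptotics.IsBigO.of_bound 1 ?_
    filter_upwards [self_mem_nhdsWithin] with v hv
    have hv' : 0 < v := hv
    have hvc : (v : ℂ) ≠ 0 := by exact_mod_cast hv'.ne'
    have hre : 0 < (z * v * N).re := by
      have : z * v * N = ((v * N : ℝ) : ℂ) * z := by push_cast; ring
      rw [this, re_ofReal_mul]; positivity
    have h := norm_charTheta_functional hN hχ hreal hκ1 hκ hre
    rw [mul_div_assoc, div_self hNc, mul_one] at h
    have e1 : 1 / (z * v * N * N) = 1 / (z * N ^ 2) * ((v⁻¹ : ℝ) : ℂ) := by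
      push_cast; field_simp
    have e2 : ‖z * v * N‖ = ‖z‖ * N * v := by
      rw [norm_mul, norm_mul, norm_natCast, norm_real, Real.norm_of_nonneg hv'.le]; ring
    rw [h, e1, e2, one_mul, norm_mul, norm_norm]
    exact mul_le_mul_of_nonneg_right (le_abs_self _) (norm_nonneg _)
  refine h2.trans ?_
  have h3 : (fun v : ℝ => (‖z‖ * N * v) ^ (-(1 / 2 + κ : ℝ))) =O[nhdsWithin 0 (Ioi 0)]
      fun v : ℝ => v ^ (-(1 / 2 + κ : ℝ)) := by
    refine Asymptotics.IsBigO.of_bound ((‖z‖ * N) ^ (-(1 / 2 + κ : ℝ))) ?_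
    filter_upwards [self_mem_nhdsWithin] with v hv
    have hv' : 0 < v := hv
    rw [Real.mul_rpow (by positivity) hv'.le, norm_mul, Real.norm_of_nonneg (by positivity)]
  refine (h3.mul h1.norm_left).congr' ?_ ?_
  · filter_upwards with v
    rfl
  · filter_upwards [self_mem_nhdsWithin] with v hv
    have hv' : 0 < v := hv
    rw [Function.comp_apply, Real.inv_rpow hv'.le, ← Real.rpow_neg hv'.le, ← Real.rpow_add hv']
    congr 1; ring

lemma one_div_natCast_sq_mul_cpow {n : ℕ} (hn : n ≠ 0) {y : ℂ} (hy : y ≠ 0) (w : ℂ) :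
    (1 / ((n : ℂ) ^ 2) * y) ^ w = (n : ℂ) ^ (-2 * w) * y ^ w := by
  have hnp : (0 : ℝ) < n := by exact_mod_cast Nat.pos_of_ne_zero hn
  have hnc : (n : ℂ) ≠ 0 := by exact_mod_cast hn
  have h1 : (1 / ((n : ℂ) ^ 2) * y) = (((n : ℝ) ^ (-2 : ℤ) : ℝ) : ℂ) * y := by
    push_cast; rw [zpow_neg]; norm_cast; simp
  have h2 : (0 : ℝ) < (n : ℝ) ^ (-2 : ℤ) := by positivity
  have h3 : (((n : ℝ) ^ (-2 : ℤ) : ℝ) : ℂ) * y ≠ 0 := mul_ne_zero (by exact_mod_cast h2.ne') hy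
  rw [h1, cpow_def_of_ne_zero h3, cpow_def_of_ne_zero hnc, cpow_def_of_ne_zero hy,
    log_ofReal_mul h2 hy, ← Complex.exp_add, Real.log_zpow, ← natCast_log]
  congr 1
  push_cast; ring

lemma mellin_charTheta_of_one_lt {N : ℕ} [NeZero N] (hN : N ≠ 1) (χ : DirichletCharacter ℂ N)
    (κ : ℕ) {z : ℂ} (hz : 0 < z.re) {w : ℂ} (hw : 1 + κ < 2 * w.re) :
    mellin (fun v : ℝ => charTheta χ κ (z * v)) w =
      Gamma w * (1 / (Real.pi * z)) ^ w * DirichletCharacter.LFunction χ (2 * w - κ) := by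
  have hw0 : 0 < w.re := by have : (0 : ℝ) ≤ κ := κ.cast_nonneg; linarith
  have hz0 : z ≠ 0 := by rintro rfl; simp at hz
  have hpi : (Real.pi : ℂ) ≠ 0 := by exact_mod_cast Real.pi_ne_zero
  have hre : ∀ n : ℕ, n ≠ 0 → 0 < (Real.pi * z * n ^ 2 : ℂ).re := by
    intro n hn
    have : (Real.pi * z * n ^ 2 : ℂ) = ((Real.pi * n ^ 2 : ℝ) : ℂ) * z := by push_cast; ring
    rw [this, re_ofReal_mul]
    have : (0 : ℝ) < n := by exact_mod_cast Nat.pos_of_ne_zero hn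
    positivity
  set F : ℕ → ℝ → ℂ := fun n v =>
    (χ (n : ZMod N) * n ^ κ) * ((v : ℂ) ^ (w - 1) * cexp (-((Real.pi * z * n ^ 2) * v))) with hF
  have hF0 : F 0 = 0 := by
    funext v; simp [hF, DirichletCharacter.map_zero' χ hN]
  have hFint : ∀ n, IntegrableOn (F n) (Ioi 0) := by
    intro n
    rcases eq_or_ne n 0 with rfl | hn
    · rw [hF0]; exact integrableOn_zero
    · exact (integrableOn_cpow_sub_one_mul_exp hw0 (hre n hn)).const_mul _
  have hFval : ∀ n, ∫ v in Ioi (0 : ℝ), F n v = Gamma w * (1 / (Real.pi * z)) ^ w *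
      LSeries.term (fun x => χ x) (2 * w - κ) n := by
    intro n
    rcases eq_or_ne n 0 with rfl | hn
    · rw [hF0]; simp
    · have hnc : (n : ℂ) ≠ 0 := by exact_mod_cast hn
      have h1 : (1 / (Real.pi * z * n ^ 2) : ℂ) = 1 / (n : ℂ) ^ 2 * (1 / (Real.pi * z)) := by
        field_simp
      rw [LSeries.term_of_ne_zero hn, integral_const_mul,
        integral_cpow_mul_exp_neg_complex_mul_Ioi hw0 (hre n hn), h1,
        one_div_natCast_sq_mul_cpow hn (one_div_ne_zero (mul_ne_zero hpi hz0)),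
        div_eq_mul_inv (χ n), ← cpow_neg, neg_sub, sub_eq_add_neg (κ : ℂ), cpow_add _ _ hnc, cpow_natCast]
      ring_nf
  have hnorm : ∀ n, ∫ v in Ioi (0 : ℝ), ‖F n v‖ ≤ Real.Gamma w.re * (1 / (Real.pi * z.re)) ^ w.re *
      (n : ℝ) ^ (κ - 2 * w.re) := by
    intro n
    rcases eq_or_ne n 0 with rfl | hn
    · rw [hF0]
      have := Real.Gamma_pos_of_pos hw0
      simp only [Pi.zero_apply, norm_zero, integral_zero]
      positivity
    · have hnp : (0 : ℝ) < n := by exact_mod_cast Nat.pos_of_ne_zero hn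
      have e1 : (Real.pi * z * n ^ 2 : ℂ).re = n ^ 2 * (Real.pi * z.re) := by
        have : (Real.pi * z * n ^ 2 : ℂ) = ((Real.pi * n ^ 2 : ℝ) : ℂ) * z := by push_cast; ring
        rw [this, re_ofReal_mul]; ring
      have h1 : ∫ v in Ioi (0 : ℝ), ‖F n v‖ = ‖χ (n : ZMod N) * n ^ κ‖ *
          ((1 / (n ^ 2 * (Real.pi * z.re))) ^ w.re * Real.Gamma w.re) := by
        rw [← Real.integral_rpow_mul_exp_neg_mul_Ioi hw0 (by positivity), ← integral_const_mul]
        refine setIntegral_congr_fun measurableSet_Ioi fun v hv => ?_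
        change ‖(χ (n : ZMod N) * n ^ κ) *
          ((v : ℂ) ^ (w - 1) * cexp (-((Real.pi * z * n ^ 2) * v)))‖ = _
        rw [norm_mul, norm_cpow_sub_one_mul_exp hv, e1]
      have h2 : ‖χ (n : ZMod N) * (n : ℂ) ^ κ‖ ≤ (n : ℝ) ^ (κ : ℝ) := by
        rw [norm_mul, norm_pow, Complex.norm_natCast, Real.rpow_natCast]
        calc _ ≤ 1 * (n : ℝ) ^ κ := by
              gcongr; exact DirichletCharacter.norm_le_one _ _
          _ = _ := one_mul _
      have h3 : (1 / (n ^ 2 * (Real.pi * z.re))) ^ w.re =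
          (n : ℝ) ^ (-(2 * w.re)) * (1 / (Real.pi * z.re)) ^ w.re := by
        have : 1 / ((n : ℝ) ^ 2 * (Real.pi * z.re)) = (n : ℝ) ^ (-2 : ℝ) * (1 / (Real.pi * z.re)) := by
          rw [Real.rpow_neg hnp.le]; norm_cast; field_simp
        rw [this, Real.mul_rpow (by positivity) (by positivity), ← Real.rpow_mul hnp.le]
        ring_nf
      have := Real.Gamma_pos_of_pos hw0
      rw [h1, h3, sub_eq_add_neg, Real.rpow_add hnp]
      calc _ ≤ (n : ℝ) ^ (κ : ℝ) * ((n : ℝ) ^ (-(2 * w.re)) * (1 / (Real.pi * z.re)) ^ w.re *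
            Real.Gamma w.re) := by gcongr
        _ = _ := by ring
  have hsum : Summable fun n => ∫ v in Ioi (0 : ℝ), ‖F n v‖ := by
    refine Summable.of_nonneg_of_le (fun n => integral_nonneg fun v => norm_nonneg _) hnorm ?_
    exact (Real.summable_nat_rpow.2 (by linarith)).mul_left _
  have h := hasSum_integral_of_summable_integral_norm hFint hsum
  have h1 : mellin (fun v : ℝ => charTheta χ κ (z * v)) w =
      ∫ v in Ioi (0 : ℝ), ∑' n, F n v := by
    rw [mellin]
    refine setIntegral_congr_fun measurableSet_Ioi fun v hv => ?_
    simp only [charTheta, smul_eq_mul, hF]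
    rw [← tsum_mul_left]
    refine tsum_congr fun n => ?_
    have : (-Real.pi * (z * v) * n ^ 2 : ℂ) = -((Real.pi * z * n ^ 2) * v) := by ring
    rw [this]; ring
  rw [h1, ← h.tsum_eq, DirichletCharacter.LFunction_eq_LSeries, LSeries, ← tsum_mul_left]
  · exact tsum_congr hFval
  · simp; linarith

/-- The completed `L`-function as the Mellin transform of the theta series along a ray. -/
theorem mellin_charTheta {N : ℕ} [NeZero N] (hN : N ≠ 1) {χ : DirichletCharacter ℂ N}
    (hχ : χ.IsPrimitive) (hχ1 : χ ≠ 1) (hreal : χ⁻¹ = χ) {κ : ℕ} (hκ1 : κ ≤ 1)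
    (hκ : χ (-1) = (-1) ^ κ) {z : ℂ} (hz : 0 < z.re) {w : ℂ} (hw : 0 < w.re) :
    mellin (fun v : ℝ => charTheta χ κ (z * v)) w =
      Gamma w * (1 / (Real.pi * z)) ^ w * DirichletCharacter.LFunction χ (2 * w - κ) := by
  have hz0 : z ≠ 0 := by rintro rfl; simp at hz
  have hpi : (Real.pi : ℂ) ≠ 0 := by exact_mod_cast Real.pi_ne_zero
  have h1 : AnalyticOnNhd ℂ (mellin (fun v : ℝ => charTheta χ κ (z * v))) {r : ℂ | 0 < r.re} := by
    refine DifferentiableOn.analyticOnNhd (fun x _ => ?_) isOpen_re_pos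
    refine DifferentiableAt.differentiableWithinAt ?_
    refine mellin_differentiableAt_of_isBigO_rpow (a := x.re + 1) (b := x.re - 1)
      ((continuousOn_charTheta_ray χ κ hz).locallyIntegrableOn measurableSet_Ioi)
      (charTheta_ray_isBigO_atTop hN χ κ hz _) (by linarith)
      (charTheta_ray_isBigO_zero hN hχ hreal hκ1 hκ hz _) (by linarith)
  have h2 : AnalyticOnNhd ℂ (fun w => Gamma w * (1 / (Real.pi * z)) ^ w *
      DirichletCharacter.LFunction χ (2 * w - κ)) {r : ℂ | 0 < r.re} := by
    refine DifferentiableOn.analyticOnNhd (fun x hx => ?_) isOpen_re_pos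
    have hx' : 0 < x.re := hx
    refine DifferentiableAt.differentiableWithinAt ?_
    refine (DifferentiableAt.mul ?_ ?_).mul ?_
    · refine differentiableAt_Gamma x fun m h => ?_
      rw [h] at hx'
      simp at hx'
      linarith [(m.cast_nonneg : (0 : ℝ) ≤ m)]
    · exact DifferentiableAt.const_cpow (by fun_prop)
        (Or.inl (one_div_ne_zero (mul_ne_zero hpi hz0)))
    · exact (DirichletCharacter.differentiable_LFunction hχ1 _).comp x (by fun_prop)
  refine h1.eqOn_of_preconnected_of_eventuallyEq h2 isPreconnected_re_pos (z₀ := 2) (by simp) ?_ hw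
  have hopen : IsOpen {r : ℂ | 1 < r.re} := isOpen_lt continuous_const continuous_re
  filter_upwards [hopen.mem_nhds (by simp : (2 : ℂ) ∈ {r : ℂ | 1 < r.re})] with x hx
  have hx' : 1 < x.re := hx
  refine mellin_charTheta_of_one_lt hN χ κ hz ?_
  have : (κ : ℝ) ≤ 1 := by exact_mod_cast hκ1
  linarith

end Mellin

section GammaBounds

/-- A constant for the approximate logarithmic convexity of `|Γ|` on vertical lines. -/
noncomputable def gammaConst : ℝ := Real.exp (∑' j : ℕ, 1 / (4 * ((j : ℝ) + 1 / 4) ^ 2))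

lemma gammaConst_pos : 0 < gammaConst := Real.exp_pos _

lemma summable_gammaConst : Summable fun j : ℕ => 1 / (4 * ((j : ℝ) + 1 / 4) ^ 2) := by
  have h : Summable fun j : ℕ => 1 / |(j : ℝ) + 1 / 4| ^ (2 : ℝ) :=
    (Real.summable_one_div_nat_add_rpow (1 / 4) 2).2 one_lt_two
  refine (h.mul_left (1 / 4)).congr fun j => ?_
  norm_cast
  rw [sq_abs]
  field_simp

lemma norm_mul_norm_le_exp {a τ b : ℝ} (hb : 0 < b) (hab : b ≤ a) :
    ‖((a - 1 / 2 : ℝ) : ℂ) + τ * I‖ * ‖((a + 1 / 2 : ℝ) : ℂ) + τ * I‖ ≤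
      ‖(a : ℂ) + τ * I‖ ^ 2 * Real.exp (1 / (4 * b ^ 2)) := by
  have hsq : ∀ x : ℝ, ‖(x : ℂ) + τ * I‖ ^ 2 = x ^ 2 + τ ^ 2 := fun x => by
    rw [norm_add_mul_I, Real.sq_sqrt (by positivity)]
  have ha : 0 < a := hb.trans_le hab
  have h1 : ‖((a - 1 / 2 : ℝ) : ℂ) + τ * I‖ * ‖((a + 1 / 2 : ℝ) : ℂ) + τ * I‖ ≤
      a ^ 2 + τ ^ 2 + 1 / 4 := by
    refine abs_le_of_sq_le_sq' ?_ (by positivity) |>.2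
    rw [mul_pow, hsq, hsq]
    nlinarith [sq_nonneg a]
  rw [hsq]
  refine h1.trans ?_
  have h2 : 1 + 1 / (4 * b ^ 2) ≤ Real.exp (1 / (4 * b ^ 2)) := by
    linarith [Real.add_one_le_exp (1 / (4 * b ^ 2))]
  have h3 : 1 ≤ (a ^ 2 + τ ^ 2) * (1 / b ^ 2) := by
    rw [mul_one_div, le_div_iff₀ (by positivity), one_mul]
    nlinarith [sq_nonneg τ]
  calc a ^ 2 + τ ^ 2 + 1 / 4 ≤ (a ^ 2 + τ ^ 2) * (1 + 1 / (4 * b ^ 2)) := by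
        have : 1 / (4 * b ^ 2) = 1 / 4 * (1 / b ^ 2) := by field_simp
        rw [this]; nlinarith
    _ ≤ _ := mul_le_mul_of_nonneg_left h2 (by positivity)

lemma norm_Gamma_sq_le {x : ℝ} (hx : 1 / 4 ≤ x) (hx' : x ≠ 1 / 2) (τ : ℝ) :
    ‖Gamma ((x : ℂ) + τ * I)‖ ^ 2 ≤ gammaConst * (‖Gamma (((x - 1 / 2 : ℝ) : ℂ) + τ * I)‖ *
      ‖Gamma (((x + 1 / 2 : ℝ) : ℂ) + τ * I)‖) := by
  have ht : ∀ s : ℂ, Filter.Tendsto (fun n => ‖GammaSeq s n‖) Filter.atTop (nhds ‖Gamma s‖) :=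
    fun s => (GammaSeq_tendsto_Gamma s).norm
  refine le_of_tendsto_of_tendsto ((ht _).pow 2) (((ht _).mul (ht _)).const_mul gammaConst) ?_
  filter_upwards [Filter.eventually_gt_atTop 0] with n hn
  have hnp : (0 : ℝ) < n := by exact_mod_cast hn
  have hseq : ∀ y : ℝ, ‖GammaSeq ((y : ℂ) + τ * I) n‖ = (n : ℝ) ^ y * (n.factorial : ℝ) /
      ∏ j ∈ Finset.range (n + 1), ‖((y + j : ℝ) : ℂ) + τ * I‖ := by
    intro y
    have hre : ((y : ℂ) + τ * I).re = y := by simp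
    rw [GammaSeq, norm_div, norm_mul, _root_.norm_prod, Complex.norm_natCast,
      Complex.norm_natCast_cpow_of_pos hn, hre]
    congr 1
    · refine Finset.prod_congr rfl fun j _ => ?_
      congr 1; push_cast; ring
  rw [hseq, hseq, hseq]
  set A := ∏ j ∈ Finset.range (n + 1), ‖((x + j : ℝ) : ℂ) + τ * I‖ with hA
  set B := ∏ j ∈ Finset.range (n + 1), ‖((x - 1 / 2 + j : ℝ) : ℂ) + τ * I‖ with hB
  set D := ∏ j ∈ Finset.range (n + 1), ‖((x + 1 / 2 + j : ℝ) : ℂ) + τ * I‖ with hD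
  have hne : ∀ y : ℝ, y ≠ 0 → 0 < ‖(y : ℂ) + τ * I‖ := by
    intro y hy
    rw [norm_pos_iff]
    intro h
    have := congrArg re h
    simp at this
    exact hy this
  have hApos : 0 < A := Finset.prod_pos fun j _ => hne _ (by positivity)
  have hDpos : 0 < D := Finset.prod_pos fun j _ => hne _ (by positivity)
  have hBpos : 0 < B := by
    refine Finset.prod_pos fun j _ => hne _ fun h => ?_
    rcases Nat.eq_zero_or_pos j with rfl | hj
    · apply hx'; push_cast at h; linarith
    · have : (1 : ℝ) ≤ j := by exact_mod_cast hj
      linarith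
  have hBD : B * D ≤ A ^ 2 * gammaConst := by
    rw [hB, hD, hA, ← Finset.prod_mul_distrib, ← Finset.prod_pow]
    calc _ ≤ ∏ j ∈ Finset.range (n + 1), (‖((x + j : ℝ) : ℂ) + τ * I‖ ^ 2 *
          Real.exp (1 / (4 * ((j : ℝ) + 1 / 4) ^ 2))) := by
          refine Finset.prod_le_prod (fun j _ => by positivity) fun j _ => ?_
          have := norm_mul_norm_le_exp (a := x + j) (τ := τ) (b := (j : ℝ) + 1 / 4) (by positivity)
            (by linarith)
          have e1 : x - 1 / 2 + j = x + j - 1 / 2 := by ring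
          have e2 : x + 1 / 2 + j = x + j + 1 / 2 := by ring
          rw [e1, e2]
          exact this
      _ ≤ _ := by
          rw [Finset.prod_mul_distrib, ← Real.exp_sum]
          refine mul_le_mul_of_nonneg_left (Real.exp_le_exp.2 ?_) (by positivity)
          exact summable_gammaConst.sum_le_tsum _ fun j _ => by positivity
  have hpow : (n : ℝ) ^ (x - 1 / 2) * (n : ℝ) ^ (x + 1 / 2) = ((n : ℝ) ^ x) ^ 2 := by
    rw [← Real.rpow_add hnp, ← Real.rpow_natCast, ← Real.rpow_mul hnp.le]
    congr 1; push_cast; ring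
  have e : gammaConst * ((n : ℝ) ^ (x - 1 / 2) * (n.factorial : ℝ) / B *
      ((n : ℝ) ^ (x + 1 / 2) * (n.factorial : ℝ) / D)) =
      ((n : ℝ) ^ x * (n.factorial : ℝ)) ^ 2 * (gammaConst / (B * D)) := by
    rw [mul_pow, ← hpow]; field_simp
  rw [e, div_pow, div_eq_mul_inv]
  refine mul_le_mul_of_nonneg_left ?_ (by positivity)
  rw [inv_eq_one_div, div_le_div_iff₀ (by positivity) (by positivity), one_mul]
  linarith

/-- Lower bounds of the correct order for `Γ` on the lines `Re s = 1/4` and `Re s = 3/4`. -/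
theorem norm_Gamma_sq_ge {κ : ℕ} (hκ : κ ≤ 1) (τ : ℝ) :
    Real.pi / √gammaConst * ‖(1 / 4 : ℂ) + τ * I‖ ^ ((κ : ℝ) - 1 / 2) *
      Real.exp (-Real.pi * |τ|) ≤ ‖Gamma ((1 / 4 : ℂ) + κ / 2 + τ * I)‖ ^ 2 := by
  set s : ℂ := (1 / 4 : ℂ) + τ * I with hs
  set g1 := ‖Gamma ((1 / 4 : ℂ) + τ * I)‖ with hg1
  set g3 := ‖Gamma ((3 / 4 : ℂ) + τ * I)‖ with hg3
  have hs0 : s ≠ 0 := by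
    intro h
    have := congrArg re h
    simp [hs] at this
  have hsp : 0 < ‖s‖ := norm_pos_iff.2 hs0
  have hC := gammaConst_pos
  have h1 : g3 ^ 2 ≤ gammaConst * (‖s‖ * g1 ^ 2) := by
    have h := norm_Gamma_sq_le (x := 3 / 4) (by norm_num) (by norm_num) τ
    have e : ((3 / 4 + 1 / 2 : ℝ) : ℂ) + τ * I = s + 1 := by rw [hs]; push_cast; ring
    have e' : ((3 / 4 - 1 / 2 : ℝ) : ℂ) + τ * I = s := by rw [hs]; push_cast; ring
    rw [e, e', Gamma_add_one _ hs0, norm_mul] at h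
    push_cast at h
    calc _ ≤ _ := h
      _ = _ := by ring
  have h2 : g1 ^ 2 * ‖s‖ ≤ gammaConst * g3 ^ 2 := by
    have h := norm_Gamma_sq_le (x := 1 / 4) (by norm_num) (by norm_num) τ
    set s' : ℂ := ((1 / 4 - 1 / 2 : ℝ) : ℂ) + τ * I with hs'
    have e : ((1 / 4 + 1 / 2 : ℝ) : ℂ) + τ * I = (3 / 4 : ℂ) + τ * I := by push_cast; ring
    have e' : ((3 / 4 : ℂ) + τ * I) = s' + 1 := by rw [hs']; push_cast; ring
    have hn : ‖s'‖ = ‖s‖ := by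
      have e2 : s = ((1 / 4 : ℝ) : ℂ) + τ * I := by rw [hs]; push_cast; ring
      rw [hs', e2, norm_add_mul_I, norm_add_mul_I]; norm_num
    have hs'0 : s' ≠ 0 := by rw [← norm_pos_iff, hn]; exact hsp
    have h3 : g3 = ‖s‖ * ‖Gamma s'‖ := by
      rw [hg3, e', Gamma_add_one _ hs'0, norm_mul, hn]
    rw [e] at h
    push_cast at h
    calc g1 ^ 2 * ‖s‖ ≤ (gammaConst * (‖Gamma s'‖ * g3)) * ‖s‖ :=
          mul_le_mul_of_nonneg_right h hsp.le
      _ = _ := by rw [h3]; ring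
  have h3 : Real.pi * Real.exp (-Real.pi * |τ|) ≤ g1 * g3 := by
    have h := Gamma_mul_Gamma_one_sub s
    have e : g3 = ‖Gamma (1 - s)‖ := by
      have : (1 - s) = (starRingEnd ℂ) ((3 / 4 : ℂ) + τ * I) := by
        have e4 : (3 / 4 : ℂ) = ((3 / 4 : ℝ) : ℂ) := by push_cast; rfl
        rw [hs, e4, map_add, map_mul, conj_ofReal, conj_ofReal, conj_I]
        push_cast
        ring
      rw [this, Gamma_conj, norm_conj, hg3]
    have hsin : ‖Complex.sin (Real.pi * s)‖ ≤ Real.exp (Real.pi * |τ|) := by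
      have e3 : ∀ w : ℂ, ‖cexp w‖ ≤ Real.exp |w.re| := fun w => by
        rw [norm_exp]; exact Real.exp_le_exp.2 (le_abs_self _)
      have r1 : |(-(Real.pi * s) * I).re| = Real.pi * |τ| := by
        simp [hs, abs_mul, abs_of_pos Real.pi_pos]
      have r2 : |((Real.pi * s) * I).re| = Real.pi * |τ| := by
        simp [hs, abs_mul, abs_of_pos Real.pi_pos]
      rw [Complex.sin, norm_div, norm_mul, norm_I, mul_one]
      have := norm_sub_le (cexp (-(Real.pi * s) * I)) (cexp ((Real.pi * s) * I))
      have a1 := e3 (-(Real.pi * s) * I)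
      have a2 := e3 ((Real.pi * s) * I)
      rw [r1] at a1; rw [r2] at a2
      have n2 : ‖(2 : ℂ)‖ = 2 := by simp
      rw [n2, div_le_iff₀ two_pos]
      linarith
    have hne : 0 < ‖Complex.sin (Real.pi * s)‖ := by
      rw [norm_pos_iff]
      intro h0
      rw [Complex.sin_eq_zero_iff] at h0
      obtain ⟨k, hk⟩ := h0
      have hpi : (Real.pi : ℂ) ≠ 0 := by exact_mod_cast Real.pi_ne_zero
      have : s = k := mul_left_cancel₀ hpi (by rw [hk]; ring)
      have h4 := congrArg re this
      simp [hs] at h4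
      have h5 : (1 : ℝ) = ((4 * k : ℤ) : ℝ) := by push_cast; linarith
      have h6 : (1 : ℤ) = 4 * k := by exact_mod_cast h5
      omega
    have h4 := congrArg norm h
    rw [norm_mul, ← e, norm_div, norm_real, Real.norm_of_nonneg Real.pi_pos.le] at h4
    rw [hg1, ← hs, h4, neg_mul, Real.exp_neg, ← div_eq_mul_inv]
    exact div_le_div_of_nonneg_left Real.pi_pos.le hne hsin
  have hg1n : 0 ≤ g1 := norm_nonneg _
  have hg3n : 0 ≤ g3 := norm_nonneg _
  have hrC : 0 < √gammaConst := Real.sqrt_pos.2 hC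
  have hrs : 0 < √‖s‖ := Real.sqrt_pos.2 hsp
  have k1 : g3 ≤ √gammaConst * √‖s‖ * g1 := by
    refine abs_le_of_sq_le_sq' ?_ (by positivity) |>.2
    rw [mul_pow, mul_pow, Real.sq_sqrt hC.le, Real.sq_sqrt hsp.le, mul_assoc]
    exact h1
  have k2 : g1 * √‖s‖ ≤ √gammaConst * g3 := by
    refine abs_le_of_sq_le_sq' ?_ (by positivity) |>.2
    rw [mul_pow, mul_pow, Real.sq_sqrt hC.le, Real.sq_sqrt hsp.le]
    exact h2
  interval_cases κ
  · have e : (1 / 4 : ℂ) + ((0 : ℕ) : ℂ) / 2 + τ * I = (1 / 4 : ℂ) + τ * I := by push_cast; ring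
    have e2 : ((0 : ℕ) : ℝ) - 1 / 2 = -(1 / 2) := by norm_num
    rw [e, ← hg1, e2, Real.rpow_neg hsp.le, ← Real.sqrt_eq_rpow]
    calc _ = (Real.pi * Real.exp (-Real.pi * |τ|)) / (√gammaConst * √‖s‖) := by field_simp
      _ ≤ (g1 * g3) / (√gammaConst * √‖s‖) := by gcongr
      _ ≤ (g1 * (√gammaConst * √‖s‖ * g1)) / (√gammaConst * √‖s‖) := by gcongr
      _ = g1 ^ 2 := by field_simp
  · have e : (1 / 4 : ℂ) + ((1 : ℕ) : ℂ) / 2 + τ * I = (3 / 4 : ℂ) + τ * I := by push_cast; ring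
    have e2 : ((1 : ℕ) : ℝ) - 1 / 2 = 1 / 2 := by norm_num
    rw [e, ← hg3, e2, ← Real.sqrt_eq_rpow]
    calc _ = (Real.pi * Real.exp (-Real.pi * |τ|)) * √‖s‖ / √gammaConst := by field_simp
      _ ≤ (g1 * g3) * √‖s‖ / √gammaConst := by gcongr
      _ = (g1 * √‖s‖) * g3 / √gammaConst := by ring
      _ ≤ (√gammaConst * g3) * g3 / √gammaConst := by gcongr
      _ = g3 ^ 2 := by field_simp

end GammaBounds

section MellinLowerBound

lemma norm_one_div_pi_mul_cpow {θ q : ℝ} (hθ : |θ| < Real.pi) (hq : 0 < q) (w : ℂ) :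
    ‖(1 / (Real.pi * (cexp (θ * I) / q))) ^ w‖ =
      (q / Real.pi) ^ w.re * Real.exp (θ * w.im) := by
  have hqc : (q : ℂ) ≠ 0 := by exact_mod_cast hq.ne'
  have hpc : (Real.pi : ℂ) ≠ 0 := by exact_mod_cast Real.pi_ne_zero
  have hx : 0 < q / Real.pi := div_pos hq Real.pi_pos
  have hθ' := abs_lt.1 hθ
  have e : 1 / (Real.pi * (cexp (θ * I) / q)) = ((q / Real.pi : ℝ) : ℂ) * cexp ((-θ : ℝ) * I) := by
    push_cast
    rw [neg_mul, exp_neg]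
    field_simp
  have hne : 1 / (Real.pi * (cexp (θ * I) / q)) ≠ 0 := by
    rw [e]
    exact mul_ne_zero (by exact_mod_cast hx.ne') (exp_ne_zero _)
  rw [norm_cpow_of_ne_zero hne, e, arg_real_mul _ hx, arg_exp_mul_I,
    (toIocMod_eq_self Real.two_pi_pos).2 ⟨by linarith, by linarith⟩, norm_mul,
    norm_exp_ofReal_mul_I, norm_real, Real.norm_of_nonneg hx.le, mul_one, neg_mul, Real.exp_neg,
    div_inv_eq_mul]

/-- A constant for the lower bound of the archimedean factor. -/
noncomputable def archConst : ℝ :=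
  Real.pi / √gammaConst * Real.exp (-1) * (16 * Real.pi ^ 2)⁻¹

lemma archConst_pos : 0 < archConst := by
  have := Real.sqrt_pos.2 gammaConst_pos
  have := Real.pi_pos
  unfold archConst
  positivity

/-- For `|t| ≤ X ≪ 1 + |t|`, the value `L(1/2 + it, χ)` is controlled by a Mellin transform of the
theta series along the ray of angle `±(π/2 - 1/X)`. -/
theorem norm_sq_LFunction_le_mellin {N : ℕ} [NeZero N] (hN : N ≠ 1) {χ : DirichletCharacter ℂ N}
    (hχ : χ.IsPrimitive) (hχ1 : χ ≠ 1) (hreal : χ⁻¹ = χ) {κ : ℕ} (hκ1 : κ ≤ 1)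
    (hκ : χ (-1) = (-1) ^ κ) {X t s : ℝ} (hX : 1 ≤ X) (hs : s * t = |t|) (hs1 : |s| = 1)
    (htX : |t| ≤ X) (hXt : X ≤ 2 + 2 * |t|) :
    archConst * (N : ℝ) ^ (1 / 2 + κ : ℝ) * X ^ (κ - 1 / 2 : ℝ) *
        ‖DirichletCharacter.LFunction χ (1 / 2 + t * I)‖ ^ 2 ≤
      ‖mellin (fun v : ℝ => charTheta χ κ (cexp ((s * (Real.pi / 2 - 1 / X) : ℝ) * I) / N * v))
        (((1 / 4 + κ / 2 : ℝ) : ℂ) + (t / 2 : ℝ) * I)‖ ^ 2 := by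
  set θ : ℝ := s * (Real.pi / 2 - 1 / X) with hθ
  have hX0 : 0 < X := by linarith
  have hX1 : 1 / X ≤ 1 := by rw [div_le_one hX0]; exact hX
  have hX2 : 0 < 1 / X := by positivity
  have hpi := Real.pi_gt_three
  have hθa : |θ| = Real.pi / 2 - 1 / X := by
    rw [hθ, abs_mul, hs1, one_mul, abs_of_pos (by linarith)]
  have hNpos : (0 : ℝ) < N := by exact_mod_cast Nat.pos_of_ne_zero (NeZero.ne N)
  have hNc : (N : ℂ) = ((N : ℝ) : ℂ) := by push_cast; rfl
  set w : ℂ := ((1 / 4 + κ / 2 : ℝ) : ℂ) + (t / 2 : ℝ) * I with hw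
  have hwre : w.re = 1 / 4 + κ / 2 := by simp [hw, -ofReal_add, -ofReal_div, -ofReal_ofNat]
  have hwim : w.im = t / 2 := by simp [hw, -ofReal_add, -ofReal_div, -ofReal_ofNat]
  have hz : 0 < (cexp (θ * I) / N).re := by
    rw [hNc, div_ofReal_re, exp_ofReal_mul_I_re]
    refine div_pos (Real.cos_pos_of_mem_Ioo ?_) hNpos
    have := abs_le.1 hθa.le
    constructor <;> linarith
  rw [mellin_charTheta hN hχ hχ1 hreal hκ1 hκ hz (by rw [hwre]; positivity), norm_mul, norm_mul,
    mul_pow, mul_pow]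
  have e1 : 2 * w - κ = 1 / 2 + t * I := by rw [hw]; push_cast; ring
  rw [e1]
  refine mul_le_mul_of_nonneg_right ?_ (by positivity)
  rw [hNc, norm_one_div_pi_mul_cpow (by rw [hθa]; linarith) hNpos, hwre, hwim]
  have hg := norm_Gamma_sq_ge hκ1 (t / 2)
  have e2 : (1 / 4 : ℂ) + κ / 2 + (t / 2 : ℝ) * I = w := by rw [hw]; push_cast; ring
  rw [e2] at hg
  set r := ‖(1 / 4 : ℂ) + (t / 2 : ℝ) * I‖ with hr
  have hr2 : r ^ 2 = 1 / 16 + |t| ^ 2 / 4 := by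
    have e3 : (1 / 4 : ℂ) = ((1 / 4 : ℝ) : ℂ) := by push_cast; rfl
    rw [hr, e3, norm_add_mul_I, Real.sq_sqrt (by positivity), sq_abs]
    ring
  have ht0 := abs_nonneg t
  have hr0 : 0 < r := by
    have h : 0 ≤ r := norm_nonneg _
    refine h.lt_of_ne fun h0 => ?_
    rw [← h0] at hr2
    nlinarith
  have hn1 : r ≤ X := by nlinarith
  have hn2 : X ≤ 16 * r := by
    refine hXt.trans (abs_le_of_sq_le_sq' ?_ (by positivity)).2
    rw [mul_pow, hr2]
    nlinarith [sq_nonneg (|t| - 1)]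
  have hpow : X ^ (κ - 1 / 2 : ℝ) / 16 ≤ r ^ (κ - 1 / 2 : ℝ) := by
    interval_cases κ
    · refine le_trans (div_le_self (by positivity) (by norm_num)) ?_
      exact Real.rpow_le_rpow_of_nonpos hr0 hn1 (by norm_num)
    · have h1 : X ^ (((1 : ℕ) : ℝ) - 1 / 2) ≤ (16 * r) ^ (((1 : ℕ) : ℝ) - 1 / 2) :=
        Real.rpow_le_rpow hX0.le hn2 (by norm_num)
      rw [Real.mul_rpow (by norm_num) hr0.le] at h1
      have h2 : (16 : ℝ) ^ (((1 : ℕ) : ℝ) - 1 / 2) ≤ 16 ^ (1 : ℝ) :=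
        Real.rpow_le_rpow_of_exponent_le (by norm_num) (by norm_num)
      rw [Real.rpow_one] at h2
      have h3 : 0 < r ^ (((1 : ℕ) : ℝ) - 1 / 2) := Real.rpow_pos_of_pos hr0 _
      rw [div_le_iff₀ (by norm_num)]
      nlinarith
  have hexp : Real.exp (-1) ≤
      Real.exp (-Real.pi * |t / 2|) * Real.exp (θ * (t / 2)) ^ 2 := by
    rw [← Real.exp_nat_mul, ← Real.exp_add, Real.exp_le_exp]
    have e4 : θ * t = |t| * (Real.pi / 2 - 1 / X) := by rw [hθ, ← hs]; ring
    have e5 : |t| * (1 / X) ≤ 1 := by rw [mul_one_div, div_le_one hX0]; exact htX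
    rw [abs_div, abs_of_pos (by norm_num : (0 : ℝ) < 2)]
    push_cast
    nlinarith
  have hNpow : (N : ℝ) ^ (1 / 2 + κ : ℝ) * (Real.pi ^ 2)⁻¹ ≤
      ((N / Real.pi : ℝ) ^ (1 / 4 + κ / 2 : ℝ)) ^ 2 := by
    rw [← Real.rpow_natCast (_ ^ (_ : ℝ)), ← Real.rpow_mul (by positivity), Real.div_rpow hNpos.le (by positivity)]
    have e6 : (1 / 4 + κ / 2 : ℝ) * (2 : ℕ) = 1 / 2 + κ := by push_cast; ring
    rw [e6, div_eq_mul_inv]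
    refine mul_le_mul_of_nonneg_left (inv_anti₀ (by positivity) ?_) (by positivity)
    rw [← Real.rpow_natCast]
    refine Real.rpow_le_rpow_of_exponent_le (by linarith) ?_
    have : (κ : ℝ) ≤ 1 := by exact_mod_cast hκ1
    push_cast
    linarith
  have hC := Real.sqrt_pos.2 gammaConst_pos
  calc archConst * (N : ℝ) ^ (1 / 2 + κ : ℝ) * X ^ (κ - 1 / 2 : ℝ)
      = Real.pi / √gammaConst * (X ^ (κ - 1 / 2 : ℝ) / 16) * Real.exp (-1) *
          ((N : ℝ) ^ (1 / 2 + κ : ℝ) * (Real.pi ^ 2)⁻¹) := by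
        rw [archConst, mul_inv]; ring
    _ ≤ Real.pi / √gammaConst * r ^ (κ - 1 / 2 : ℝ) *
          (Real.exp (-Real.pi * |t / 2|) * Real.exp (θ * (t / 2)) ^ 2) *
          ((N / Real.pi : ℝ) ^ (1 / 4 + κ / 2 : ℝ)) ^ 2 := by gcongr
    _ = (Real.pi / √gammaConst * r ^ (κ - 1 / 2 : ℝ) * Real.exp (-Real.pi * |t / 2|)) *
          ((N / Real.pi : ℝ) ^ (1 / 4 + κ / 2 : ℝ) * Real.exp (θ * (t / 2))) ^ 2 := by ring
    _ ≤ ‖Gamma w‖ ^ 2 * ((N / Real.pi : ℝ) ^ (1 / 4 + κ / 2 : ℝ) * Real.exp (θ * (t / 2))) ^ 2 :=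
        mul_le_mul_of_nonneg_right hg (by positivity)

end MellinLowerBound

section SeparatedSums

lemma card_le_of_separated {δ m : ℝ} (hδ : 0 < δ) {B : Finset ℝ}
    (hB : ∀ t ∈ B, ∀ t' ∈ B, t ≠ t' → δ ≤ |t - t'|) (hm : ∀ t ∈ B, m ≤ t ∧ t < m + 1) :
    (B.card : ℝ) ≤ δ⁻¹ + 1 := by
  have h : B.card ≤ (Finset.range (⌊δ⁻¹⌋₊ + 1)).card := by
    refine Finset.card_le_card_of_injOn (fun t => ⌊(t - m) / δ⌋₊) (fun t ht => ?_) ?_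
    · have := hm t ht
      simp only [Finset.coe_range, Set.mem_Iio]
      refine Nat.lt_succ_of_le (Nat.floor_le_floor ?_)
      rw [div_eq_mul_inv]
      have : 0 < δ⁻¹ := by positivity
      nlinarith
    · intro t ht t' ht' h
      by_contra hne
      have h1 := hB t ht t' ht' hne
      have p1 : 0 ≤ (t - m) / δ := div_nonneg (by linarith [hm t ht]) hδ.le
      have p2 : 0 ≤ (t' - m) / δ := div_nonneg (by linarith [hm t' ht']) hδ.le
      have a1 := Nat.floor_le p1
      have a2 := Nat.lt_floor_add_one ((t - m) / δ)
      have b1 := Nat.floor_le p2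
      have b2 := Nat.lt_floor_add_one ((t' - m) / δ)
      simp only at h
      rw [h] at a1 a2
      have h2 : |(t - m) / δ - (t' - m) / δ| < 1 := by
        rw [abs_lt]; constructor <;> linarith
      rw [← sub_div, abs_div, abs_of_pos hδ, div_lt_one hδ] at h2
      have : t - m - (t' - m) = t - t' := by ring
      rw [this] at h2
      linarith
  rw [Finset.card_range] at h
  calc (B.card : ℝ) ≤ ((⌊δ⁻¹⌋₊ + 1 : ℕ) : ℝ) := by exact_mod_cast h
    _ ≤ δ⁻¹ + 1 := by
      push_cast
      linarith [Nat.floor_le (by positivity : 0 ≤ δ⁻¹)]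

theorem exists_sum_separated_le {η : ℝ} (hη : 0 < η) : ∃ C > (0 : ℝ), ∀ δ > (0 : ℝ),
    ∀ B : Finset ℝ, (∀ t ∈ B, ∀ t' ∈ B, t ≠ t' → δ ≤ |t - t'|) → ∀ t : ℝ,
      ∑ t' ∈ B, 2 * η / (η ^ 2 + ((t - t') / 2) ^ 2) ≤ C * (δ⁻¹ + 1) := by
  have hs : Summable fun n : ℤ => 1 / |(n : ℝ) + 1 / 2| ^ (2 : ℝ) :=
    (Real.summable_one_div_int_add_rpow (1 / 2) 2).2 one_lt_two
  set f : ℤ → ℝ := fun n => 2 * η * (1 / (2 * η ^ 2) + 8) * (1 / |(n : ℝ) + 1 / 2| ^ (2 : ℝ)) with hf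
  have hfs : Summable f := hs.mul_left _
  have hf0 : ∀ n, 0 ≤ f n := fun n => by positivity
  refine ⟨∑' n, f n + 1, add_pos_of_nonneg_of_pos (tsum_nonneg hf0) one_pos, fun δ hδ B hB t => ?_⟩
  have hterm : ∀ t' ∈ B, 2 * η / (η ^ 2 + ((t - t') / 2) ^ 2) ≤ f ⌊t' - t⌋ := by
    intro t' _
    have h1 := Int.floor_le (t' - t)
    have h2 := Int.lt_floor_add_one (t' - t)
    set n := ⌊t' - t⌋
    have hne : (n : ℝ) + 1 / 2 ≠ 0 := by
      intro h
      have h3 : ((2 * n + 1 : ℤ) : ℝ) = 0 := by push_cast; linarith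
      have h4 : 2 * n + 1 = 0 := by exact_mod_cast h3
      omega
    have hpos : 0 < ((n : ℝ) + 1 / 2) ^ 2 := by positivity
    have h3 : ((n : ℝ) + 1 / 2) ^ 2 ≤ 2 * (t - t') ^ 2 + 1 / 2 := by
      have h5 : ((n : ℝ) + 1 / 2 - (t' - t)) ^ 2 ≤ 1 / 4 := by nlinarith
      nlinarith [sq_nonneg ((n : ℝ) + 1 / 2 - 2 * (t' - t))]
    rw [hf]
    simp only
    have e : |(n : ℝ) + 1 / 2| ^ (2 : ℝ) = ((n : ℝ) + 1 / 2) ^ 2 := by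
      rw [← sq_abs, ← Real.rpow_natCast]; norm_num
    rw [e, mul_one_div, div_le_div_iff₀ (by positivity) hpos, mul_assoc (2 * η)]
    refine mul_le_mul_of_nonneg_left (h3.trans ?_) (by positivity)
    have : (1 / (2 * η ^ 2) + 8) * (η ^ 2 + ((t - t') / 2) ^ 2) =
      1 / 2 + 8 * η ^ 2 + 1 / (2 * η ^ 2) * ((t - t') / 2) ^ 2 + 2 * (t - t') ^ 2 := by
      field_simp; ring
    rw [this]
    have : 0 ≤ 8 * η ^ 2 + 1 / (2 * η ^ 2) * ((t - t') / 2) ^ 2 := by positivity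
    linarith
  calc ∑ t' ∈ B, 2 * η / (η ^ 2 + ((t - t') / 2) ^ 2) ≤ ∑ t' ∈ B, f ⌊t' - t⌋ :=
        Finset.sum_le_sum hterm
    _ = ∑ n ∈ B.image (fun t' => ⌊t' - t⌋), ((B.filter fun t' => ⌊t' - t⌋ = n).card : ℝ) * f n := by
        rw [← Finset.sum_fiberwise_of_maps_to (s := B) (t := B.image (fun t' => ⌊t' - t⌋))
          (g := fun t' => ⌊t' - t⌋) (fun x hx => Finset.mem_image_of_mem _ hx)]
        refine Finset.sum_congr rfl fun n _ => ?_
        rw [Finset.sum_congr rfl (g := fun _ => f n) fun x hx => by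
          rw [(Finset.mem_filter.1 hx).2], Finset.sum_const, nsmul_eq_mul]
    _ ≤ ∑ n ∈ B.image (fun t' => ⌊t' - t⌋), (δ⁻¹ + 1) * f n := by
        refine Finset.sum_le_sum fun n _ => mul_le_mul_of_nonneg_right ?_ (hf0 n)
        refine card_le_of_separated (m := t + n) hδ (fun x hx y hy => ?_) fun x hx => ?_
        · exact hB x (Finset.mem_filter.1 hx).1 y (Finset.mem_filter.1 hy).1
        · have := Int.floor_eq_iff.1 (Finset.mem_filter.1 hx).2
          constructor <;> linarith
    _ ≤ (δ⁻¹ + 1) * ∑' n, f n := by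
        rw [← Finset.mul_sum]
        exact mul_le_mul_of_nonneg_left (hfs.sum_le_tsum _ fun n _ => hf0 n) (by positivity)
    _ ≤ _ := by
        have : 0 < δ⁻¹ := by positivity
        nlinarith

end SeparatedSums

section DiscreteMeanValue

/-- The weight `min(v ^ η, v ^ (-η))`. -/
noncomputable def tentWeight (η v : ℝ) : ℝ := if v ≤ 1 then v ^ η else v ^ (-η)

lemma tentWeight_pos (η : ℝ) {v : ℝ} (hv : 0 < v) : 0 < tentWeight η v := by
  unfold tentWeight
  split_ifs <;> exact Real.rpow_pos_of_pos hv _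

lemma tentWeight_mul_cpow_of_le (η : ℝ) {v : ℝ} (hv : 0 < v) (hv1 : v ≤ 1) (s : ℂ) :
    (tentWeight η v : ℂ) * (v : ℂ) ^ s = (v : ℂ) ^ (η + s) := by
  rw [tentWeight, if_pos hv1, ofReal_cpow hv.le, ← cpow_add _ _ (by exact_mod_cast hv.ne')]

lemma tentWeight_mul_cpow_of_lt (η : ℝ) {v : ℝ} (hv1 : 1 < v) (s : ℂ) :
    (tentWeight η v : ℂ) * (v : ℂ) ^ s = (v : ℂ) ^ (-η + s) := by
  have hv : 0 < v := by linarith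
  rw [tentWeight, if_neg (not_le.2 hv1), ofReal_cpow hv.le,
    ← cpow_add _ _ (by exact_mod_cast hv.ne')]
  push_cast
  rfl

lemma tentWeight_mellin {η : ℝ} (hη : 0 < η) (τ : ℝ) :
    MeasureTheory.IntegrableOn (fun v : ℝ => (tentWeight η v : ℂ) * (v : ℂ) ^ (τ * I - 1))
      (Set.Ioi 0) ∧
    ‖∫ v in Set.Ioi (0 : ℝ), (tentWeight η v : ℂ) * (v : ℂ) ^ (τ * I - 1)‖ ≤
      2 * η / (η ^ 2 + τ ^ 2) := by
  have hu : Set.Ioi (0 : ℝ) = Set.Ioc 0 1 ∪ Set.Ioi 1 := (Set.Ioc_union_Ioi_eq_Ioi zero_le_one).symm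
  have hd : Disjoint (Set.Ioc (0 : ℝ) 1) (Set.Ioi 1) := Set.Ioc_disjoint_Ioi le_rfl
  have c1 : Set.EqOn (fun v : ℝ => (tentWeight η v : ℂ) * (v : ℂ) ^ (τ * I - 1))
      (fun v : ℝ => (v : ℂ) ^ (η + (τ * I - 1))) (Set.Ioc 0 1) := fun v hv =>
    tentWeight_mul_cpow_of_le η hv.1 hv.2 _
  have c2 : Set.EqOn (fun v : ℝ => (tentWeight η v : ℂ) * (v : ℂ) ^ (τ * I - 1))
      (fun v : ℝ => (v : ℂ) ^ (-η + (τ * I - 1))) (Set.Ioi 1) := fun v hv =>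
    tentWeight_mul_cpow_of_lt η hv _
  have i1 : MeasureTheory.IntegrableOn (fun v : ℝ => (v : ℂ) ^ (η + (τ * I - 1))) (Set.Ioc 0 1) := by
    rw [← intervalIntegrable_iff_integrableOn_Ioc_of_le zero_le_one]
    exact intervalIntegral.intervalIntegrable_cpow' (by simp; linarith)
  have i2 : MeasureTheory.IntegrableOn (fun v : ℝ => (v : ℂ) ^ (-η + (τ * I - 1))) (Set.Ioi 1) :=
    integrableOn_Ioi_cpow_of_lt (by simp; linarith) zero_lt_one
  have j1 := i1.congr_fun c1.symm measurableSet_Ioc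
  have j2 := i2.congr_fun c2.symm measurableSet_Ioi
  refine ⟨by rw [hu]; exact j1.union j2, ?_⟩
  have k1 : ∫ v in Set.Ioc (0 : ℝ) 1, (v : ℂ) ^ (η + (τ * I - 1)) = 1 / (η + τ * I) := by
    rw [← intervalIntegral.integral_of_le zero_le_one, integral_cpow (Or.inl (by simp; linarith))]
    have hne : (η + (τ * I - 1) + 1 : ℂ) = η + τ * I := by ring
    have hne0 : (η + τ * I : ℂ) ≠ 0 := by
      intro h
      have := congrArg re h
      simp at this
      exact hη.ne' this
    rw [hne, ofReal_one, one_cpow, ofReal_zero, zero_cpow hne0, sub_zero]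
  have k2 : ∫ v in Set.Ioi (1 : ℝ), (v : ℂ) ^ (-η + (τ * I - 1)) = -1 / (-η + τ * I) := by
    rw [integral_Ioi_cpow_of_lt (by simp; linarith) zero_lt_one]
    have hne : (-η + (τ * I - 1) + 1 : ℂ) = -η + τ * I := by ring
    rw [hne, ofReal_one, one_cpow]
  rw [hu, MeasureTheory.setIntegral_union hd measurableSet_Ioi j1 j2,
    MeasureTheory.setIntegral_congr_fun measurableSet_Ioc c1,
    MeasureTheory.setIntegral_congr_fun measurableSet_Ioi c2, k1, k2]
  have hpos : 0 < η ^ 2 + τ ^ 2 := by positivity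
  have n1 : (η + τ * I : ℂ) ≠ 0 := by
    intro h
    have := congrArg re h
    simp at this
    exact hη.ne' this
  have n2 : (-η + τ * I : ℂ) ≠ 0 := by
    intro h
    have := congrArg re h
    simp at this
    exact hη.ne' this
  have n3 : ((η ^ 2 + τ ^ 2 : ℝ) : ℂ) ≠ 0 := by exact_mod_cast hpos.ne'
  have e : 1 / (η + τ * I : ℂ) + -1 / (-η + τ * I) = ((2 * η / (η ^ 2 + τ ^ 2) : ℝ) : ℂ) := by
    rw [ofReal_div, div_add_div _ _ n1 n2, div_eq_div_iff (mul_ne_zero n1 n2) n3]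
    push_cast
    linear_combination (-2 * η * τ ^ 2 : ℂ) * I_sq
  rw [e, norm_real, Real.norm_of_nonneg (by positivity)]

end DiscreteMeanValue

section DiscreteMeanValue

lemma measurable_tentWeight (η : ℝ) : Measurable (tentWeight η) :=
  Measurable.ite measurableSet_Iic (by fun_prop) (by fun_prop)

lemma ofReal_cpow_mul_I_conj {v : ℝ} (hv : 0 < v) (τ : ℝ) :
    (starRingEnd ℂ) ((v : ℂ) ^ (τ * I)) = (v : ℂ) ^ (((-τ : ℝ) : ℂ) * I) := by
  have h := cpow_conj (v : ℂ) (τ * I) (by rw [arg_ofReal_of_nonneg hv.le]; exact Real.pi_pos.ne)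
  rw [conj_ofReal, map_mul, conj_ofReal, conj_I] at h
  rw [← h, ofReal_neg, neg_mul, mul_neg]

lemma norm_sum_sum_mul_le {ι : Type*} (B : Finset ι) (M : ι → ℂ) (k : ι → ι → ℂ) (K : ι → ι → ℝ)
    (hk : ∀ i ∈ B, ∀ j ∈ B, ‖k i j‖ ≤ K i j) (hsymm : ∀ i j, K i j = K j i) {R : ℝ}
    (hR : ∀ i ∈ B, ∑ j ∈ B, K i j ≤ R) :
    ‖∑ i ∈ B, ∑ j ∈ B, (starRingEnd ℂ) (M i) * M j * k i j‖ ≤ R * ∑ i ∈ B, ‖M i‖ ^ 2 := by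
  have hK : ∀ i ∈ B, ∀ j ∈ B, 0 ≤ K i j := fun i hi j hj => (norm_nonneg _).trans (hk i hi j hj)
  have h1 : ∑ i ∈ B, ∑ j ∈ B, ‖M j‖ ^ 2 * K i j = ∑ i ∈ B, ∑ j ∈ B, ‖M i‖ ^ 2 * K i j := by
    rw [Finset.sum_comm]
    exact Finset.sum_congr rfl fun i _ => Finset.sum_congr rfl fun j _ => by rw [hsymm]
  calc ‖∑ i ∈ B, ∑ j ∈ B, (starRingEnd ℂ) (M i) * M j * k i j‖
      ≤ ∑ i ∈ B, ∑ j ∈ B, (‖M i‖ ^ 2 * K i j + ‖M j‖ ^ 2 * K i j) / 2 := by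
        refine (norm_sum_le _ _).trans (Finset.sum_le_sum fun i hi => ?_)
        refine (norm_sum_le _ _).trans (Finset.sum_le_sum fun j hj => ?_)
        rw [norm_mul, norm_mul, norm_conj]
        have h2 := hk i hi j hj
        have h3 := hK i hi j hj
        calc ‖M i‖ * ‖M j‖ * ‖k i j‖ ≤ ‖M i‖ * ‖M j‖ * K i j := by gcongr
          _ ≤ _ := by nlinarith [mul_nonneg (sq_nonneg (‖M i‖ - ‖M j‖)) h3]
    _ = ∑ i ∈ B, ‖M i‖ ^ 2 * ∑ j ∈ B, K i j := by
        simp_rw [← Finset.sum_div, Finset.sum_add_distrib]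
        rw [h1, add_self_div_two]
        simp_rw [Finset.mul_sum]
    _ ≤ ∑ i ∈ B, ‖M i‖ ^ 2 * R := by
        gcongr with i hi
        exact hR i hi
    _ = _ := by rw [← Finset.sum_mul, mul_comm]

/-- A mean value estimate for a Mellin transform at well-spaced points of a vertical line. -/
theorem sum_norm_mellin_sq_le {F : ℝ → ℂ} (hFc : ContinuousOn F (Set.Ioi 0)) {a η R : ℝ}
    (hη : 0 < η) (hF : MellinConvergent F a) (B : Finset ℝ) (hR : 0 < R)
    (hB : ∀ t ∈ B, ∑ t' ∈ B, 2 * η / (η ^ 2 + ((t - t') / 2) ^ 2) ≤ R) :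
    ENNReal.ofReal (∑ t ∈ B, ‖mellin F (a + (t / 2 : ℝ) * I)‖ ^ 2) ≤
      ENNReal.ofReal R * ∫⁻ v in Set.Ioi (0 : ℝ),
        ENNReal.ofReal (‖F v‖ ^ 2 * v ^ (2 * a - 1) * (tentWeight η v)⁻¹) := by
  set h : ℝ → ℝ := fun v => ‖F v‖ ^ 2 * v ^ (2 * a - 1) * (tentWeight η v)⁻¹ with hh
  set μ := MeasureTheory.volume.restrict (Set.Ioi (0 : ℝ)) with hμ
  have hae : ∀ᵐ v ∂μ, 0 < v := MeasureTheory.ae_restrict_mem measurableSet_Ioi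
  by_cases htop : ∫⁻ v in Set.Ioi (0 : ℝ), ENNReal.ofReal (h v) = ⊤
  · rw [htop, ENNReal.mul_top (by simpa using hR)]
    exact le_top
  have hFm : MeasureTheory.AEStronglyMeasurable F μ := hFc.aestronglyMeasurable measurableSet_Ioi
  have hhm : MeasureTheory.AEStronglyMeasurable h μ := by
    refine ((hFm.norm.pow 2).mul ?_).mul ?_
    · exact (by fun_prop : Measurable fun v : ℝ => v ^ (2 * a - 1)).aestronglyMeasurable
    · exact (measurable_tentWeight η).inv.aestronglyMeasurable
  have hh0 : ∀ᵐ v ∂μ, 0 ≤ h v := by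
    filter_upwards [hae] with v hv
    have := tentWeight_pos η hv
    positivity
  have hhi : MeasureTheory.Integrable h μ :=
    ⟨hhm, (MeasureTheory.hasFiniteIntegral_iff_ofReal hh0).2 (lt_top_iff_ne_top.2 htop)⟩
  rw [← MeasureTheory.ofReal_integral_eq_lintegral_ofReal hhi hh0, ← ENNReal.ofReal_mul hR.le]
  refine ENNReal.ofReal_le_ofReal ?_
  set M : ℝ → ℂ := fun t => mellin F (a + (t / 2 : ℝ) * I) with hM
  set S := ∑ t ∈ B, ‖M t‖ ^ 2 with hS
  set D : ℝ → ℂ := fun v => ∑ t ∈ B, (starRingEnd ℂ) (M t) * (v : ℂ) ^ (((t / 2 : ℝ) : ℂ) * I)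
    with hD
  set P : ℝ → ℝ := fun v => tentWeight η v * v⁻¹ * ‖D v‖ ^ 2 with hP
  have hPeq : ∀ v : ℝ, 0 < v → (P v : ℂ) = ∑ t ∈ B, ∑ t' ∈ B, (starRingEnd ℂ) (M t) * M t' *
      ((tentWeight η v : ℂ) * (v : ℂ) ^ ((((t - t') / 2 : ℝ) : ℂ) * I - 1)) := by
    intro v hv
    have hvc : (v : ℂ) ≠ 0 := by exact_mod_cast hv.ne'
    have e1 : ((‖D v‖ ^ 2 : ℝ) : ℂ) = D v * (starRingEnd ℂ) (D v) := by
      rw [mul_conj, normSq_eq_norm_sq]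
    rw [hP]
    simp only
    rw [ofReal_mul, e1, hD]
    simp only
    rw [map_sum, Finset.sum_mul_sum, Finset.mul_sum]
    refine Finset.sum_congr rfl fun t _ => ?_
    rw [Finset.mul_sum]
    refine Finset.sum_congr rfl fun t' _ => ?_
    rw [map_mul, conj_conj, ofReal_cpow_mul_I_conj hv, cpow_sub _ _ hvc, cpow_one]
    have e2 : (((t - t') / 2 : ℝ) : ℂ) * I = ((t / 2 : ℝ) : ℂ) * I + ((-(t' / 2) : ℝ) : ℂ) * I := by
      push_cast; ring
    rw [e2, cpow_add _ _ hvc]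
    push_cast
    field_simp
  have hki : ∀ t t' : ℝ, MeasureTheory.Integrable (fun v : ℝ => (starRingEnd ℂ) (M t) * M t' *
      ((tentWeight η v : ℂ) * (v : ℂ) ^ ((((t - t') / 2 : ℝ) : ℂ) * I - 1))) μ := fun t t' =>
    (tentWeight_mellin hη ((t - t') / 2)).1.const_mul _
  have hPci : MeasureTheory.Integrable (fun v : ℝ => (P v : ℂ)) μ := by
    refine (MeasureTheory.integrable_finsetSum B fun t _ =>
      MeasureTheory.integrable_finsetSum B fun t' _ => hki t t').congr ?_
    filter_upwards [hae] with v hv using (hPeq v hv).symm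
  have hPi : MeasureTheory.Integrable P μ := by simpa using hPci.re
  have hPle : ∫ v, P v ∂μ ≤ R * S := by
    have e : ((∫ v, P v ∂μ : ℝ) : ℂ) = ∑ t ∈ B, ∑ t' ∈ B, (starRingEnd ℂ) (M t) * M t' *
        ∫ v, ((tentWeight η v : ℂ) * (v : ℂ) ^ ((((t - t') / 2 : ℝ) : ℂ) * I - 1)) ∂μ := by
      rw [← integral_complex_ofReal, MeasureTheory.integral_congr_ae (g := fun v => ∑ t ∈ B, ∑ t' ∈ B,
        (starRingEnd ℂ) (M t) * M t' * ((tentWeight η v : ℂ) *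
          (v : ℂ) ^ ((((t - t') / 2 : ℝ) : ℂ) * I - 1)))
        (by filter_upwards [hae] with v hv using hPeq v hv),
        MeasureTheory.integral_finsetSum _ fun t _ =>
          MeasureTheory.integrable_finsetSum B fun t' _ => hki t t']
      refine Finset.sum_congr rfl fun t _ => ?_
      rw [MeasureTheory.integral_finsetSum _ fun t' _ => hki t t']
      exact Finset.sum_congr rfl fun t' _ => MeasureTheory.integral_const_mul _ _
    have h2 := norm_sum_sum_mul_le B M
      (fun t t' => ∫ v, ((tentWeight η v : ℂ) * (v : ℂ) ^ ((((t - t') / 2 : ℝ) : ℂ) * I - 1)) ∂μ)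
      (fun t t' => 2 * η / (η ^ 2 + ((t - t') / 2) ^ 2))
      (fun t _ t' _ => (tentWeight_mellin hη ((t - t') / 2)).2)
      (fun t t' => by congr 2; ring) hB
    rw [← e, norm_real] at h2
    exact (le_abs_self _).trans h2
  set g : ℝ → ℂ := fun v => (v : ℂ) ^ ((a : ℂ) - 1) * F v * D v with hg
  have hgeq : ∀ v : ℝ, 0 < v → g v = ∑ t ∈ B, (starRingEnd ℂ) (M t) *
      ((v : ℂ) ^ ((a : ℂ) + (t / 2 : ℝ) * I - 1) • F v) := by
    intro v hv
    have hvc : (v : ℂ) ≠ 0 := by exact_mod_cast hv.ne'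
    rw [hg]
    simp only
    rw [hD]
    simp only
    rw [Finset.mul_sum]
    refine Finset.sum_congr rfl fun t _ => ?_
    have e2 : (a : ℂ) + (t / 2 : ℝ) * I - 1 = (a - 1) + ((t / 2 : ℝ) : ℂ) * I := by ring
    rw [e2, cpow_add _ _ hvc, smul_eq_mul]
    ring
  have hconv : ∀ t : ℝ, MellinConvergent F (a + (t / 2 : ℝ) * I) := by
    intro t
    refine MeasureTheory.Integrable.mono hF ?_ ?_
    · have h1 : Measurable fun v : ℝ => (v : ℂ) ^ ((a : ℂ) + (t / 2 : ℝ) * I - 1) := by fun_prop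
      exact h1.aestronglyMeasurable.smul hFm
    · filter_upwards [hae] with v hv
      rw [norm_smul, norm_smul, norm_cpow_eq_rpow_re_of_pos hv, norm_cpow_eq_rpow_re_of_pos hv]
      simp
  have hti : ∀ t : ℝ, MeasureTheory.Integrable (fun v : ℝ => (starRingEnd ℂ) (M t) *
      ((v : ℂ) ^ ((a : ℂ) + (t / 2 : ℝ) * I - 1) • F v)) μ := fun t => (hconv t).const_mul _
  have hgi : ∫ v, g v ∂μ = (S : ℂ) := by
    rw [MeasureTheory.integral_congr_ae (g := fun v : ℝ => ∑ t ∈ B, (starRingEnd ℂ) (M t) *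
      ((v : ℂ) ^ ((a : ℂ) + (t / 2 : ℝ) * I - 1) • F v))
      (by filter_upwards [hae] with v hv using hgeq v hv),
      MeasureTheory.integral_finsetSum _ fun t _ => hti t, hS, ofReal_sum]
    refine Finset.sum_congr rfl fun t _ => ?_
    rw [MeasureTheory.integral_const_mul, ← normSq_eq_norm_sq, ← mul_conj, mul_comm]
    rfl
  have hgP : ∀ᵐ v ∂μ, ‖g v‖ ≤ R / 2 * h v + 1 / (2 * R) * P v := by
    filter_upwards [hae, hh0] with v hv hv0
    have ht := tentWeight_pos η hv
    have hP0 : 0 ≤ P v := by positivity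
    have e : ‖g v‖ ^ 2 = h v * P v := by
      rw [hg, hh, hP]
      simp only
      rw [norm_mul, norm_mul, norm_cpow_eq_rpow_re_of_pos hv, sub_re, ofReal_re, one_re]
      have e3 : (2 * a - 1) = (a - 1) * 2 + 1 := by ring
      have e4 : (v ^ (a - 1)) ^ 2 = v ^ ((a - 1) * 2) := by
        rw [Real.rpow_mul hv.le]; norm_cast
      rw [e3, Real.rpow_add hv, ← e4, Real.rpow_one]
      field_simp
    refine (abs_le_of_sq_le_sq' ?_ (by positivity)).2
    rw [e]
    have e5 : (R / 2 * h v + 1 / (2 * R) * P v) ^ 2 =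
        h v * P v + (R / 2 * h v - 1 / (2 * R) * P v) ^ 2 := by field_simp; ring
    rw [e5]
    nlinarith [sq_nonneg (R / 2 * h v - 1 / (2 * R) * P v)]
  have hfin : S ≤ R / 2 * ∫ v, h v ∂μ + 1 / (2 * R) * ∫ v, P v ∂μ := by
    calc S ≤ ‖(S : ℂ)‖ := by rw [norm_real]; exact le_abs_self _
      _ = ‖∫ v, g v ∂μ‖ := by rw [hgi]
      _ ≤ ∫ v, (R / 2 * h v + 1 / (2 * R) * P v) ∂μ :=
          MeasureTheory.norm_integral_le_of_norm_le ((hhi.const_mul _).add (hPi.const_mul _)) hgP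
      _ = _ := by
          rw [MeasureTheory.integral_add (hhi.const_mul _) (hPi.const_mul _),
            MeasureTheory.integral_const_mul, MeasureTheory.integral_const_mul]
  have h3 : 1 / (2 * R) * ∫ v, P v ∂μ ≤ S / 2 := by
    calc _ ≤ 1 / (2 * R) * (R * S) := by gcongr
      _ = _ := by field_simp
  linarith

end DiscreteMeanValue

section ThetaRay

lemma norm_charTheta_conj {N : ℕ} [NeZero N] {χ : DirichletCharacter ℂ N} (hreal : χ⁻¹ = χ)
    (κ : ℕ) (c : ℂ) : ‖charTheta χ κ ((starRingEnd ℂ) c)‖ = ‖charTheta χ κ c‖ := by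
  have h : charTheta χ κ ((starRingEnd ℂ) c) = (starRingEnd ℂ) (charTheta χ κ c) := by
    unfold charTheta
    rw [conj_tsum]
    refine tsum_congr fun n => ?_
    have e : (starRingEnd ℂ) (χ n) = χ n := by
      have h1 := MulChar.star_apply' χ (n : ZMod N)
      rw [hreal] at h1
      exact h1
    rw [map_mul, map_mul, map_pow, ← exp_conj, e]
    simp
  rw [h, norm_conj]

lemma norm_charTheta_ray_inv {N : ℕ} [NeZero N] (hN : N ≠ 1) {χ : DirichletCharacter ℂ N}
    (hχ : χ.IsPrimitive) (hreal : χ⁻¹ = χ) {κ : ℕ} (hκ1 : κ ≤ 1) (hκ : χ (-1) = (-1) ^ κ)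
    {z : ℂ} (hz : 0 < z.re) (hz1 : ‖z‖ = 1) {u : ℝ} (hu : 0 < u) :
    ‖charTheta χ κ (z / N * (u⁻¹ : ℝ))‖ = u ^ (1 / 2 + κ : ℝ) * ‖charTheta χ κ (z / N * u)‖ := by
  have hx : 0 < (z * (u⁻¹ : ℝ)).re := by
    rw [re_mul_ofReal]; positivity
  have h := norm_charTheta_functional hN hχ hreal hκ1 hκ hx
  have e1 : z * (u⁻¹ : ℝ) / N = z / N * (u⁻¹ : ℝ) := by ring
  have e2 : 1 / (z * (u⁻¹ : ℝ) * N) = (starRingEnd ℂ) (z / N * u) := by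
    have hz2 : z⁻¹ = (starRingEnd ℂ) z := inv_eq_conj hz1
    rw [map_mul, map_div₀, ← hz2, conj_ofReal, map_natCast]
    push_cast
    field_simp
  rw [e1, e2, norm_charTheta_conj hreal, norm_mul, hz1, one_mul, norm_real,
    Real.norm_of_nonneg (by positivity), Real.inv_rpow hu.le, Real.rpow_neg hu.le, inv_inv] at h
  exact h

lemma lintegral_theta_ray_le {N : ℕ} [NeZero N] (hN : N ≠ 1) {χ : DirichletCharacter ℂ N}
    (hχ : χ.IsPrimitive) (hreal : χ⁻¹ = χ) {κ : ℕ} (hκ1 : κ ≤ 1) (hκ : χ (-1) = (-1) ^ κ)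
    {z : ℂ} (hz : 0 < z.re) (hz1 : ‖z‖ = 1) (η : ℝ) :
    ∫⁻ v in Set.Ioi (0 : ℝ), ENNReal.ofReal (‖charTheta χ κ (z / N * v)‖ ^ 2 *
        v ^ (2 * (1 / 4 + κ / 2 : ℝ) - 1) * (tentWeight η v)⁻¹) =
      ENNReal.ofReal (2 * (N : ℝ) ^ (1 / 2 + κ + η : ℝ)) * ∫⁻ v in Set.Ioi (N : ℝ)⁻¹,
        ENNReal.ofReal (‖charTheta χ κ (z * v)‖ ^ 2 * v ^ (κ - 1 / 2 + η : ℝ)) := by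
  have hNpos : (0 : ℝ) < N := by exact_mod_cast Nat.pos_of_ne_zero (NeZero.ne N)
  set f : ℝ → ENNReal := fun v => ENNReal.ofReal (‖charTheta χ κ (z / N * v)‖ ^ 2 *
        v ^ (2 * (1 / 4 + κ / 2 : ℝ) - 1) * (tentWeight η v)⁻¹) with hf
  set g : ℝ → ENNReal := fun v => ENNReal.ofReal (‖charTheta χ κ (z / N * v)‖ ^ 2 *
        v ^ (κ - 1 / 2 + η : ℝ)) with hg
  have e0 : 2 * (1 / 4 + κ / 2 : ℝ) - 1 = κ - 1 / 2 := by ring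
  have h1 : ∫⁻ v in Set.Ioi (1 : ℝ), f v = ∫⁻ v in Set.Ioi (1 : ℝ), g v := by
    refine MeasureTheory.setLIntegral_congr_fun measurableSet_Ioi fun v hv => ?_
    have hv1 : (1 : ℝ) < v := hv
    have hv0 : 0 < v := by linarith
    simp only [hf, hg]
    rw [e0, tentWeight, if_neg (not_le.2 hv1), Real.rpow_neg hv0.le, inv_inv, mul_assoc,
      ← Real.rpow_add hv0]
  have h2 : ∫⁻ v in Set.Ioo (0 : ℝ) 1, f v = ∫⁻ v in Set.Ioi (1 : ℝ), g v := by
    have him : Set.Ioo (0 : ℝ) 1 = (fun u : ℝ => u⁻¹) '' Set.Ioi 1 := by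
      rw [Set.image_inv_eq_inv, Set.inv_Ioi₀ one_pos, inv_one]
    rw [him, MeasureTheory.lintegral_image_eq_lintegral_abs_deriv_mul measurableSet_Ioi
      (f' := fun u => -(u ^ 2)⁻¹)
      (fun u hu => (hasDerivAt_inv (by have : (1 : ℝ) < u := hu; positivity)).hasDerivWithinAt)
      (fun u _ v _ h => inv_injective h)]
    refine MeasureTheory.setLIntegral_congr_fun measurableSet_Ioi fun u hu => ?_
    have hu1 : (1 : ℝ) < u := hu
    have hu0 : 0 < u := by linarith
    simp only [hf, hg]
    rw [← ENNReal.ofReal_mul (abs_nonneg _), norm_charTheta_ray_inv hN hχ hreal hκ1 hκ hz hz1 hu0,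
      e0, tentWeight, if_pos (inv_le_one_of_one_le₀ hu1.le), abs_neg, abs_of_pos (by positivity),
      Real.inv_rpow hu0.le, Real.inv_rpow hu0.le, inv_inv, mul_pow]
    congr 1
    have e1 : (u ^ (1 / 2 + κ : ℝ)) ^ 2 = u ^ (κ - 1 / 2 : ℝ) * u ^ (κ - 1 / 2 : ℝ) * u ^ 2 := by
      rw [← Real.rpow_natCast, ← Real.rpow_natCast, ← Real.rpow_mul hu0.le, ← Real.rpow_add hu0,
        ← Real.rpow_add hu0]
      congr 1; push_cast; ring
    rw [e1, Real.rpow_add hu0]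
    have : 0 < u ^ (κ - 1 / 2 : ℝ) := by positivity
    field_simp
  have h3 : ∫⁻ v in Set.Ioi (0 : ℝ), f v = 2 * ∫⁻ v in Set.Ioi (1 : ℝ), g v := by
    have hu : Set.Ioi (0 : ℝ) = Set.Ioc 0 1 ∪ Set.Ioi 1 :=
      (Set.Ioc_union_Ioi_eq_Ioi zero_le_one).symm
    rw [hu, MeasureTheory.lintegral_union measurableSet_Ioi (Set.Ioc_disjoint_Ioi le_rfl), h1,
      MeasureTheory.setLIntegral_congr MeasureTheory.Ioo_ae_eq_Ioc.symm, h2, two_mul]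
  have h4 : ∫⁻ v in Set.Ioi (1 : ℝ), g v = ENNReal.ofReal ((N : ℝ) ^ (1 / 2 + κ + η : ℝ)) *
      ∫⁻ v in Set.Ioi (N : ℝ)⁻¹,
        ENNReal.ofReal (‖charTheta χ κ (z * v)‖ ^ 2 * v ^ (κ - 1 / 2 + η : ℝ)) := by
    have him : Set.Ioi (1 : ℝ) = (fun u : ℝ => (N : ℝ) * u) '' Set.Ioi (N : ℝ)⁻¹ := by
      rw [Set.image_mul_left_Ioi hNpos, mul_inv_cancel₀ hNpos.ne']
    rw [him, MeasureTheory.lintegral_image_eq_lintegral_abs_deriv_mul measurableSet_Ioi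
      (f' := fun u => (N : ℝ))
      (fun u hu => by simpa using ((hasDerivAt_id u).const_mul (N : ℝ)).hasDerivWithinAt)
      (fun u _ v _ h => mul_left_cancel₀ hNpos.ne' h),
      ← MeasureTheory.lintegral_const_mul' _ _ ENNReal.ofReal_ne_top]
    refine MeasureTheory.setLIntegral_congr_fun measurableSet_Ioi fun u hu => ?_
    have hu0 : 0 < u := lt_trans (by positivity) (Set.mem_Ioi.1 hu)
    simp only [hg]
    have e2 : z / N * ((N * u : ℝ) : ℂ) = z * u := by
      have : (N : ℂ) ≠ 0 := by exact_mod_cast hNpos.ne'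
      push_cast
      field_simp
    rw [← ENNReal.ofReal_mul (abs_nonneg _), ← ENNReal.ofReal_mul (by positivity), e2,
      abs_of_pos hNpos, Real.mul_rpow hNpos.le hu0.le]
    congr 1
    have e3 : (N : ℝ) ^ (1 / 2 + κ + η : ℝ) = N * N ^ (κ - 1 / 2 + η : ℝ) := by
      have e5 : (1 / 2 + κ + η : ℝ) = 1 + (κ - 1 / 2 + η) := by ring
      rw [e5, Real.rpow_add hNpos, Real.rpow_one]
    rw [e3]
    ring
  rw [h3, h4, ← mul_assoc, ENNReal.ofReal_mul two_pos.le]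
  norm_num

/-- The mean square of `L(1/2 + it, χ)` over well-spaced `t` of size about `X` is controlled by a
mean square of the theta series along a ray. -/
theorem sum_norm_sq_LFunction_le {N : ℕ} [NeZero N] (hN : N ≠ 1) {χ : DirichletCharacter ℂ N}
    (hχ : χ.IsPrimitive) (hχ1 : χ ≠ 1) (hreal : χ⁻¹ = χ) {κ : ℕ} (hκ1 : κ ≤ 1)
    (hκ : χ (-1) = (-1) ^ κ) {X s η R : ℝ} (hX : 1 ≤ X) (hs1 : |s| = 1) (hη : 0 < η) (hR : 0 < R)
    {B : Finset ℝ} (hBX : ∀ t ∈ B, s * t = |t| ∧ |t| ≤ X ∧ X ≤ 2 + 2 * |t|)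
    (hB : ∀ t ∈ B, ∑ t' ∈ B, 2 * η / (η ^ 2 + ((t - t') / 2) ^ 2) ≤ R) :
    ENNReal.ofReal (archConst * X ^ (κ - 1 / 2 : ℝ) *
        ∑ t ∈ B, ‖DirichletCharacter.LFunction χ (1 / 2 + t * I)‖ ^ 2) ≤
      ENNReal.ofReal (2 * R * (N : ℝ) ^ η) * ∫⁻ v in Set.Ioi (N : ℝ)⁻¹,
        ENNReal.ofReal (‖charTheta χ κ (cexp ((s * (Real.pi / 2 - 1 / X) : ℝ) * I) * v)‖ ^ 2 *
          v ^ (κ - 1 / 2 + η : ℝ)) := by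
  have hNpos : (0 : ℝ) < N := by exact_mod_cast Nat.pos_of_ne_zero (NeZero.ne N)
  have hNc : (N : ℂ) = ((N : ℝ) : ℂ) := by push_cast; rfl
  set z := cexp ((s * (Real.pi / 2 - 1 / X) : ℝ) * I) with hz
  have hz1 : ‖z‖ = 1 := norm_exp_ofReal_mul_I _
  have hzre : 0 < z.re := by
    rw [hz, exp_ofReal_mul_I_re]
    refine Real.cos_pos_of_mem_Ioo ?_
    have hX0 : 0 < X := by linarith
    have hX1 : 1 / X ≤ 1 := by rw [div_le_one hX0]; exact hX
    have hX2 : 0 < 1 / X := by positivity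
    have hpi := Real.pi_gt_three
    have := abs_lt.1 (show |s * (Real.pi / 2 - 1 / X)| < Real.pi / 2 by
      rw [abs_mul, hs1, one_mul, abs_of_pos (by linarith)]; linarith)
    exact this
  have hzN : 0 < (z / N).re := by rw [hNc, div_ofReal_re]; positivity
  set F : ℝ → ℂ := fun v => charTheta χ κ (z / N * v) with hF
  have hFc : ContinuousOn F (Set.Ioi 0) := continuousOn_charTheta_ray χ κ hzN
  have hconv : MellinConvergent F (((1 / 4 + κ / 2 : ℝ) : ℝ) : ℂ) :=
    mellinConvergent_of_isBigO_rpow (hFc.locallyIntegrableOn measurableSet_Ioi)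
      (charTheta_ray_isBigO_atTop hN χ κ hzN (-(1 / 4 + κ / 2 + 1))) (by rw [ofReal_re]; linarith)
      (charTheta_ray_isBigO_zero hN hχ hreal hκ1 hκ hzN (-0)) (by rw [ofReal_re]; positivity)
  have h1 := sum_norm_mellin_sq_le hFc hη hconv B hR hB
  rw [lintegral_theta_ray_le hN hχ hreal hκ1 hκ hzre hz1 η] at h1
  set J := ∫⁻ v in Set.Ioi (N : ℝ)⁻¹,
        ENNReal.ofReal (‖charTheta χ κ (z * v)‖ ^ 2 * v ^ (κ - 1 / 2 + η : ℝ)) with hJ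
  have h2 : (N : ℝ) ^ (1 / 2 + κ : ℝ) * (archConst * X ^ (κ - 1 / 2 : ℝ) *
        ∑ t ∈ B, ‖DirichletCharacter.LFunction χ (1 / 2 + t * I)‖ ^ 2) ≤
      ∑ t ∈ B, ‖mellin F (((1 / 4 + κ / 2 : ℝ) : ℂ) + (t / 2 : ℝ) * I)‖ ^ 2 := by
    rw [Finset.mul_sum, Finset.mul_sum]
    refine Finset.sum_le_sum fun t ht => ?_
    obtain ⟨a1, a2, a3⟩ := hBX t ht
    have := norm_sq_LFunction_le_mellin hN hχ hχ1 hreal hκ1 hκ hX a1 hs1 a2 a3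
    rw [← hz] at this
    refine le_trans (le_of_eq ?_) this
    ring
  have h3 := (ENNReal.ofReal_le_ofReal h2).trans h1
  have hNp : 0 < (N : ℝ) ^ (1 / 2 + κ : ℝ) := by positivity
  rw [ENNReal.ofReal_mul hNp.le, ← mul_assoc (ENNReal.ofReal R), ← ENNReal.ofReal_mul hR.le,
    Real.rpow_add hNpos (1 / 2 + κ)] at h3
  have e4 : R * (2 * ((N : ℝ) ^ (1 / 2 + κ : ℝ) * (N : ℝ) ^ η)) =
      (N : ℝ) ^ (1 / 2 + κ : ℝ) * (2 * R * (N : ℝ) ^ η) := by ring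
  rw [e4, ENNReal.ofReal_mul hNp.le, mul_assoc (ENNReal.ofReal _)] at h3
  exact (ENNReal.mul_le_mul_iff_right (ENNReal.ofReal_pos.2 hNp).ne' ENNReal.ofReal_ne_top).1 h3

end ThetaRay

section ArithmeticSums

lemma eq_of_isSquare_mul {a b i j : ℕ} (ha : Squarefree a) (hb : Squarefree b)
    (hi : i ≠ 0) (hj : j ≠ 0) (h : IsSquare ((i ^ 2 * a) * (j ^ 2 * b))) : a = b := by
  obtain ⟨c, hc⟩ := h
  have ha0 := ha.ne_zero
  have hb0 := hb.ne_zero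
  refine Nat.eq_of_factorization_eq ha0 hb0 fun p => ?_
  have h1 := congrArg (fun n => n.factorization p) hc
  have hc0 : c ≠ 0 := by
    rintro rfl
    simp [hi, hj, ha0, hb0] at hc
  simp only [Nat.factorization_mul (mul_ne_zero (pow_ne_zero 2 hi) ha0)
    (mul_ne_zero (pow_ne_zero 2 hj) hb0), Nat.factorization_mul (pow_ne_zero 2 hi) ha0,
    Nat.factorization_mul (pow_ne_zero 2 hj) hb0, Nat.factorization_pow,
    Nat.factorization_mul hc0 hc0, Finsupp.add_apply, Finsupp.smul_apply, smul_eq_mul] at h1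
  have h2 := ha.natFactorization_le_one p
  have h3 := hb.natFactorization_le_one p
  omega

/-- The largest odd divisor of `n`. -/
noncomputable def oddPart (n : ℕ) : ℕ := n / 2 ^ n.factorization 2

lemma two_pow_mul_oddPart (n : ℕ) : 2 ^ n.factorization 2 * oddPart n = n :=
  Nat.ordProj_mul_ordCompl_eq_self n 2

lemma odd_oddPart {n : ℕ} (hn : n ≠ 0) : Odd (oddPart n) := by
  rw [← Nat.not_even_iff_odd, even_iff_two_dvd]
  exact Nat.not_dvd_ordCompl Nat.prime_two hn

/-- The summable majorant attached to the decomposition `n = 2 ^ e * j ^ 2 * r`. -/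
noncomputable def pairMajorant (p : ℝ) (x : ℕ × ((ℕ × ℕ) × (ℕ × ℕ))) : ℝ :=
  (x.1 : ℝ) ^ (-(2 * p)) *
      ((((2 : ℝ) ^ (-p)) ^ x.2.1.1 * (x.2.1.2 : ℝ) ^ (-(2 * p))) *
        (((2 : ℝ) ^ (-p)) ^ x.2.2.1 * (x.2.2.2 : ℝ) ^ (-(2 * p))))

lemma pairMajorant_nonneg (p : ℝ) (x) : 0 ≤ pairMajorant p x := by
  unfold pairMajorant
  positivity

lemma summable_pairMajorant {p : ℝ} (hp : 1 / 2 < p) : Summable (pairMajorant p) := by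
  have s1 : Summable fun e : ℕ => ((2 : ℝ) ^ (-p)) ^ e :=
    summable_geometric_of_lt_one (by positivity)
      (Real.rpow_lt_one_of_one_lt_of_neg one_lt_two (by linarith))
  have s2 : Summable fun j : ℕ => (j : ℝ) ^ (-(2 * p)) :=
    Real.summable_nat_rpow.2 (by linarith)
  have n1 : (0 : ℕ → ℝ) ≤ fun e => ((2 : ℝ) ^ (-p)) ^ e := fun e => pow_nonneg
    (Real.rpow_nonneg zero_le_two _) e
  have n2 : (0 : ℕ → ℝ) ≤ fun j : ℕ => (j : ℝ) ^ (-(2 * p)) := fun j =>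
    Real.rpow_nonneg (Nat.cast_nonneg j) _
  have s12 := s1.mul_of_nonneg s2 n1 n2
  have n12 : (0 : ℕ × ℕ → ℝ) ≤ fun x => ((2 : ℝ) ^ (-p)) ^ x.1 * (x.2 : ℝ) ^ (-(2 * p)) :=
    fun x => mul_nonneg (n1 x.1) (n2 x.2)
  have s3 := s12.mul_of_nonneg s12 n12 n12
  exact s2.mul_of_nonneg s3 n2 fun x => mul_nonneg (n12 x.1) (n12 x.2)

lemma exists_sum_sqrt_isSquare_le {η : ℝ} (hη : 0 < η) : ∃ C > (0 : ℝ), ∀ M : ℕ,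
    ∑ x ∈ (Finset.Ico 1 M ×ˢ Finset.Ico 1 M).filter
      (fun x => IsSquare (oddPart x.1 * oddPart x.2)),
        ((x.1 : ℝ) * x.2) ^ (-(1 / 2 + η)) ≤ C := by
  obtain ⟨p, hp, hp2⟩ : ∃ p : ℝ, 1 / 2 + η = p ∧ 1 / 2 < p := ⟨_, rfl, by linarith⟩
  rw [hp]
  have hdec : ∀ n : ℕ, ∃ r j : ℕ, j ^ 2 * r = oddPart n ∧ (n ≠ 0 → Squarefree r) := by
    intro n
    obtain ⟨a, b, h, hs⟩ := Nat.sq_mul_squarefree (oddPart n)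
    exact ⟨a, b, h, fun _ => hs⟩
  choose r j hrj hsf using hdec
  have hn : ∀ n : ℕ, n = 2 ^ n.factorization 2 * (j n ^ 2 * r n) := fun n => by
    rw [hrj, two_pow_mul_oddPart]
  refine ⟨∑' x, pairMajorant p x + 1, add_pos_of_nonneg_of_pos
    (tsum_nonneg (pairMajorant_nonneg p)) one_pos, fun M => ?_⟩
  set A := (Finset.Ico 1 M ×ˢ Finset.Ico 1 M).filter
      (fun x => IsSquare (oddPart x.1 * oddPart x.2)) with hA
  set Φ : ℕ × ℕ → ℕ × ((ℕ × ℕ) × (ℕ × ℕ)) := fun x =>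
    (r x.1, (x.1.factorization 2, j x.1), (x.2.factorization 2, j x.2)) with hΦ
  have hreq : ∀ x ∈ A, r x.1 = r x.2 ∧ x.1 ≠ 0 ∧ x.2 ≠ 0 := by
    intro x hx
    rw [hA, Finset.mem_filter, Finset.mem_product, Finset.mem_Ico, Finset.mem_Ico] at hx
    obtain ⟨⟨⟨h1, -⟩, h2, -⟩, h3⟩ := hx
    have n1 : x.1 ≠ 0 := by omega
    have n2 : x.2 ≠ 0 := by omega
    have hj0 : ∀ n : ℕ, n ≠ 0 → j n ≠ 0 := by
      intro n hn0 h
      have := hn n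
      rw [h] at this
      simp at this
      exact hn0 this
    refine ⟨eq_of_isSquare_mul (hsf _ n1) (hsf _ n2) (hj0 _ n1) (hj0 _ n2) ?_, n1, n2⟩
    rw [hrj, hrj]
    exact h3
  have hinj : Set.InjOn Φ A := by
    intro x hx y hy h
    simp only [hΦ, Prod.mk.injEq] at h
    obtain ⟨h1, ⟨h2, h3⟩, h4, h5⟩ := h
    have hx' := (hreq x hx).1
    have hy' := (hreq y hy).1
    refine Prod.ext ?_ ?_
    · rw [hn x.1, hn y.1, h1, h2, h3]
    · rw [hn x.2, hn y.2, ← hx', ← hy', h1, h4, h5]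
  have hterm : ∀ x ∈ A, ((x.1 : ℝ) * x.2) ^ (-p) = pairMajorant p (Φ x) := by
    intro x hx
    have h1 := (hreq x hx).1
    have hpw : ∀ n : ℕ, (n : ℝ) ^ (-p) = (r n : ℝ) ^ (-p) * (((2 : ℝ) ^ (-p)) ^ (n.factorization 2) *
        (j n : ℝ) ^ (-(2 * p))) := by
      intro n
      conv_lhs => rw [hn n]
      push_cast
      rw [Real.mul_rpow (by positivity) (by positivity), Real.mul_rpow (by positivity)
        (by positivity), ← Real.rpow_natCast, ← Real.rpow_natCast, ← Real.rpow_mul (by positivity),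
        ← Real.rpow_mul (by positivity), ← Real.rpow_natCast, ← Real.rpow_mul (by positivity)]
      have e1 : ((n.factorization 2 : ℕ) : ℝ) * -p = -p * (n.factorization 2 : ℕ) := by ring
      have e2 : ((2 : ℕ) : ℝ) * -p = -(2 * p) := by push_cast; ring
      rw [e1, e2]
      ring
    rw [Real.mul_rpow (by positivity) (by positivity), hpw x.1, hpw x.2, ← h1, hΦ, pairMajorant]
    dsimp only
    have hr0 : (0 : ℝ) < r x.1 := by
      exact_mod_cast Nat.pos_of_ne_zero (hsf _ (hreq x hx).2.1).ne_zero
    have e3 : -(2 * p) = -p + -p := by ring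
    have e4 : (r x.1 : ℝ) ^ (-(2 * p)) = (r x.1 : ℝ) ^ (-p) * (r x.1 : ℝ) ^ (-p) := by
      rw [e3, Real.rpow_add hr0]
    rw [e4]
    ring
  rw [Finset.sum_congr rfl hterm, ← Finset.sum_image (f := pairMajorant p) (g := Φ) hinj]
  linarith [(summable_pairMajorant hp2).sum_le_tsum (A.image Φ) fun x _ => pairMajorant_nonneg p x]

lemma exists_sum_sqrt_div_sub_le {η : ℝ} (hη : 0 < η) : ∃ C > (0 : ℝ), ∀ M : ℕ,
    ∑ x ∈ Finset.Ico 1 M ×ˢ Finset.Ico 1 M,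
      ((x.1 : ℝ) * x.2) ^ (-(1 / 2 + η)) / |(x.1 : ℝ) - x.2| ≤ C := by
  have s1 : Summable fun n : ℕ => (n : ℝ) ^ (-(1 + η)) :=
    (Real.summable_nat_rpow (p := -(1 + η))).2 (by linarith)
  have s2 : Summable fun n : ℤ => |(n : ℝ)| ^ (-(1 + η)) :=
    Real.summable_abs_int_rpow (by linarith)
  set A := ∑' n : ℕ, (n : ℝ) ^ (-(1 + η)) with hA
  set B := ∑' n : ℤ, |(n : ℝ)| ^ (-(1 + η)) with hB
  have hA0 : 0 ≤ A := tsum_nonneg fun n => by positivity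
  have hB0 : 0 ≤ B := tsum_nonneg fun n => by positivity
  refine ⟨2 * (A * B) + 1, by positivity, fun M => ?_⟩
  have key : ∀ m n : ℕ, m ≠ 0 → m < n → ((m : ℝ) * n) ^ (-(1 / 2 + η)) / |(m : ℝ) - n| ≤
      (m : ℝ) ^ (-(1 + η)) * |(m : ℝ) - n| ^ (-(1 + η)) := by
    intro m n hm hmn
    have hm0 : (0 : ℝ) < m := by exact_mod_cast Nat.pos_of_ne_zero hm
    have hmn' : (m : ℝ) < n := by exact_mod_cast hmn
    have hn0 : (0 : ℝ) < n := by linarith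
    have habs : |(m : ℝ) - n| = n - m := by rw [abs_sub_comm, abs_of_pos (by linarith)]
    rw [habs]
    have hh : 0 < (n : ℝ) - m := by linarith
    have h1 : (n : ℝ) ^ (-(1 / 2 + η)) ≤ (m : ℝ) ^ (-(1 / 2 : ℝ)) * ((n : ℝ) - m) ^ (-η) := by
      rw [neg_add, Real.rpow_add hn0]
      refine mul_le_mul (Real.rpow_le_rpow_of_nonpos hm0 hmn'.le (by norm_num))
        (Real.rpow_le_rpow_of_nonpos hh (by linarith) (by linarith)) (by positivity) (by positivity)
    rw [Real.mul_rpow hm0.le hn0.le]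
    have e1 : (m : ℝ) ^ (-(1 + η)) = (m : ℝ) ^ (-(1 / 2 + η)) * (m : ℝ) ^ (-(1 / 2 : ℝ)) := by
      rw [← Real.rpow_add hm0]; congr 1; ring
    have e2 : ((n : ℝ) - m) ^ (-(1 + η)) = ((n : ℝ) - m) ^ (-η) / ((n : ℝ) - m) := by
      rw [neg_add, add_comm, Real.rpow_add hh, Real.rpow_neg_one, div_eq_mul_inv]
    calc _ ≤ (m : ℝ) ^ (-(1 / 2 + η)) * ((m : ℝ) ^ (-(1 / 2 : ℝ)) * ((n : ℝ) - m) ^ (-η)) /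
          ((n : ℝ) - m) := by gcongr
      _ = _ := by rw [e1, e2]; ring
  have key2 : ∀ x ∈ Finset.Ico 1 M ×ˢ Finset.Ico 1 M,
      ((x.1 : ℝ) * x.2) ^ (-(1 / 2 + η)) / |(x.1 : ℝ) - x.2| ≤
        (x.1 : ℝ) ^ (-(1 + η)) * |(x.1 : ℝ) - x.2| ^ (-(1 + η)) +
        (x.2 : ℝ) ^ (-(1 + η)) * |(x.2 : ℝ) - x.1| ^ (-(1 + η)) := by
    intro x hx
    rw [Finset.mem_product, Finset.mem_Ico, Finset.mem_Ico] at hx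
    rcases lt_trichotomy x.1 x.2 with h | h | h
    · refine (key x.1 x.2 (by omega) h).trans (le_add_of_nonneg_right (by positivity))
    · rw [h, sub_self, abs_zero, div_zero]
      positivity
    · rw [mul_comm (x.1 : ℝ), abs_sub_comm]
      refine (key x.2 x.1 (by omega) h).trans (le_add_of_nonneg_left (by positivity))
  have hinner : ∀ m : ℕ, ∑ n ∈ Finset.Ico 1 M, |(m : ℝ) - n| ^ (-(1 + η)) ≤ B := by
    intro m
    have hinj : Set.InjOn (fun n : ℕ => (m : ℤ) - n) (Finset.Ico 1 M : Set ℕ) := by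
      intro a _ b _ h
      simp only at h
      omega
    have e : ∀ n ∈ Finset.Ico 1 M, |(m : ℝ) - n| ^ (-(1 + η)) =
        (fun k : ℤ => |(k : ℝ)| ^ (-(1 + η))) ((m : ℤ) - n) := by
      intro n _
      push_cast
      rfl
    rw [Finset.sum_congr rfl e, ← Finset.sum_image (f := fun k : ℤ => |(k : ℝ)| ^ (-(1 + η)))
      (g := fun n : ℕ => (m : ℤ) - n) hinj]
    exact s2.sum_le_tsum _ fun _ _ => by positivity
  have houter : ∑ m ∈ Finset.Ico 1 M, ∑ n ∈ Finset.Ico 1 M,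
      (m : ℝ) ^ (-(1 + η)) * |(m : ℝ) - n| ^ (-(1 + η)) ≤ A * B := by
    calc _ ≤ ∑ m ∈ Finset.Ico 1 M, (m : ℝ) ^ (-(1 + η)) * B := by
          refine Finset.sum_le_sum fun m _ => ?_
          rw [← Finset.mul_sum]
          exact mul_le_mul_of_nonneg_left (hinner m) (by positivity)
      _ ≤ A * B := by
          rw [← Finset.sum_mul]
          exact mul_le_mul_of_nonneg_right (s1.sum_le_tsum _ fun _ _ => by positivity) hB0
  calc _ ≤ _ := Finset.sum_le_sum key2
    _ ≤ A * B + A * B := by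
        rw [Finset.sum_add_distrib, Finset.sum_product, Finset.sum_product_right]
        exact add_le_add houter houter
    _ ≤ _ := by linarith

end ArithmeticSums

section KernelBounds

open MeasureTheory

lemma norm_cexp_neg_mul_ofReal (a : ℂ) (v : ℝ) : ‖cexp (-(a * v))‖ = Real.exp (-(a.re * v)) := by
  rw [Complex.norm_exp]
  simp

lemma norm_rpow_mul_cexp (β : ℝ) (a : ℂ) {v : ℝ} (hv : 0 < v) :
    ‖((v ^ β : ℝ) : ℂ) * cexp (-(a * v))‖ = v ^ β * Real.exp (-(a.re * v)) := by
  rw [norm_mul, norm_cexp_neg_mul_ofReal, Complex.norm_real, Real.norm_of_nonneg (by positivity)]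

lemma integrableOn_rpow_mul_exp_Ioi (β : ℝ) {r V : ℝ} (hr : 0 < r) (hV : 0 < V) :
    IntegrableOn (fun v : ℝ => v ^ β * Real.exp (-(r * v))) (Set.Ioi V) := by
  have h1 : IntegrableOn (fun v : ℝ => v ^ ((|β| + 1) - 1) * Real.exp (-(r * v))) (Set.Ioi V) :=
    (integrableOn_rpow_sub_one_mul_exp (by positivity) hr).mono_set (Set.Ioi_subset_Ioi hV.le)
  have hc : ContinuousOn (fun v : ℝ => v ^ β * Real.exp (-(r * v))) (Set.Ioi V) := by
    refine ContinuousOn.mul (fun v hv => ?_) (by fun_prop)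
    exact (Real.continuousAt_rpow_const _ _ (Or.inl (hV.trans hv).ne')).continuousWithinAt
  refine Integrable.mono' (h1.const_mul (V ^ (β - |β|))) (hc.aestronglyMeasurable measurableSet_Ioi)
    ((ae_restrict_iff' measurableSet_Ioi).2 (Filter.Eventually.of_forall fun v hv => ?_))
  have hv0 : 0 < v := hV.trans hv
  rw [Real.norm_of_nonneg (by positivity), ← mul_assoc]
  gcongr
  rw [add_sub_cancel_right]
  calc v ^ β = v ^ (β - |β|) * v ^ |β| := by rw [← Real.rpow_add hv0]; congr 1; ring
    _ ≤ _ := by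
      exact mul_le_mul_of_nonneg_right (Real.rpow_le_rpow_of_nonpos hV (le_of_lt hv)
        (by linarith [le_abs_self β])) (by positivity)

lemma integrableOn_rpow_mul_cexp_Ioi (β : ℝ) {a : ℂ} {V : ℝ} (hr : 0 < a.re) (hV : 0 < V) :
    IntegrableOn (fun v : ℝ => ((v ^ β : ℝ) : ℂ) * cexp (-(a * v))) (Set.Ioi V) := by
  have hc : ContinuousOn (fun v : ℝ => ((v ^ β : ℝ) : ℂ) * cexp (-(a * v))) (Set.Ioi V) := by
    refine ContinuousOn.mul (Complex.continuous_ofReal.comp_continuousOn fun v hv => ?_)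
      (by fun_prop)
    exact (Real.continuousAt_rpow_const _ _ (Or.inl (hV.trans hv).ne')).continuousWithinAt
  refine Integrable.mono' (integrableOn_rpow_mul_exp_Ioi β hr hV)
    (hc.aestronglyMeasurable measurableSet_Ioi)
    ((ae_restrict_iff' measurableSet_Ioi).2 (Filter.Eventually.of_forall fun v hv => ?_))
  rw [norm_rpow_mul_cexp β a (hV.trans hv)]

lemma norm_integral_rpow_mul_cexp_le (β : ℝ) {a : ℂ} {V : ℝ} (hV : 0 < V) :
    ‖∫ v in Set.Ioi V, ((v ^ β : ℝ) : ℂ) * cexp (-(a * v))‖ ≤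
      ∫ v in Set.Ioi V, v ^ β * Real.exp (-(a.re * v)) := by
  refine (norm_integral_le_integral_norm _).trans (le_of_eq ?_)
  exact setIntegral_congr_fun measurableSet_Ioi fun v hv => norm_rpow_mul_cexp β a (hV.trans hv)

lemma norm_integral_rpow_mul_cexp_le_Gamma {β : ℝ} (hβ : -1 < β) {a : ℂ} {V : ℝ} (hr : 0 < a.re)
    (hV : 0 < V) :
    ‖∫ v in Set.Ioi V, ((v ^ β : ℝ) : ℂ) * cexp (-(a * v))‖ ≤
      Real.Gamma (β + 1) * a.re ^ (-(β + 1)) := by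
  refine (norm_integral_rpow_mul_cexp_le β hV).trans ?_
  have h1 := integrableOn_rpow_sub_one_mul_exp (σ := β + 1) (by linarith) hr
  have h2 := Real.integral_rpow_mul_exp_neg_mul_Ioi (a := β + 1) (by linarith) hr
  rw [add_sub_cancel_right] at h1 h2
  calc _ ≤ ∫ v in Set.Ioi (0 : ℝ), v ^ β * Real.exp (-(a.re * v)) := by
        refine setIntegral_mono_set h1 ?_ (Set.Ioi_subset_Ioi hV.le).eventuallyLE
        refine (ae_restrict_iff' measurableSet_Ioi).2 (Filter.Eventually.of_forall fun v hv => ?_)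
        have : (0 : ℝ) < v := hv
        show 0 ≤ v ^ β * Real.exp (-(a.re * v))
        positivity
    _ = _ := by
        rw [h2, one_div, Real.inv_rpow hr.le, ← Real.rpow_neg hr.le, mul_comm]

lemma integral_exp_neg_mul_Ioi {r : ℝ} (hr : 0 < r) (V : ℝ) :
    ∫ v in Set.Ioi V, Real.exp (-(r * v)) = Real.exp (-(r * V)) / r := by
  have := integral_exp_mul_Ioi (a := -r) (by linarith) V
  simp only [neg_mul] at this
  rw [this, neg_div_neg_eq]

lemma integral_rpow_mul_cexp_eq (β : ℝ) {a : ℂ} {V : ℝ} (hr : 0 < a.re) (hV : 0 < V) :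
    ∫ v in Set.Ioi V, ((v ^ β : ℝ) : ℂ) * cexp (-(a * v)) =
      ((V ^ β : ℝ) : ℂ) * cexp (-(a * V)) / a +
        β / a * ∫ v in Set.Ioi V, ((v ^ (β - 1) : ℝ) : ℂ) * cexp (-(a * v)) := by
  have ha : a ≠ 0 := by rintro rfl; simp at hr
  have hderiv : ∀ v ∈ Set.Ici V, HasDerivAt
      (fun v : ℝ => ((v ^ β : ℝ) : ℂ) * (cexp (-(a * v)) / (-a)))
      (((β * v ^ (β - 1) : ℝ) : ℂ) * (cexp (-(a * v)) / (-a)) +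
        ((v ^ β : ℝ) : ℂ) * cexp (-(a * v))) v := by
    intro v hv
    have hv0 : v ≠ 0 := (hV.trans_le hv).ne'
    have h1 := (Real.hasDerivAt_rpow_const (x := v) (p := β) (Or.inl hv0)).ofReal_comp
    have h2 : HasDerivAt (fun v : ℝ => cexp (-(a * v)) / (-a)) (cexp (-(a * v))) v := by
      have h3 : HasDerivAt (fun v : ℝ => -(a * (v : ℂ))) (-(a * 1)) v :=
        ((hasDerivAt_id v).ofReal_comp.const_mul a).neg
      have h4 := h3.cexp.div_const (-a)
      rwa [mul_one, mul_div_assoc, div_self (neg_ne_zero.2 ha), mul_one] at h4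
    exact h1.mul h2
  have i1 := integrableOn_rpow_mul_cexp_Ioi β hr hV
  have i2 := integrableOn_rpow_mul_cexp_Ioi (β - 1) hr hV
  have i2' : IntegrableOn (fun v : ℝ => ((β * v ^ (β - 1) : ℝ) : ℂ) * (cexp (-(a * v)) / (-a)))
      (Set.Ioi V) := by
    refine (i2.const_mul (-(β / a))).congr (Filter.Eventually.of_forall fun v => ?_)
    push_cast
    field_simp
  have hlim : Filter.Tendsto (fun v : ℝ => ((v ^ β : ℝ) : ℂ) * (cexp (-(a * v)) / (-a)))
      Filter.atTop (nhds 0) := by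
    rw [tendsto_zero_iff_norm_tendsto_zero]
    have h1 := (tendsto_rpow_mul_exp_neg_mul_atTop_nhds_zero β a.re hr).mul_const (1 / ‖a‖)
    rw [zero_mul] at h1
    refine h1.congr' ?_
    filter_upwards [Filter.eventually_gt_atTop 0] with v hv
    rw [← mul_div_assoc (((v ^ β : ℝ) : ℂ)), norm_div, norm_rpow_mul_cexp β a hv, norm_neg,
      neg_mul, mul_one_div]
  have := integral_Ioi_of_hasDerivAt_of_tendsto' hderiv (i2'.add i1) hlim
  rw [integral_add i2' i1] at this
  have e : ∫ v in Set.Ioi V, ((β * v ^ (β - 1) : ℝ) : ℂ) * (cexp (-(a * v)) / (-a)) =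
      -(β / a * ∫ v in Set.Ioi V, ((v ^ (β - 1) : ℝ) : ℂ) * cexp (-(a * v))) := by
    rw [← neg_mul, ← integral_const_mul]
    congr 1
    ext v
    push_cast
    field_simp
  rw [e] at this
  linear_combination this

lemma norm_integral_rpow_mul_cexp_le_of_nonpos {β : ℝ} (hβ : β ≤ 0) {a : ℂ} {V : ℝ}
    (hr : 0 < a.re) (hV : 0 < V) :
    ‖∫ v in Set.Ioi V, ((v ^ β : ℝ) : ℂ) * cexp (-(a * v))‖ ≤
      2 * V ^ β * Real.exp (-(a.re * V)) / ‖a‖ := by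
  have hI : -β * ∫ v in Set.Ioi V, v ^ (β - 1) * Real.exp (-(a.re * v)) ≤
      V ^ β * Real.exp (-(a.re * V)) := by
    rcases hβ.eq_or_lt with rfl | hβ'
    · rw [neg_zero, zero_mul]; positivity
    have h1 : IntegrableOn (fun v : ℝ => v ^ (β - 1)) (Set.Ioi V) :=
      integrableOn_Ioi_rpow_of_lt (by linarith) hV
    have h2 : ∫ v in Set.Ioi V, v ^ (β - 1) * Real.exp (-(a.re * v)) ≤
        ∫ v in Set.Ioi V, v ^ (β - 1) * Real.exp (-(a.re * V)) := by
      refine setIntegral_mono_on (integrableOn_rpow_mul_exp_Ioi _ hr hV) (h1.mul_const _)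
        measurableSet_Ioi fun v hv => ?_
      have : 0 < v := hV.trans hv
      have hv' : V ≤ v := le_of_lt hv
      gcongr
    rw [integral_mul_const, integral_Ioi_rpow_of_lt (by linarith) hV] at h2
    calc _ ≤ -β * (-V ^ (β - 1 + 1) / (β - 1 + 1) * Real.exp (-(a.re * V))) :=
          mul_le_mul_of_nonneg_left h2 (by linarith)
      _ = _ := by
          rw [sub_add_cancel]
          have := hβ'.ne
          field_simp
  rw [integral_rpow_mul_cexp_eq β hr hV]
  refine (norm_add_le _ _).trans ?_
  rw [norm_div, norm_rpow_mul_cexp β a hV, norm_mul, norm_div, Complex.norm_real, Real.norm_eq_abs,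
    abs_of_nonpos hβ]
  have h3 := norm_integral_rpow_mul_cexp_le (β - 1) (a := a) hV
  calc _ ≤ V ^ β * Real.exp (-(a.re * V)) / ‖a‖ +
        -β / ‖a‖ * ∫ v in Set.Ioi V, v ^ (β - 1) * Real.exp (-(a.re * v)) := by
        gcongr
        exact div_nonneg (by linarith) (norm_nonneg _)
    _ ≤ V ^ β * Real.exp (-(a.re * V)) / ‖a‖ + V ^ β * Real.exp (-(a.re * V)) / ‖a‖ := by
        rw [div_mul_eq_mul_div]
        gcongr
    _ = _ := by ring

lemma norm_integral_rpow_mul_cexp_le_of_nonneg {β : ℝ} (hβ : 0 ≤ β) (hβ1 : β ≤ 1) {a : ℂ} {V : ℝ}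
    (hr : 0 < a.re) (hV : 0 < V) :
    ‖∫ v in Set.Ioi V, ((v ^ β : ℝ) : ℂ) * cexp (-(a * v))‖ ≤
      V ^ β * Real.exp (-(a.re * V)) * (1 + 1 / (a.re * V)) / ‖a‖ := by
  have hI : β * ∫ v in Set.Ioi V, v ^ (β - 1) * Real.exp (-(a.re * v)) ≤
      V ^ (β - 1) * (Real.exp (-(a.re * V)) / a.re) := by
    have h0 : IntegrableOn (fun v : ℝ => Real.exp (-(a.re * v))) (Set.Ioi V) := by
      simpa using integrableOn_rpow_mul_exp_Ioi 0 hr hV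
    have h2 : ∫ v in Set.Ioi V, v ^ (β - 1) * Real.exp (-(a.re * v)) ≤
        ∫ v in Set.Ioi V, V ^ (β - 1) * Real.exp (-(a.re * v)) := by
      refine setIntegral_mono_on (integrableOn_rpow_mul_exp_Ioi _ hr hV) (h0.const_mul _)
        measurableSet_Ioi fun v hv => ?_
      gcongr ?_ * _
      exact Real.rpow_le_rpow_of_nonpos hV (le_of_lt hv) (by linarith)
    rw [integral_const_mul, integral_exp_neg_mul_Ioi hr] at h2
    calc _ ≤ 1 * _ := mul_le_mul hβ1 h2 (setIntegral_nonneg measurableSet_Ioi fun v hv => by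
          have : 0 < v := hV.trans hv
          positivity) zero_le_one
      _ = _ := one_mul _
  rw [integral_rpow_mul_cexp_eq β hr hV]
  refine (norm_add_le _ _).trans ?_
  rw [norm_div, norm_rpow_mul_cexp β a hV, norm_mul, norm_div, Complex.norm_real, Real.norm_eq_abs,
    abs_of_nonneg hβ]
  have h3 := norm_integral_rpow_mul_cexp_le (β - 1) (a := a) hV
  calc _ ≤ V ^ β * Real.exp (-(a.re * V)) / ‖a‖ +
        β / ‖a‖ * ∫ v in Set.Ioi V, v ^ (β - 1) * Real.exp (-(a.re * v)) := by
        gcongr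
    _ ≤ V ^ β * Real.exp (-(a.re * V)) / ‖a‖ +
        V ^ (β - 1) * (Real.exp (-(a.re * V)) / a.re) / ‖a‖ := by
        rw [div_mul_eq_mul_div]
        gcongr
    _ = _ := by
        rw [Real.rpow_sub_one hV.ne']
        field_simp

end KernelBounds

section ThetaKernel

open MeasureTheory

/-- The `n`-th term of the theta series without its character value. -/
noncomputable def thetaTerm (κ n : ℕ) (c : ℂ) : ℂ := (n : ℂ) ^ κ * cexp (-Real.pi * c * n ^ 2)

/-- The weighted inner product of two terms of the theta series along a ray. -/
noncomputable def thetaKernel (κ : ℕ) (β V : ℝ) (z : ℂ) (m n : ℕ) : ℂ :=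
  ∫ v in Set.Ioi V, thetaTerm κ m (z * v) * (starRingEnd ℂ) (thetaTerm κ n (z * v)) *
    ((v ^ β : ℝ) : ℂ)

lemma thetaTerm_mul_conj (κ m n : ℕ) (z : ℂ) (v : ℝ) :
    thetaTerm κ m (z * v) * (starRingEnd ℂ) (thetaTerm κ n (z * v)) =
      ((m : ℂ) * n) ^ κ *
        cexp (-(Real.pi * (m ^ 2 * z + n ^ 2 * (starRingEnd ℂ) z) * v)) := by
  have e : (starRingEnd ℂ) (thetaTerm κ n (z * v)) =
      (n : ℂ) ^ κ * cexp (-Real.pi * ((starRingEnd ℂ) z * v) * n ^ 2) := by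
    simp only [thetaTerm, map_mul, map_pow, map_natCast, ← Complex.exp_conj, map_neg,
      Complex.conj_ofReal]
  rw [e, thetaTerm, mul_mul_mul_comm, ← mul_pow, ← Complex.exp_add]
  congr 2
  ring

lemma thetaKernel_eq (κ : ℕ) (β V : ℝ) (z : ℂ) (m n : ℕ) :
    thetaKernel κ β V z m n = ((m : ℂ) * n) ^ κ * ∫ v in Set.Ioi V,
      ((v ^ β : ℝ) : ℂ) * cexp (-(Real.pi * (m ^ 2 * z + n ^ 2 * (starRingEnd ℂ) z) * v)) := by
  rw [thetaKernel, ← integral_const_mul]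
  congr 1
  ext v
  rw [thetaTerm_mul_conj]
  ring

lemma re_thetaExponent (z : ℂ) (m n : ℕ) :
    ((Real.pi : ℂ) * (m ^ 2 * z + n ^ 2 * (starRingEnd ℂ) z)).re =
      Real.pi * z.re * (m ^ 2 + n ^ 2) := by
  rw [Complex.re_ofReal_mul, Complex.add_re]
  have h : ∀ (k : ℕ) (w : ℂ), ((k : ℂ) ^ 2 * w).re = (k : ℝ) ^ 2 * w.re := fun k w => by
    rw [← Nat.cast_pow, ← Complex.ofReal_natCast, Complex.re_ofReal_mul]
    push_cast; rfl
  rw [h, h, Complex.conj_re]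
  ring

lemma im_thetaExponent (z : ℂ) (m n : ℕ) :
    ((Real.pi : ℂ) * (m ^ 2 * z + n ^ 2 * (starRingEnd ℂ) z)).im =
      Real.pi * z.im * (m ^ 2 - n ^ 2) := by
  rw [Complex.im_ofReal_mul, Complex.add_im]
  have h : ∀ (k : ℕ) (w : ℂ), ((k : ℂ) ^ 2 * w).im = (k : ℝ) ^ 2 * w.im := fun k w => by
    rw [← Nat.cast_pow, ← Complex.ofReal_natCast, Complex.im_ofReal_mul]
    push_cast; rfl
  rw [h, h, Complex.conj_im]
  ring

lemma mul_le_re_thetaExponent {z : ℂ} (hz : 0 < z.re) (m n : ℕ) :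
    6 * (z.re * ((m : ℝ) * n)) ≤
      ((Real.pi : ℂ) * (m ^ 2 * z + n ^ 2 * (starRingEnd ℂ) z)).re := by
  rw [re_thetaExponent]
  have h1 : 2 * ((m : ℝ) * n) ≤ m ^ 2 + n ^ 2 := by nlinarith [sq_nonneg ((m : ℝ) - n)]
  have h2 := Real.pi_gt_three
  calc 6 * (z.re * ((m : ℝ) * n)) = 3 * z.re * (2 * ((m : ℝ) * n)) := by ring
    _ ≤ Real.pi * z.re * (m ^ 2 + n ^ 2) := by gcongr

lemma mul_le_norm_thetaExponent {z : ℂ} (hz : 1 / 2 ≤ |z.im|) (m n : ℕ) :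
    3 * (√((m : ℝ) * n) * |(m : ℝ) - n|) ≤
      ‖(Real.pi : ℂ) * (m ^ 2 * z + n ^ 2 * (starRingEnd ℂ) z)‖ := by
  refine le_trans ?_ (Complex.abs_im_le_norm _)
  rw [im_thetaExponent, abs_mul, abs_mul, abs_of_pos Real.pi_pos]
  have h1 : (m : ℝ) ^ 2 - n ^ 2 = ((m : ℝ) - n) * (m + n) := by ring
  have h2 : √((m : ℝ) * n) ≤ (m + n) / 2 := by
    rw [Real.sqrt_le_left (by positivity)]
    nlinarith [sq_nonneg ((m : ℝ) - n)]
  rw [h1, abs_mul, abs_of_nonneg (by positivity : (0 : ℝ) ≤ (m : ℝ) + n)]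
  have h3 := Real.pi_gt_three
  calc 3 * (√((m : ℝ) * n) * |(m : ℝ) - n|) ≤ 3 * ((m + n) / 2 * |(m : ℝ) - n|) := by gcongr
    _ = 3 * (1 / 2) * (|(m : ℝ) - n| * (m + n)) := by ring
    _ ≤ _ := by gcongr

lemma norm_thetaKernel_le {κ : ℕ} {β V : ℝ} (hβ : -1 < β) (hV : 0 < V) {z : ℂ} (hz : 0 < z.re)
    {m n : ℕ} (hm : m ≠ 0) (hn : n ≠ 0) :
    ‖thetaKernel κ β V z m n‖ ≤
      Real.Gamma (β + 1) * z.re ^ (-(β + 1)) * ((m : ℝ) * n) ^ (κ - (β + 1)) := by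
  have hm0 : (0 : ℝ) < m := by exact_mod_cast Nat.pos_of_ne_zero hm
  have hn0 : (0 : ℝ) < n := by exact_mod_cast Nat.pos_of_ne_zero hn
  have hr := mul_le_re_thetaExponent hz m n
  have hP : 0 < z.re * ((m : ℝ) * n) := by positivity
  rw [thetaKernel_eq, norm_mul, norm_pow, norm_mul, Complex.norm_natCast, Complex.norm_natCast]
  have h1 := norm_integral_rpow_mul_cexp_le_Gamma hβ (a := (Real.pi : ℂ) *
    (m ^ 2 * z + n ^ 2 * (starRingEnd ℂ) z)) (by linarith) hV
  have hG := Real.Gamma_pos_of_pos (show 0 < β + 1 by linarith)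
  calc _ ≤ ((m : ℝ) * n) ^ κ * (Real.Gamma (β + 1) * (z.re * ((m : ℝ) * n)) ^ (-(β + 1))) := by
        refine mul_le_mul_of_nonneg_left (h1.trans ?_) (by positivity)
        refine mul_le_mul_of_nonneg_left ?_ hG.le
        exact Real.rpow_le_rpow_of_nonpos hP (by linarith) (by linarith)
    _ = _ := by
        rw [Real.mul_rpow hz.le (by positivity), sub_eq_add_neg, Real.rpow_add (by positivity),
          Real.rpow_natCast]
        ring

lemma norm_thetaKernel_mul_le {κ : ℕ} (hκ : κ ≤ 1) {β V : ℝ} (hβ0 : κ = 0 → β ≤ 0)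
    (hβ1 : κ = 1 → 0 ≤ β ∧ β ≤ 1) (hV : 0 < V) {z : ℂ} (hz : 0 < z.re) (hz' : 1 / 2 ≤ |z.im|)
    {m n : ℕ} (hm : m ≠ 0) (hn : n ≠ 0) (hmn : m ≠ n) :
    ‖thetaKernel κ β V z m n‖ * (√((m : ℝ) * n) * |(m : ℝ) - n|) ≤
      (z.re * V) ^ (-(κ : ℝ)) * V ^ β * Real.exp (-(z.re * V * ((m : ℝ) * n))) := by
  have hm0 : (0 : ℝ) < m := by exact_mod_cast Nat.pos_of_ne_zero hm
  have hn0 : (0 : ℝ) < n := by exact_mod_cast Nat.pos_of_ne_zero hn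
  have hr := mul_le_re_thetaExponent hz m n
  have ha := mul_le_norm_thetaExponent hz' m n
  have hD : 0 < √((m : ℝ) * n) * |(m : ℝ) - n| := by
    have : (m : ℝ) - n ≠ 0 := sub_ne_zero.2 (by exact_mod_cast hmn)
    positivity
  have hP : 0 < z.re * ((m : ℝ) * n) := by positivity
  rw [thetaKernel_eq, norm_mul, norm_pow, norm_mul, Complex.norm_natCast, Complex.norm_natCast]
  generalize (Real.pi : ℂ) * (m ^ 2 * z + n ^ 2 * (starRingEnd ℂ) z) = a at hr ha ⊢
  have har : 0 < a.re := by linarith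
  have ha0 : 0 < ‖a‖ := by linarith
  set D := √((m : ℝ) * n) * |(m : ℝ) - n| with hDdef
  set w := z.re * V * ((m : ℝ) * n) with hw
  have hw0 : 0 < w := by positivity
  have hy : 6 * w ≤ a.re * V := by
    calc 6 * w = 6 * (z.re * ((m : ℝ) * n)) * V := by rw [hw]; ring
      _ ≤ _ := by gcongr
  have hDa : D / ‖a‖ ≤ 1 / 3 := by rw [div_le_div_iff₀ ha0 (by norm_num)]; linarith
  interval_cases κ
  · have h1 := norm_integral_rpow_mul_cexp_le_of_nonpos (hβ0 rfl) har hV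
    rw [pow_zero, one_mul, Nat.cast_zero, neg_zero, Real.rpow_zero, one_mul]
    calc _ ≤ 2 * V ^ β * Real.exp (-(a.re * V)) / ‖a‖ * D := by gcongr
      _ = 2 * (D / ‖a‖) * (V ^ β * Real.exp (-(a.re * V))) := by ring
      _ ≤ 1 * (V ^ β * Real.exp (-w)) := by
          gcongr
          · linarith
          · linarith
      _ = _ := one_mul _
  · obtain ⟨hβ, hβ'⟩ := hβ1 rfl
    have h1 := norm_integral_rpow_mul_cexp_le_of_nonneg hβ hβ' har hV
    rw [pow_one, Nat.cast_one, Real.rpow_neg_one]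
    have hPw : (m : ℝ) * n = (z.re * V)⁻¹ * w := by
      rw [hw]; field_simp
    have hy0 : 0 < a.re * V := by positivity
    have h2 : w * (1 + 1 / (a.re * V)) ≤ Real.exp w := by
      have h3 : w * (1 / (a.re * V)) ≤ 1 := by
        rw [mul_one_div, div_le_one hy0]; linarith
      have := Real.add_one_le_exp w
      linarith
    calc _ ≤ (m : ℝ) * n * (V ^ β * Real.exp (-(a.re * V)) * (1 + 1 / (a.re * V)) / ‖a‖) * D := by
          gcongr
      _ = (D / ‖a‖) * ((z.re * V)⁻¹ * V ^ β * (w * (1 + 1 / (a.re * V)) *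
            Real.exp (-(a.re * V)))) := by rw [hPw]; ring
      _ ≤ 1 * ((z.re * V)⁻¹ * V ^ β * (Real.exp w * Real.exp (-(6 * w)))) := by
          gcongr
          linarith
      _ ≤ _ := by
          rw [one_mul, ← Real.exp_add]
          gcongr
          linarith

end ThetaKernel

section DoubleSum

lemma exp_neg_le_rpow_neg {x p : ℝ} (hx : 0 < x) (hp0 : 0 ≤ p) (hp1 : p ≤ 1) :
    Real.exp (-x) ≤ x ^ (-p) := by
  rw [Real.exp_neg, Real.rpow_neg hx.le]
  refine inv_anti₀ (by positivity) ?_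
  have h := Real.add_one_le_exp x
  rcases le_total x 1 with h1 | h1
  · linarith [Real.rpow_le_one hx.le h1 hp0]
  · have := Real.rpow_le_rpow_of_exponent_le h1 hp1
    rw [Real.rpow_one] at this
    linarith

lemma one_add_log_le_mul_rpow {η P : ℝ} (hη : 0 < η) (hP : 1 ≤ P) :
    1 + Real.log P ≤ (1 + 1 / η) * P ^ η := by
  have h1 := Real.log_le_rpow_div (x := P) (by linarith) hη
  have h2 := Real.one_le_rpow hP hη.le
  calc 1 + Real.log P ≤ P ^ η + P ^ η / η := add_le_add h2 h1
    _ = _ := by ring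

lemma exists_sum_mul_norm_thetaKernel_le {κ : ℕ} (hκ : κ ≤ 1) {η : ℝ} (hη : 0 < η)
    (hη1 : η ≤ 1 / 4) : ∃ C > (0 : ℝ), ∀ Q X : ℝ, 1 ≤ Q → 1 ≤ X → ∀ z : ℂ, 1 / (2 * X) ≤ z.re →
    1 / 2 ≤ |z.im| → ∀ S : ℕ → ℕ → ℝ, (∀ m n, |S m n| ≤ Q + 1) →
    (∀ m n, m ≠ 0 → n ≠ 0 → ¬ IsSquare (oddPart m * oddPart n) →
      |S m n| ≤ 2 * √((m : ℝ) * n) * (1 + Real.log ((m : ℝ) * n))) → ∀ M : ℕ,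
    ∑ x ∈ Finset.Ico 1 M ×ˢ Finset.Ico 1 M, |S x.1 x.2| *
      ‖thetaKernel κ (κ - 1 / 2 + η) (1 / (2 * Q)) z x.1 x.2‖ ≤
        C * Q ^ (1 + η) * X ^ (κ + 1 / 2 + 2 * η) := by
  obtain ⟨C₁, hC₁, h₁⟩ := exists_sum_sqrt_isSquare_le hη
  obtain ⟨C₂, hC₂, h₂⟩ := exists_sum_sqrt_div_sub_le hη
  have hκ0 : (0 : ℝ) ≤ κ := κ.cast_nonneg
  have hκ1 : (κ : ℝ) ≤ 1 := by exact_mod_cast hκ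
  have hG : 0 < Real.Gamma (κ + 1 / 2 + η) := Real.Gamma_pos_of_pos (by positivity)
  refine ⟨2 * Real.Gamma (κ + 1 / 2 + η) * 4 * C₁ + 2 * (1 + 1 / η) * 4 * 4 * C₂, by positivity,
    fun Q X hQ hX z hz hz' S hS1 hS2 M => ?_⟩
  have hz0 : 0 < z.re := lt_of_lt_of_le (by positivity) hz
  have hV : 0 < 1 / (2 * Q) := by positivity
  have hXE : ∀ e : ℝ, 0 ≤ e → e ≤ κ + 1 / 2 + 2 * η →
      z.re ^ (-e) ≤ 4 * X ^ (κ + 1 / 2 + 2 * η) := by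
    intro e he he'
    calc z.re ^ (-e) ≤ (1 / (2 * X)) ^ (-e) :=
          Real.rpow_le_rpow_of_nonpos (by positivity) hz (by linarith)
      _ = (2 * X) ^ e := by
          rw [one_div, Real.inv_rpow (by positivity), Real.rpow_neg (by positivity), inv_inv]
      _ ≤ (2 * X) ^ (κ + 1 / 2 + 2 * η) := Real.rpow_le_rpow_of_exponent_le (by linarith) he'
      _ = 2 ^ (κ + 1 / 2 + 2 * η) * X ^ (κ + 1 / 2 + 2 * η) :=
          Real.mul_rpow zero_le_two (by linarith)
      _ ≤ _ := by
          gcongr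
          calc (2 : ℝ) ^ (κ + 1 / 2 + 2 * η) ≤ 2 ^ (2 : ℝ) :=
                Real.rpow_le_rpow_of_exponent_le one_le_two (by linarith)
            _ = 4 := by norm_num
  have hsq : ∀ x ∈ (Finset.Ico 1 M ×ˢ Finset.Ico 1 M).filter
      (fun x => IsSquare (oddPart x.1 * oddPart x.2)),
      |S x.1 x.2| * ‖thetaKernel κ (κ - 1 / 2 + η) (1 / (2 * Q)) z x.1 x.2‖ ≤
        2 * Real.Gamma (κ + 1 / 2 + η) * 4 * Q ^ (1 + η) * X ^ (κ + 1 / 2 + 2 * η) *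
          ((x.1 : ℝ) * x.2) ^ (-(1 / 2 + η)) := by
    intro x hx
    rw [Finset.mem_filter, Finset.mem_product, Finset.mem_Ico, Finset.mem_Ico] at hx
    have hk := norm_thetaKernel_le (κ := κ) (β := κ - 1 / 2 + η) (by linarith) hV hz0
      (m := x.1) (n := x.2) (by omega) (by omega)
    rw [show (κ : ℝ) - 1 / 2 + η + 1 = κ + 1 / 2 + η by ring,
      show (κ : ℝ) - (κ + 1 / 2 + η) = -(1 / 2 + η) by ring] at hk
    have hQ' : Q + 1 ≤ 2 * Q ^ (1 + η) := by
      have := Real.rpow_le_rpow_of_exponent_le hQ (show (1 : ℝ) ≤ 1 + η by linarith)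
      rw [Real.rpow_one] at this
      linarith
    calc _ ≤ (2 * Q ^ (1 + η)) * (Real.Gamma (κ + 1 / 2 + η) * (4 * X ^ (κ + 1 / 2 + 2 * η)) *
          ((x.1 : ℝ) * x.2) ^ (-(1 / 2 + η))) := by
          refine mul_le_mul ((hS1 _ _).trans hQ') (hk.trans ?_) (norm_nonneg _) (by positivity)
          gcongr
          exact hXE _ (by positivity) (by linarith)
      _ = _ := by ring
  have hns : ∀ x ∈ (Finset.Ico 1 M ×ˢ Finset.Ico 1 M).filter
      (fun x => ¬ IsSquare (oddPart x.1 * oddPart x.2)),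
      |S x.1 x.2| * ‖thetaKernel κ (κ - 1 / 2 + η) (1 / (2 * Q)) z x.1 x.2‖ ≤
        2 * (1 + 1 / η) * 4 * 4 * Q ^ (1 + η) * X ^ (κ + 1 / 2 + 2 * η) *
          (((x.1 : ℝ) * x.2) ^ (-(1 / 2 + η)) / |(x.1 : ℝ) - x.2|) := by
    intro x hx
    rw [Finset.mem_filter, Finset.mem_product, Finset.mem_Ico, Finset.mem_Ico] at hx
    obtain ⟨⟨⟨hm, -⟩, hn, -⟩, hx⟩ := hx
    have hm' : x.1 ≠ 0 := by omega
    have hn' : x.2 ≠ 0 := by omega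
    have hne : x.1 ≠ x.2 := by
      intro h
      rw [h] at hx
      exact hx ⟨_, rfl⟩
    have hk := norm_thetaKernel_mul_le (β := κ - 1 / 2 + η) hκ
      (by rintro rfl; norm_num; linarith) (by rintro rfl; norm_num; constructor <;> linarith)
      hV hz0 hz' hm' hn' hne
    have hP : (1 : ℝ) ≤ (x.1 : ℝ) * x.2 := by exact_mod_cast Nat.mul_pos hm hn
    have hS := hS2 _ _ hm' hn' hx
    generalize (x.1 : ℝ) * x.2 = P at hk hP hS ⊢
    have hd : 0 < |(x.1 : ℝ) - x.2| := abs_pos.2 (sub_ne_zero.2 (by exact_mod_cast hne))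
    generalize |(x.1 : ℝ) - x.2| = d at hk hd ⊢
    have hK0 := norm_nonneg (thetaKernel κ (κ - 1 / 2 + η) (1 / (2 * Q)) z x.1 x.2)
    generalize ‖thetaKernel κ (κ - 1 / 2 + η) (1 / (2 * Q)) z x.1 x.2‖ = K at hk hK0 ⊢
    have hP0 : 0 < P := by linarith
    have hlog := one_add_log_le_mul_rpow hη hP
    have hk' : K * √P ≤ ((z.re * (1 / (2 * Q))) ^ (-(κ : ℝ)) * (1 / (2 * Q)) ^ (κ - 1 / 2 + η) *
        Real.exp (-(z.re * (1 / (2 * Q)) * P))) / d := by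
      rw [le_div_iff₀ hd, mul_assoc]
      exact hk
    have hexp := exp_neg_le_rpow_neg (x := z.re * (1 / (2 * Q)) * P) (p := 1 / 2 + 2 * η)
      (by positivity) (by positivity) (by linarith)
    have hVe : (1 / (2 * Q)) ^ (-(κ : ℝ)) * (1 / (2 * Q)) ^ (κ - 1 / 2 + η) *
        (1 / (2 * Q)) ^ (-(1 / 2 + 2 * η)) ≤ 4 * Q ^ (1 + η) := by
      rw [← Real.rpow_add hV, ← Real.rpow_add hV, one_div, Real.inv_rpow (by positivity),
        ← Real.rpow_neg (by positivity)]
      rw [show -(-(κ : ℝ) + (κ - 1 / 2 + η) + -(1 / 2 + 2 * η)) = 1 + η by ring,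
        Real.mul_rpow zero_le_two (by linarith)]
      gcongr
      calc (2 : ℝ) ^ (1 + η) ≤ 2 ^ (2 : ℝ) :=
            Real.rpow_le_rpow_of_exponent_le one_le_two (by linarith)
        _ = 4 := by norm_num
    have hze := hXE (κ + 1 / 2 + 2 * η) (by positivity) le_rfl
    have hPe : P ^ η * P ^ (-(1 / 2 + 2 * η)) = P ^ (-(1 / 2 + η)) := by
      rw [← Real.rpow_add hP0]; congr 1; ring
    have hzz : z.re ^ (-(κ : ℝ)) * z.re ^ (-(1 / 2 + 2 * η)) = z.re ^ (-(κ + 1 / 2 + 2 * η)) := by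
      rw [← Real.rpow_add hz0]; congr 1; ring
    have hlog0 : 0 ≤ 1 + Real.log P := by linarith [Real.log_nonneg hP]
    rw [Real.mul_rpow hz0.le hV.le] at hk'
    rw [Real.mul_rpow (by positivity) hP0.le, Real.mul_rpow hz0.le hV.le] at hexp
    generalize 1 / (2 * Q) = V at *
    calc |S x.1 x.2| * K ≤ 2 * √P * (1 + Real.log P) * K := by gcongr
      _ = 2 * (1 + Real.log P) * (K * √P) := by ring
      _ ≤ 2 * ((1 + 1 / η) * P ^ η) * (z.re ^ (-(κ : ℝ)) * V ^ (-(κ : ℝ)) *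
          V ^ (κ - 1 / 2 + η) * (z.re ^ (-(1 / 2 + 2 * η)) * V ^ (-(1 / 2 + 2 * η)) *
          P ^ (-(1 / 2 + 2 * η))) / d) := by
          refine mul_le_mul (by gcongr) (hk'.trans ?_) (by positivity) (by positivity)
          gcongr
      _ = 2 * (1 + 1 / η) * (z.re ^ (-(κ : ℝ)) * z.re ^ (-(1 / 2 + 2 * η))) *
          (V ^ (-(κ : ℝ)) * V ^ (κ - 1 / 2 + η) * V ^ (-(1 / 2 + 2 * η))) *
          ((P ^ η * P ^ (-(1 / 2 + 2 * η))) / d) := by ring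
      _ ≤ 2 * (1 + 1 / η) * (4 * X ^ (κ + 1 / 2 + 2 * η)) * (4 * Q ^ (1 + η)) *
          (P ^ (-(1 / 2 + η)) / d) := by
          rw [hPe, hzz]
          gcongr
      _ = _ := by ring
  rw [← Finset.sum_filter_add_sum_filter_not _ (fun x => IsSquare (oddPart x.1 * oddPart x.2))]
  refine (add_le_add (Finset.sum_le_sum hsq) (Finset.sum_le_sum hns)).trans ?_
  rw [← Finset.mul_sum, ← Finset.mul_sum]
  have h₂' : ∑ x ∈ (Finset.Ico 1 M ×ˢ Finset.Ico 1 M).filter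
      (fun x => ¬ IsSquare (oddPart x.1 * oddPart x.2)),
        ((x.1 : ℝ) * x.2) ^ (-(1 / 2 + η)) / |(x.1 : ℝ) - x.2| ≤ C₂ :=
    (Finset.sum_le_sum_of_subset_of_nonneg (Finset.filter_subset _ _)
      fun _ _ _ => by positivity).trans (h₂ M)
  have hA : 0 ≤ Q ^ (1 + η) * X ^ (κ + 1 / 2 + 2 * η) := by positivity
  calc _ ≤ 2 * Real.Gamma (κ + 1 / 2 + η) * 4 * Q ^ (1 + η) * X ^ (κ + 1 / 2 + 2 * η) * C₁ +
        2 * (1 + 1 / η) * 4 * 4 * Q ^ (1 + η) * X ^ (κ + 1 / 2 + 2 * η) * C₂ := by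
        gcongr
        exact h₁ M
    _ = _ := by ring

end DoubleSum

section MeanSquare

open MeasureTheory

lemma sum_lintegral_norm_sq_le {ι : Type*} (D : Finset ι) (A : Finset ℕ) (c : ι → ℕ → ℝ)
    (f : ℕ → ℝ → ℂ) (w : ℝ → ℝ) (μ : Measure ℝ) (hw : ∀ᵐ v ∂μ, 0 ≤ w v)
    (hf : ∀ m ∈ A, ∀ n ∈ A, Integrable (fun v => f m v * (starRingEnd ℂ) (f n v) * (w v : ℂ)) μ) :
    ∑ d ∈ D, ∫⁻ v, ENNReal.ofReal (‖∑ n ∈ A, (c d n : ℂ) * f n v‖ ^ 2 * w v) ∂μ ≤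
      ENNReal.ofReal (∑ x ∈ A ×ˢ A, |∑ d ∈ D, c d x.1 * c d x.2| *
        ‖∫ v, f x.1 v * (starRingEnd ℂ) (f x.2 v) * (w v : ℂ) ∂μ‖) := by
  have hexp : ∀ d v, ((‖∑ n ∈ A, (c d n : ℂ) * f n v‖ ^ 2 * w v : ℝ) : ℂ) =
      ∑ x ∈ A ×ˢ A, ((c d x.1 * c d x.2 : ℝ) : ℂ) *
        (f x.1 v * (starRingEnd ℂ) (f x.2 v) * (w v : ℂ)) := by
    intro d v
    push_cast
    rw [← Complex.mul_conj', map_sum, Finset.sum_mul_sum, ← Finset.sum_product', Finset.sum_mul]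
    refine Finset.sum_congr rfl fun x _ => ?_
    rw [map_mul, Complex.conj_ofReal]
    ring
  have hintg : ∀ d, Integrable (fun v => ((‖∑ n ∈ A, (c d n : ℂ) * f n v‖ ^ 2 * w v : ℝ) : ℂ)) μ := by
    intro d
    simp_rw [hexp]
    exact integrable_finsetSum _ fun x hx => (hf _ (Finset.mem_product.1 hx).1 _
      (Finset.mem_product.1 hx).2).const_mul _
  have hintg' : ∀ d, Integrable (fun v => ‖∑ n ∈ A, (c d n : ℂ) * f n v‖ ^ 2 * w v) μ := fun d => by
    have := (hintg d).re
    simp only [RCLike.re_to_complex, Complex.ofReal_re] at this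
    exact this
  have hnn : ∀ d, 0 ≤ᵐ[μ] fun v => ‖∑ n ∈ A, (c d n : ℂ) * f n v‖ ^ 2 * w v := fun d => by
    filter_upwards [hw] with v hv
    show 0 ≤ _
    positivity
  have h1 : ∀ d ∈ D, ∫⁻ v, ENNReal.ofReal (‖∑ n ∈ A, (c d n : ℂ) * f n v‖ ^ 2 * w v) ∂μ =
      ENNReal.ofReal (∫ v, ‖∑ n ∈ A, (c d n : ℂ) * f n v‖ ^ 2 * w v ∂μ) := fun d _ =>
    (ofReal_integral_eq_lintegral_ofReal (hintg' d) (hnn d)).symm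
  rw [Finset.sum_congr rfl h1, ← ENNReal.ofReal_sum_of_nonneg
    fun d _ => integral_nonneg_of_ae (hnn d)]
  refine ENNReal.ofReal_le_ofReal ?_
  have h2 : ((∑ d ∈ D, ∫ v, ‖∑ n ∈ A, (c d n : ℂ) * f n v‖ ^ 2 * w v ∂μ : ℝ) : ℂ) =
      ∑ x ∈ A ×ˢ A, ((∑ d ∈ D, c d x.1 * c d x.2 : ℝ) : ℂ) *
        ∫ v, f x.1 v * (starRingEnd ℂ) (f x.2 v) * (w v : ℂ) ∂μ := by
    push_cast
    simp_rw [Finset.sum_mul]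
    rw [Finset.sum_comm]
    refine Finset.sum_congr rfl fun d _ => ?_
    rw [← integral_complex_ofReal]
    simp_rw [hexp]
    rw [integral_finsetSum _ fun x hx => (hf _ (Finset.mem_product.1 hx).1 _
      (Finset.mem_product.1 hx).2).const_mul _]
    refine Finset.sum_congr rfl fun x _ => ?_
    rw [integral_const_mul]
    push_cast
    rfl
  calc _ ≤ ‖((∑ d ∈ D, ∫ v, ‖∑ n ∈ A, (c d n : ℂ) * f n v‖ ^ 2 * w v ∂μ : ℝ) : ℂ)‖ := by
        rw [Complex.norm_real]
        exact le_abs_self _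
    _ ≤ _ := by
        rw [h2]
        refine (norm_sum_le _ _).trans (Finset.sum_le_sum fun x _ => ?_)
        rw [norm_mul, Complex.norm_real, Real.norm_eq_abs]

lemma integrableOn_thetaTerm_mul_conj (κ : ℕ) (β : ℝ) {V : ℝ} (hV : 0 < V) {z : ℂ}
    (hz : 0 < z.re) {m n : ℕ} (hm : m ≠ 0) (hn : n ≠ 0) :
    IntegrableOn (fun v : ℝ => thetaTerm κ m (z * v) *
      (starRingEnd ℂ) (thetaTerm κ n (z * v)) * ((v ^ β : ℝ) : ℂ)) (Set.Ioi V) := by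
  have hm0 : (0 : ℝ) < m := by exact_mod_cast Nat.pos_of_ne_zero hm
  have hn0 : (0 : ℝ) < n := by exact_mod_cast Nat.pos_of_ne_zero hn
  have hr := mul_le_re_thetaExponent hz m n
  have hP : 0 < z.re * ((m : ℝ) * n) := by positivity
  have h := (integrableOn_rpow_mul_cexp_Ioi β (a := (Real.pi : ℂ) *
    (m ^ 2 * z + n ^ 2 * (starRingEnd ℂ) z)) (by linarith) hV).const_mul (((m : ℂ) * n) ^ κ)
  refine h.congr (Filter.Eventually.of_forall fun v => ?_)
  simp only
  rw [thetaTerm_mul_conj]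
  ring

end MeanSquare

section QuadraticFamily

open MeasureTheory

/-- The value at `n` of the real character of modulus `d` and sign `s` whose value at `2` is `b`. -/
noncomputable def twistCoeff (s b : ℤ) (d n : ℕ) : ℤ :=
  b ^ n.factorization 2 * jacobiSym (s * d) (oddPart n)

lemma abs_jacobiSym_le_one (a : ℤ) (n : ℕ) : |jacobiSym a n| ≤ 1 := by
  rcases jacobiSym.trichotomy a n with h | h | h <;> simp [h]

lemma twistCoeff_mul_twistCoeff (s b : ℤ) {m n : ℕ} (hm : m ≠ 0) (hn : n ≠ 0) (d : ℕ) :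
    twistCoeff s b d m * twistCoeff s b d n =
      (b ^ m.factorization 2 * b ^ n.factorization 2 *
        (jacobiSym s (oddPart m) * jacobiSym s (oddPart n))) *
        jacobiSym d (oddPart m * oddPart n) := by
  rw [twistCoeff, twistCoeff, jacobiSym.mul_left, jacobiSym.mul_left,
    jacobiSym.mul_right' _ (odd_oddPart hm).pos.ne' (odd_oddPart hn).pos.ne']
  ring

lemma abs_twistCoeff_le_one (s d : ℤ) {b : ℤ} (hb : |b| ≤ 1) (k n : ℕ) :
    |b ^ k * jacobiSym (s * d) n| ≤ 1 := by
  rw [abs_mul, abs_pow]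
  exact mul_le_one₀ (pow_le_one₀ (abs_nonneg _) hb) (abs_nonneg _) (abs_jacobiSym_le_one _ _)

lemma oddPart_le (n : ℕ) : oddPart n ≤ n := Nat.div_le_self _ _

lemma abs_sum_twistCoeff_le (s : ℤ) {b : ℤ} (hb : |b| ≤ 1) {m n : ℕ} (hm : m ≠ 0) (hn : n ≠ 0)
    (hsq : ¬ IsSquare (oddPart m * oddPart n)) (A B : ℕ) :
    |∑ d ∈ Finset.Ioc A B, (twistCoeff s b d m : ℝ) * twistCoeff s b d n| ≤
      2 * √((m : ℝ) * n) * (1 + Real.log ((m : ℝ) * n)) := by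
  have h1 : ∑ d ∈ Finset.Ioc A B, (twistCoeff s b d m : ℝ) * twistCoeff s b d n =
      ((b ^ m.factorization 2 * b ^ n.factorization 2 *
        (jacobiSym s (oddPart m) * jacobiSym s (oddPart n)) : ℤ) : ℝ) *
        ((∑ d ∈ Finset.Ioc A B, jacobiSym d (oddPart m * oddPart n) : ℤ) : ℝ) := by
    rw [← Int.cast_mul, Finset.mul_sum, Int.cast_sum]
    refine Finset.sum_congr rfl fun d _ => ?_
    rw [← Int.cast_mul, twistCoeff_mul_twistCoeff s b hm hn]
  have h2 := abs_sum_jacobiSym_le ((odd_oddPart hm).mul (odd_oddPart hn)) hsq A B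
  have h3 : |((b ^ m.factorization 2 * b ^ n.factorization 2 *
        (jacobiSym s (oddPart m) * jacobiSym s (oddPart n)) : ℤ) : ℝ)| ≤ 1 := by
    rw [← Int.cast_abs]
    have hb' : ∀ k : ℕ, |b ^ k| ≤ 1 := fun k => by
      rw [abs_pow]; exact pow_le_one₀ (abs_nonneg _) hb
    have : |b ^ m.factorization 2 * b ^ n.factorization 2 *
        (jacobiSym s (oddPart m) * jacobiSym s (oddPart n))| ≤ 1 := by
      rw [abs_mul, abs_mul, abs_mul]
      exact mul_le_one₀ (mul_le_one₀ (hb' _) (abs_nonneg _) (hb' _)) (by positivity)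
        (mul_le_one₀ (abs_jacobiSym_le_one _ _) (abs_nonneg _) (abs_jacobiSym_le_one _ _))
    exact_mod_cast this
  have h4 : (((oddPart m * oddPart n : ℕ)) : ℝ) ≤ (m : ℝ) * n := by
    exact_mod_cast Nat.mul_le_mul (oddPart_le m) (oddPart_le n)
  have h5 : (1 : ℝ) ≤ ((oddPart m * oddPart n : ℕ) : ℝ) := by
    exact_mod_cast Nat.mul_pos (odd_oddPart hm).pos (odd_oddPart hn).pos
  have h6 := Real.log_nonneg h5
  rw [h1, abs_mul]
  calc _ ≤ 1 * (2 * √((oddPart m * oddPart n : ℕ) : ℝ) *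
        (1 + Real.log ((oddPart m * oddPart n : ℕ) : ℝ))) := by gcongr
    _ ≤ _ := by
      rw [one_mul]
      gcongr

lemma eq_twistCoeff {q : ℕ} [NeZero q] {χ : DirichletCharacter ℂ q} (hχ : χ.IsQuadratic)
    (hp : χ.IsPrimitive) {s b : ℤ} (hs : χ (-1) = s) (hb : χ 2 = b) {n : ℕ} (hn : n ≠ 0) :
    χ (n : ZMod q) = (twistCoeff s b q n : ℂ) := by
  obtain ⟨s', -, hs', h⟩ := exists_sign_forall_odd_eq_jacobiSym hχ hp
  have : s' = s := by exact_mod_cast hs'.symm.trans hs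
  subst this
  conv_lhs => rw [← two_pow_mul_oddPart n]
  rw [Nat.cast_mul, Nat.cast_pow, map_mul, map_pow, h _ (odd_oddPart hn), Nat.cast_two, hb,
    twistCoeff]
  push_cast
  rfl

lemma eq_of_apply_neg_one_of_apply_two {q : ℕ} [NeZero q] {χ ψ : DirichletCharacter ℂ q}
    (hχ : χ.IsQuadratic) (hχp : χ.IsPrimitive) (hψ : ψ.IsQuadratic) (hψp : ψ.IsPrimitive)
    {s b : ℤ} (hs : χ (-1) = s) (hb : χ 2 = b) (hs' : ψ (-1) = s) (hb' : ψ 2 = b) : χ = ψ := by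
  refine MulChar.ext fun a => ?_
  have h := NeZero.ne q
  have e : ((a : ZMod q)) = (((a : ZMod q).val + q : ℕ) : ZMod q) := by simp
  rw [e, eq_twistCoeff hχ hχp hs hb (by omega), eq_twistCoeff hψ hψp hs' hb' (by omega)]

end QuadraticFamily

section QuadraticMeanSquare

open MeasureTheory

lemma isQuadratic_of_inFamily {Q : ℝ} {q : ℕ} {χ : DirichletCharacter ℂ q}
    (h : inFamily 2 Q q χ) : χ.IsQuadratic :=
  MulChar.isQuadratic_iff_sq_eq_one.2 (by rw [← h.2.1, pow_orderOf_eq_one])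

lemma exists_sum_lintegral_twistCoeff_le {κ : ℕ} (hκ : κ ≤ 1) {η : ℝ} (hη : 0 < η)
    (hη1 : η ≤ 1 / 4) : ∃ C > (0 : ℝ), ∀ Q X : ℝ, 1 ≤ Q → 1 ≤ X → ∀ z : ℂ, 1 / (2 * X) ≤ z.re →
    1 / 2 ≤ |z.im| → ∀ s b : ℤ, |b| ≤ 1 → ∀ M : ℕ,
    ∑ d ∈ Finset.Ioc ⌊Q⌋₊ ⌊2 * Q⌋₊, ∫⁻ v in Set.Ioi (1 / (2 * Q)),
      ENNReal.ofReal (‖∑ n ∈ Finset.Ico 1 M, ((twistCoeff s b d n : ℝ) : ℂ) *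
        thetaTerm κ n (z * v)‖ ^ 2 * v ^ (κ - 1 / 2 + η)) ≤
      ENNReal.ofReal (C * Q ^ (1 + η) * X ^ (κ + 1 / 2 + 2 * η)) := by
  obtain ⟨C, hC, h⟩ := exists_sum_mul_norm_thetaKernel_le hκ hη hη1
  refine ⟨C, hC, fun Q X hQ hX z hz hz' s b hb M => ?_⟩
  have hV : 0 < 1 / (2 * Q) := by positivity
  have hz0 : 0 < z.re := lt_of_lt_of_le (by positivity) hz
  refine (sum_lintegral_norm_sq_le (Finset.Ioc ⌊Q⌋₊ ⌊2 * Q⌋₊) (Finset.Ico 1 M)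
    (fun d n => (twistCoeff s b d n : ℝ)) (fun n v => thetaTerm κ n (z * v))
    (fun v => v ^ (κ - 1 / 2 + η)) _ ?_ ?_).trans (ENNReal.ofReal_le_ofReal ?_)
  · refine (ae_restrict_iff' measurableSet_Ioi).2 (Filter.Eventually.of_forall fun v hv => ?_)
    exact Real.rpow_nonneg (hV.le.trans (le_of_lt hv)) _
  · intro m hm n hn
    rw [Finset.mem_Ico] at hm hn
    exact integrableOn_thetaTerm_mul_conj κ _ hV hz0 (by omega) (by omega)
  · refine h Q X hQ hX z hz hz' (fun m n => ∑ d ∈ Finset.Ioc ⌊Q⌋₊ ⌊2 * Q⌋₊,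
      (twistCoeff s b d m : ℝ) * twistCoeff s b d n) (fun m n => ?_)
      (fun m n hm hn hsq => abs_sum_twistCoeff_le s hb hm hn hsq _ _) M
    have h1 : ∀ d n : ℕ, |(twistCoeff s b d n : ℝ)| ≤ 1 := fun d n => by
      rw [← Int.cast_abs]
      exact_mod_cast abs_twistCoeff_le_one s d hb _ _
    refine (Finset.abs_sum_le_sum_abs _ _).trans ?_
    calc _ ≤ ∑ d ∈ Finset.Ioc ⌊Q⌋₊ ⌊2 * Q⌋₊, (1 : ℝ) := by
          refine Finset.sum_le_sum fun d _ => ?_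
          rw [abs_mul]
          exact mul_le_one₀ (h1 _ _) (abs_nonneg _) (h1 _ _)
      _ = ((⌊2 * Q⌋₊ : ℝ) - ⌊Q⌋₊) := by
          rw [Finset.sum_const, Nat.card_Ioc, nsmul_eq_mul, mul_one,
            Nat.cast_sub (Nat.floor_le_floor (by linarith))]
      _ ≤ Q + 1 := by
          have := Nat.floor_le (show 0 ≤ 2 * Q by linarith)
          have := Nat.lt_floor_add_one Q
          linarith

lemma exists_sum_lintegral_charTheta_le {κ : ℕ} (hκ : κ ≤ 1) {η : ℝ} (hη : 0 < η)
    (hη1 : η ≤ 1 / 4) : ∃ C > (0 : ℝ), ∀ Q X : ℝ, 1 ≤ Q → 1 ≤ X → ∀ z : ℂ, 1 / (2 * X) ≤ z.re →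
    1 / 2 ≤ |z.im| → ∀ F : Finset (Σ q : ℕ, DirichletCharacter ℂ q),
    (∀ p ∈ F, inFamily 2 Q p.1 p.2 ∧ p.2 (-1) = (-1) ^ κ) →
    ∑ p ∈ F, ∫⁻ v in Set.Ioi (1 / (2 * Q)),
      ENNReal.ofReal (‖charTheta p.2 κ (z * v)‖ ^ 2 * v ^ (κ - 1 / 2 + η)) ≤
      ENNReal.ofReal (C * Q ^ (1 + η) * X ^ (κ + 1 / 2 + 2 * η)) := by
  obtain ⟨C, hC, h⟩ := exists_sum_lintegral_twistCoeff_le hκ hη hη1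
  refine ⟨3 * C, by positivity, fun Q X hQ hX z hz hz' F hF => ?_⟩
  have hV : 0 < 1 / (2 * Q) := by positivity
  have hz0 : 0 < z.re := lt_of_lt_of_le (by positivity) hz
  set β : ℝ := κ - 1 / 2 + η with hβ
  set f : ℕ → (Σ q : ℕ, DirichletCharacter ℂ q) → ℝ → ENNReal := fun M p v =>
    ENNReal.ofReal (‖∑ n ∈ Finset.Ico 1 M, p.2 (n : ZMod p.1) * thetaTerm κ n (z * v)‖ ^ 2 *
      v ^ β) with hf
  have hmeas : ∀ M p, Measurable (f M p) := by
    intro M p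
    refine ENNReal.measurable_ofReal.comp (Measurable.mul ?_ (by fun_prop))
    unfold thetaTerm
    fun_prop
  have hlim : ∀ p ∈ F, ∀ v ∈ Set.Ioi (1 / (2 * Q)), Filter.Tendsto (fun M => f M p v) Filter.atTop
      (nhds (ENNReal.ofReal (‖charTheta p.2 κ (z * v)‖ ^ 2 * v ^ β))) := by
    intro p hp v hv
    have hv0 : 0 < v := hV.trans hv
    have hq1 : p.1 ≠ 1 := by
      intro h1
      have := (hF p hp).1.2.2.1
      rw [h1] at this
      norm_num at this
      linarith
    have hs := (summable_charTheta p.2 κ (c := z * v) (by simpa using mul_pos hz0 hv0)).hasSum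
    have ht := hs.tendsto_sum_nat
    refine (ENNReal.continuous_ofReal.tendsto _).comp (Filter.Tendsto.mul_const _ ?_)
    refine (Filter.Tendsto.norm ?_).pow 2
    refine ht.congr fun M => (Finset.sum_subset (fun n hn => ?_) fun n hn hn' => ?_).symm
    · rw [Finset.mem_Ico] at hn
      exact Finset.mem_range.2 hn.2
    · have : n = 0 := by
        rw [Finset.mem_Ico] at hn'
        rw [Finset.mem_range] at hn
        omega
      rw [this, Nat.cast_zero, DirichletCharacter.map_zero' _ hq1, zero_mul]
  have hbound : ∀ M, ∑ p ∈ F, ∫⁻ v in Set.Ioi (1 / (2 * Q)), f M p v ≤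
      ENNReal.ofReal (3 * C * Q ^ (1 + η) * X ^ (κ + 1 / 2 + 2 * η)) := by
    intro M
    set s : ℤ := (-1) ^ κ with hs
    set G : ℤ × ℕ → ENNReal := fun x => ∫⁻ v in Set.Ioi (1 / (2 * Q)),
      ENNReal.ofReal (‖∑ n ∈ Finset.Ico 1 M, ((twistCoeff s x.1 x.2 n : ℝ) : ℂ) *
        thetaTerm κ n (z * v)‖ ^ 2 * v ^ β) with hG
    have hex : ∀ p : Σ q : ℕ, DirichletCharacter ℂ q, ∃ b : ℤ,
        p ∈ F → p.2 2 = b ∧ b ∈ ({0, 1, -1} : Finset ℤ) := by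
      intro p
      by_cases hp : p ∈ F
      · rcases isQuadratic_of_inFamily (hF p hp).1 2 with h0 | h0 | h0
        · exact ⟨0, fun _ => by simp [h0]⟩
        · exact ⟨1, fun _ => by simp [h0]⟩
        · exact ⟨-1, fun _ => by simp [h0]⟩
      · exact ⟨0, fun h => absurd h hp⟩
    choose b hb using hex
    have hsgn : ∀ p ∈ F, p.2 (-1) = (s : ℂ) := fun p hp => by
      rw [(hF p hp).2, hs]; push_cast; rfl
    have hq0 : ∀ p ∈ F, NeZero p.1 := fun p hp => ⟨fun h0 => by
      have := (hF p hp).1.2.2.1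
      rw [h0] at this
      norm_num at this
      linarith⟩
    have hfG : ∀ p ∈ F, ∫⁻ v in Set.Ioi (1 / (2 * Q)), f M p v = G (b p, p.1) := by
      intro p hp
      have := hq0 p hp
      have e : ∀ v : ℝ, ∑ n ∈ Finset.Ico 1 M, p.2 (n : ZMod p.1) * thetaTerm κ n (z * v) =
          ∑ n ∈ Finset.Ico 1 M, ((twistCoeff s (b p) p.1 n : ℝ) : ℂ) * thetaTerm κ n (z * v) := by
        intro v
        refine Finset.sum_congr rfl fun n hn => ?_
        rw [Finset.mem_Ico] at hn
        rw [eq_twistCoeff (isQuadratic_of_inFamily (hF p hp).1) (hF p hp).1.1 (hsgn p hp)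
          (hb p hp).1 (by omega)]
        push_cast
        rfl
      simp only [hf, hG, e]
    have hinj : Set.InjOn (fun p : Σ q : ℕ, DirichletCharacter ℂ q => (b p, p.1)) F := by
      rintro ⟨q, χ⟩ hp ⟨q', ψ⟩ hp' hpp
      simp only [Prod.mk.injEq] at hpp
      obtain ⟨h1, rfl⟩ := hpp
      have := hq0 _ hp
      have h2 := (hb _ hp).1
      rw [h1] at h2
      exact congrArg (Sigma.mk q) (eq_of_apply_neg_one_of_apply_two (isQuadratic_of_inFamily (hF _ hp).1) (hF _ hp).1.1
        (isQuadratic_of_inFamily (hF _ hp').1) (hF _ hp').1.1 (hsgn _ hp) h2 (hsgn _ hp')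
        (hb _ hp').1)
    rw [Finset.sum_congr rfl hfG, ← Finset.sum_image (f := G) hinj]
    calc _ ≤ ∑ x ∈ ({0, 1, -1} : Finset ℤ) ×ˢ Finset.Ioc ⌊Q⌋₊ ⌊2 * Q⌋₊, G x := by
          refine Finset.sum_le_sum_of_subset fun x hx => ?_
          obtain ⟨p, hp, rfl⟩ := Finset.mem_image.1 hx
          have hfam := (hF p hp).1.2.2
          refine Finset.mem_product.2 ⟨(hb p hp).2, Finset.mem_Ioc.2 ⟨?_, ?_⟩⟩
          · exact (Nat.floor_lt (by linarith)).2 hfam.1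
          · exact Nat.le_floor hfam.2
      _ = ∑ c ∈ ({0, 1, -1} : Finset ℤ), ∑ d ∈ Finset.Ioc ⌊Q⌋₊ ⌊2 * Q⌋₊, G (c, d) :=
          Finset.sum_product _ _ _
      _ ≤ ∑ c ∈ ({0, 1, -1} : Finset ℤ),
          ENNReal.ofReal (C * Q ^ (1 + η) * X ^ (κ + 1 / 2 + 2 * η)) := by
          refine Finset.sum_le_sum fun c hc => h Q X hQ hX z hz hz' s c ?_ M
          fin_cases hc <;> simp
      _ = _ := by
          rw [Finset.sum_const, show ({0, 1, -1} : Finset ℤ).card = 3 from rfl, ← ENNReal.ofReal_nsmul]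
          congr 1
          simp only [nsmul_eq_mul, Nat.cast_ofNat]
          ring
  calc _ = ∫⁻ v in Set.Ioi (1 / (2 * Q)), Filter.liminf (fun M => ∑ p ∈ F, f M p v)
        Filter.atTop := by
        have e : ∀ v ∈ Set.Ioi (1 / (2 * Q)), Filter.liminf (fun M => ∑ p ∈ F, f M p v)
            Filter.atTop = ∑ p ∈ F, ENNReal.ofReal (‖charTheta p.2 κ (z * v)‖ ^ 2 * v ^ β) :=
          fun v hv => (tendsto_finsetSum _ fun p hp => hlim p hp v hv).liminf_eq
        rw [setLIntegral_congr_fun measurableSet_Ioi e, lintegral_finsetSum']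
        intro p hp
        refine aemeasurable_of_tendsto_metrizable_ae Filter.atTop
          (fun M => (hmeas M p).aemeasurable) ?_
        exact (ae_restrict_iff' measurableSet_Ioi).2
          (Filter.Eventually.of_forall fun v hv => hlim p hp v hv)
    _ ≤ Filter.liminf (fun M => ∫⁻ v in Set.Ioi (1 / (2 * Q)), ∑ p ∈ F, f M p v) Filter.atTop :=
        lintegral_liminf_le fun M => Finset.measurable_sum _ fun p _ => hmeas M p
    _ ≤ Filter.liminf (fun _ : ℕ => ENNReal.ofReal (3 * C * Q ^ (1 + η) *
          X ^ (κ + 1 / 2 + 2 * η))) Filter.atTop := by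
        refine Filter.liminf_le_liminf (Filter.Eventually.of_forall fun M => ?_)
        rw [lintegral_finsetSum _ fun p _ => hmeas M p]
        exact hbound M
    _ = _ := Filter.liminf_const _

end QuadraticMeanSquare

section Block

open MeasureTheory

lemma re_im_cexp_ray {s X : ℝ} (hs : |s| = 1) (hX : 1 ≤ X) :
    1 / (2 * X) ≤ (cexp ((s * (Real.pi / 2 - 1 / X) : ℝ) * I)).re ∧
      1 / 2 ≤ |(cexp ((s * (Real.pi / 2 - 1 / X) : ℝ) * I)).im| := by
  have hX0 : 0 < 1 / X := by positivity
  have hX1 : 1 / X ≤ 1 := by rw [div_le_one (by linarith)]; exact hX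
  rw [Complex.exp_ofReal_mul_I_re, Complex.exp_ofReal_mul_I_im]
  have hc : Real.cos (s * (Real.pi / 2 - 1 / X)) = Real.sin (1 / X) := by
    rcases eq_or_eq_neg_of_abs_eq hs with rfl | rfl
    · rw [one_mul, Real.cos_pi_div_two_sub]
    · rw [neg_one_mul, Real.cos_neg, Real.cos_pi_div_two_sub]
  have hsn : |Real.sin (s * (Real.pi / 2 - 1 / X))| = |Real.cos (1 / X)| := by
    rcases eq_or_eq_neg_of_abs_eq hs with rfl | rfl
    · rw [one_mul, Real.sin_pi_div_two_sub]
    · rw [neg_one_mul, Real.sin_neg, Real.sin_pi_div_two_sub, abs_neg]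
  rw [hc, hsn]
  constructor
  · have h1 := Real.mul_le_sin hX0.le (by linarith [Real.pi_gt_three])
    have h2 : 1 / 2 ≤ 2 / Real.pi := by
      rw [div_le_div_iff₀ two_pos Real.pi_pos]; linarith [Real.pi_le_four]
    calc 1 / (2 * X) = 1 / 2 * (1 / X) := by field_simp
      _ ≤ 2 / Real.pi * (1 / X) := by gcongr
      _ ≤ _ := h1
  · refine le_trans ?_ (le_abs_self _)
    have := Real.one_sub_sq_div_two_le_cos (x := 1 / X)
    nlinarith

lemma exists_sum_block_le {κ : ℕ} (hκ : κ ≤ 1) {η : ℝ} (hη : 0 < η) (hη1 : η ≤ 1 / 4) :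
    ∃ C > (0 : ℝ), ∀ Q X δ s : ℝ, 1 ≤ Q → 1 ≤ X → 0 < δ → |s| = 1 →
    ∀ F : Finset (Σ q : ℕ, DirichletCharacter ℂ q),
    (∀ p ∈ F, inFamily 2 Q p.1 p.2 ∧ p.2 (-1) = (-1) ^ κ) →
    ∀ B : (Σ q : ℕ, DirichletCharacter ℂ q) → Finset ℝ,
    (∀ p ∈ F, ∀ t ∈ B p, ∀ t' ∈ B p, t ≠ t' → δ ≤ |t - t'|) →
    (∀ p ∈ F, ∀ t ∈ B p, s * t = |t| ∧ |t| ≤ X ∧ X ≤ 2 + 2 * |t|) →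
    ∑ p ∈ F, ∑ t ∈ B p, ‖LFun p.1 p.2 ((1 / 2 : ℂ) + (t : ℂ) * I)‖ ^ 2 ≤
      C * (δ⁻¹ + 1) * (Q * X) ^ (1 + 2 * η) := by
  obtain ⟨C₁, hC₁, h₁⟩ := exists_sum_lintegral_charTheta_le hκ hη hη1
  obtain ⟨C₂, hC₂, h₂⟩ := exists_sum_separated_le hη
  have harch := archConst_pos
  refine ⟨archConst⁻¹ * (2 * C₂ * 2 ^ η * C₁), by positivity,
    fun Q X δ s hQ hX hδ hs F hF B hsep hB => ?_⟩
  obtain ⟨hz, hz'⟩ := re_im_cexp_ray hs hX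
  have hR : 0 < C₂ * (δ⁻¹ + 1) := by positivity
  have hX0 : 0 < X := by linarith
  have hQ0 : 0 < Q := by linarith
  have key : ∀ p ∈ F, ENNReal.ofReal (archConst * X ^ (κ - 1 / 2 : ℝ) *
      ∑ t ∈ B p, ‖LFun p.1 p.2 ((1 / 2 : ℂ) + (t : ℂ) * I)‖ ^ 2) ≤
      ENNReal.ofReal (2 * (C₂ * (δ⁻¹ + 1)) * (2 * Q) ^ η) * ∫⁻ v in Set.Ioi (1 / (2 * Q)),
        ENNReal.ofReal (‖charTheta p.2 κ (cexp ((s * (Real.pi / 2 - 1 / X) : ℝ) * I) * v)‖ ^ 2 *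
          v ^ (κ - 1 / 2 + η)) := by
    rintro ⟨q, χ⟩ hp
    obtain ⟨hfam, hpar⟩ := hF _ hp
    have hq := hfam.2.2
    simp only at hq hfam hpar ⊢
    have hq0 : q ≠ 0 := by
      rintro rfl
      norm_num at hq
      linarith
    have : NeZero q := ⟨hq0⟩
    have hq1 : q ≠ 1 := by
      rintro rfl
      norm_num at hq
      linarith
    have hq0' : (0 : ℝ) < q := by exact_mod_cast Nat.pos_of_ne_zero hq0
    have hsq : χ ^ 2 = 1 := MulChar.isQuadratic_iff_sq_eq_one.1 (isQuadratic_of_inFamily hfam)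
    have hχ1 : χ ≠ 1 := by
      rintro rfl
      have := hfam.2.1
      rw [orderOf_one] at this
      norm_num at this
    have hreal : χ⁻¹ = χ := by
      rw [inv_eq_iff_mul_eq_one, ← sq, hsq]
    have hmain := sum_norm_sq_LFunction_le hq1 hfam.1 hχ1 hreal hκ hpar hX hs hη hR (hB _ hp)
      (fun t _ => h₂ δ hδ _ (hsep _ hp) t)
    have hL : ∀ w, LFun q χ w = DirichletCharacter.LFunction χ w := fun w => by
      rw [LFun, dif_neg hq0]
    simp only [hL]
    refine hmain.trans (mul_le_mul' (ENNReal.ofReal_le_ofReal ?_) ?_)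
    · have := hq.2
      gcongr
    · refine lintegral_mono_set (Set.Ioi_subset_Ioi ?_)
      rw [one_div]
      exact inv_anti₀ hq0' hq.2
  have hsum := Finset.sum_le_sum key
  rw [← Finset.mul_sum, ← ENNReal.ofReal_sum_of_nonneg fun p _ => by positivity,
    ← Finset.mul_sum] at hsum
  have hsum' := hsum.trans (mul_le_mul_right (h₁ Q X hQ hX _ hz hz' F hF) _)
  rw [← ENNReal.ofReal_mul (by positivity), ENNReal.ofReal_le_ofReal_iff (by positivity)] at hsum'
  have hP : 0 < archConst * X ^ (κ - 1 / 2 : ℝ) := by positivity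
  rw [← le_div_iff₀' hP] at hsum'
  refine hsum'.trans (le_of_eq ?_)
  rw [div_eq_iff hP.ne', Real.mul_rpow hQ0.le hX0.le, Real.mul_rpow zero_le_two hQ0.le]
  have e1 : X ^ (κ + 1 / 2 + 2 * η) = X ^ (1 + 2 * η) * X ^ (κ - 1 / 2 : ℝ) := by
    rw [← Real.rpow_add hX0]; congr 1; ring
  have e2 : Q ^ (1 + 2 * η) = Q ^ η * Q ^ (1 + η) := by
    rw [← Real.rpow_add hQ0]; congr 1; ring
  rw [e1, e2]
  field_simp

end Block

section Assembly

lemma sum_le_sum_sum_filter {α ι : Type*} (A : Finset α) (J : Finset ι) (P : ι → α → Prop)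
    [∀ i, DecidablePred (P i)] {f : α → ℝ} (hf : ∀ a, 0 ≤ f a) (h : ∀ a ∈ A, ∃ i ∈ J, P i a) :
    ∑ a ∈ A, f a ≤ ∑ i ∈ J, ∑ a ∈ A.filter (P i), f a := by
  simp_rw [Finset.sum_filter]
  rw [Finset.sum_comm]
  refine Finset.sum_le_sum fun a ha => ?_
  obtain ⟨i, hi, hP⟩ := h a ha
  refine le_trans (le_of_eq ?_) (Finset.single_le_sum
    (f := fun i => if P i a then f a else 0) (fun j _ => ?_) hi)
  · simp [hP]
  · split_ifs
    exacts [hf a, le_rfl]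

lemma sum_pow_succ_le {r : ℝ} (hr : 2 ≤ r) (n : ℕ) : ∑ m ∈ Finset.range n, r ^ (m + 1) ≤ 2 * r ^ n := by
  induction n with
  | zero => simp
  | succ n ih =>
    rw [Finset.sum_range_succ]
    have : 0 < r ^ n := by positivity
    rw [pow_succ]
    nlinarith

lemma exists_dyadic_block (t : ℝ) : ∃ m ≤ Nat.log 2 (⌊|t|⌋₊ + 1),
    |t| ≤ 2 ^ (m + 1) ∧ (2 : ℝ) ^ (m + 1) ≤ 2 + 2 * |t| := by
  refine ⟨_, le_rfl, ?_, ?_⟩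
  · have h1 := Nat.lt_pow_succ_log_self one_lt_two (⌊|t|⌋₊ + 1)
    have h2 : ((⌊|t|⌋₊ + 1 : ℕ) : ℝ) ≤ 2 ^ (Nat.log 2 (⌊|t|⌋₊ + 1) + 1) := by exact_mod_cast h1.le
    have h3 := Nat.lt_floor_add_one |t|
    push_cast at h2
    linarith
  · have h1 := Nat.pow_log_le_self 2 (Nat.succ_ne_zero ⌊|t|⌋₊)
    have h2 : (2 : ℝ) ^ Nat.log 2 (⌊|t|⌋₊ + 1) ≤ ((⌊|t|⌋₊ + 1 : ℕ) : ℝ) := by exact_mod_cast h1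
    have h3 := Nat.floor_le (abs_nonneg t)
    push_cast at h2
    rw [pow_succ]
    linarith

lemma exists_sum_parity_le {κ : ℕ} (hκ : κ ≤ 1) {η : ℝ} (hη : 0 < η) (hη1 : η ≤ 1 / 4) :
    ∃ C > (0 : ℝ), ∀ Q T δ : ℝ, 1 ≤ Q → 2 ≤ T → 0 < δ →
    ∀ F : Finset (Σ q : ℕ, DirichletCharacter ℂ q),
    (∀ p ∈ F, inFamily 2 Q p.1 p.2 ∧ p.2 (-1) = (-1) ^ κ) →
    ∀ B : (Σ q : ℕ, DirichletCharacter ℂ q) → Finset ℝ,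
    (∀ p ∈ F, ∀ t ∈ B p, ∀ t' ∈ B p, t ≠ t' → δ ≤ |t - t'|) →
    (∀ p ∈ F, ∀ t ∈ B p, |t| ≤ T) →
    ∑ p ∈ F, ∑ t ∈ B p, ‖LFun p.1 p.2 ((1 / 2 : ℂ) + (t : ℂ) * I)‖ ^ 2 ≤
      C * (δ⁻¹ + 1) * (Q * T) ^ (1 + 2 * η) := by
  classical
  obtain ⟨C, hC, h⟩ := exists_sum_block_le hκ hη hη1
  refine ⟨36 * C, by positivity, fun Q T δ hQ hT hδ F hF B hsep hB => ?_⟩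
  set e := 1 + 2 * η with he
  set L := Nat.log 2 (⌊T⌋₊ + 1) with hL
  set J : Finset (ℝ × ℕ) := ({1, -1} : Finset ℝ) ×ˢ Finset.range (L + 1) with hJ
  set P : ℝ × ℕ → ℝ → Prop := fun i t =>
    i.1 * t = |t| ∧ |t| ≤ 2 ^ (i.2 + 1) ∧ (2 : ℝ) ^ (i.2 + 1) ≤ 2 + 2 * |t| with hP
  have hQ0 : 0 < Q := by linarith
  have hT0 : 0 < T := by linarith
  have hcover : ∀ p ∈ F, ∀ t ∈ B p, ∃ i ∈ J, P i t := by
    intro p hp t ht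
    obtain ⟨m, hm, h1, h2⟩ := exists_dyadic_block t
    have hmL : m < L + 1 := Nat.lt_succ_of_le (hm.trans (Nat.log_mono_right
      (Nat.add_le_add_right (Nat.floor_le_floor (hB p hp t ht)) 1)))
    rcases le_total 0 t with h0 | h0
    · exact ⟨(1, m), Finset.mem_product.2 ⟨by simp, Finset.mem_range.2 hmL⟩,
        by rw [one_mul, abs_of_nonneg h0], h1, h2⟩
    · exact ⟨(-1, m), Finset.mem_product.2 ⟨by simp, Finset.mem_range.2 hmL⟩,
        by rw [neg_one_mul, abs_of_nonpos h0], h1, h2⟩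
  have hblock : ∀ i ∈ J, ∑ p ∈ F, ∑ t ∈ (B p).filter (P i),
      ‖LFun p.1 p.2 ((1 / 2 : ℂ) + (t : ℂ) * I)‖ ^ 2 ≤
        C * (δ⁻¹ + 1) * Q ^ e * ((2 : ℝ) ^ e) ^ (i.2 + 1) := by
    intro i hi
    have hi1 : |i.1| = 1 := by
      have := (Finset.mem_product.1 hi).1
      simp only [Finset.mem_insert, Finset.mem_singleton] at this
      rcases this with h | h <;> simp [h]
    refine (h Q (2 ^ (i.2 + 1)) δ i.1 hQ (one_le_pow₀ one_le_two) hδ hi1 F hF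
      (fun p => (B p).filter (P i)) (fun p hp t ht t' ht' => hsep p hp t
        (Finset.mem_filter.1 ht).1 t' (Finset.mem_filter.1 ht').1)
      (fun p _ t ht => (Finset.mem_filter.1 ht).2)).trans (le_of_eq ?_)
    rw [Real.mul_rpow hQ0.le (by positivity), ← Real.rpow_natCast, ← Real.rpow_natCast,
      ← Real.rpow_mul zero_le_two, ← Real.rpow_mul zero_le_two, mul_comm e]
    ring
  have hr : (2 : ℝ) ≤ 2 ^ e := by
    calc (2 : ℝ) = 2 ^ (1 : ℝ) := (Real.rpow_one 2).symm
      _ ≤ _ := Real.rpow_le_rpow_of_exponent_le one_le_two (by linarith)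
  have hL2 : (2 : ℝ) ^ (L + 1) ≤ 3 * T := by
    have h1 := Nat.pow_log_le_self 2 (Nat.succ_ne_zero ⌊T⌋₊)
    have h2 : (2 : ℝ) ^ L ≤ ((⌊T⌋₊ + 1 : ℕ) : ℝ) := by exact_mod_cast h1
    have h3 := Nat.floor_le hT0.le
    push_cast at h2
    rw [pow_succ]
    linarith
  have hL3 : ((2 : ℝ) ^ e) ^ (L + 1) ≤ 9 * T ^ e := by
    calc ((2 : ℝ) ^ e) ^ (L + 1) = (2 ^ (L + 1)) ^ e := by
          rw [← Real.rpow_natCast, ← Real.rpow_natCast, ← Real.rpow_mul zero_le_two,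
            ← Real.rpow_mul zero_le_two, mul_comm e]
      _ ≤ (3 * T) ^ e := Real.rpow_le_rpow (by positivity) hL2 (by positivity)
      _ = 3 ^ e * T ^ e := Real.mul_rpow (by norm_num) hT0.le
      _ ≤ _ := by
          gcongr
          calc (3 : ℝ) ^ e ≤ 3 ^ (2 : ℝ) :=
                Real.rpow_le_rpow_of_exponent_le (by norm_num) (by linarith)
            _ = 9 := by norm_num
  calc _ ≤ ∑ p ∈ F, ∑ i ∈ J, ∑ t ∈ (B p).filter (P i),
        ‖LFun p.1 p.2 ((1 / 2 : ℂ) + (t : ℂ) * I)‖ ^ 2 :=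
        Finset.sum_le_sum fun p hp => sum_le_sum_sum_filter _ _ _ (fun _ => by positivity)
          (hcover p hp)
    _ = ∑ i ∈ J, ∑ p ∈ F, ∑ t ∈ (B p).filter (P i),
        ‖LFun p.1 p.2 ((1 / 2 : ℂ) + (t : ℂ) * I)‖ ^ 2 := Finset.sum_comm
    _ ≤ ∑ i ∈ J, C * (δ⁻¹ + 1) * Q ^ e * ((2 : ℝ) ^ e) ^ (i.2 + 1) := Finset.sum_le_sum hblock
    _ = 2 * (C * (δ⁻¹ + 1) * Q ^ e * ∑ m ∈ Finset.range (L + 1), ((2 : ℝ) ^ e) ^ (m + 1)) := by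
        rw [hJ, Finset.sum_product, Finset.sum_pair (by norm_num), ← Finset.mul_sum]
        ring
    _ ≤ 2 * (C * (δ⁻¹ + 1) * Q ^ e * (2 * (9 * T ^ e))) := by
        gcongr
        exact (sum_pow_succ_le hr _).trans (by gcongr)
    _ = _ := by
        rw [Real.mul_rpow hQ0.le hT0.le]
        ring

lemma finite_inFamily {Q : ℝ} (hQ : 0 ≤ Q) (q : ℕ) :
    {χ : DirichletCharacter ℂ q | inFamily 2 Q q χ}.Finite := by
  rcases eq_or_ne q 0 with rfl | hq
  · convert Set.finite_empty
    ext χ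
    simp only [Set.mem_ofPred_eq, Set.mem_empty_iff_false, iff_false]
    intro h
    have := h.2.2.1
    rw [Nat.cast_zero] at this
    linarith
  · have : NeZero q := ⟨hq⟩
    exact Set.toFinite _

lemma exists_finset_finsum_eq {Q : ℝ} (hQ : 0 ≤ Q) :
    ∃ F : Finset (Σ q : ℕ, DirichletCharacter ℂ q), (∀ p ∈ F, inFamily 2 Q p.1 p.2) ∧
      ∀ f : (q : ℕ) → DirichletCharacter ℂ q → ℝ,
        ∑ᶠ (q : ℕ) (χ : DirichletCharacter ℂ q) (_ : inFamily 2 Q q χ), f q χ =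
          ∑ p ∈ F, f p.1 p.2 := by
  refine ⟨(Finset.Ioc ⌊Q⌋₊ ⌊2 * Q⌋₊).sigma fun q => (finite_inFamily hQ q).toFinset, ?_, ?_⟩
  · intro p hp
    exact (finite_inFamily hQ p.1).mem_toFinset.1 (Finset.mem_sigma.1 hp).2
  · intro f
    have h1 : ∀ q : ℕ, ∑ᶠ (χ : DirichletCharacter ℂ q) (_ : inFamily 2 Q q χ), f q χ =
        ∑ χ ∈ (finite_inFamily hQ q).toFinset, f q χ := fun q =>
      finsum_mem_eq_finite_toFinset_sum _ (finite_inFamily hQ q)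
    simp_rw [h1]
    rw [Finset.sum_sigma, finsum_eq_sum_of_support_subset]
    intro q hq
    obtain ⟨χ, hχ, -⟩ := Finset.exists_ne_zero_of_sum_ne_zero hq
    have hfam := ((finite_inFamily hQ q).mem_toFinset.1 hχ).2.2
    exact Finset.mem_coe.2 (Finset.mem_Ioc.2
      ⟨(Nat.floor_lt hQ).2 hfam.1, Nat.le_floor hfam.2⟩)

end Assembly

theorem stmt2 :
    ∀ ε > (0 : ℝ), ∃ C > (0 : ℝ), ∀ Q T δ : ℝ, 2 ≤ Q → 2 ≤ T → 0 < δ →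
      ∀ 𝒯 : (q : ℕ) → DirichletCharacter ℂ q → Finset ℝ,
      (∀ (q : ℕ) (χ : DirichletCharacter ℂ q), inFamily 2 Q q χ →
        (∀ t ∈ 𝒯 q χ, δ/2 - T ≤ t ∧ t ≤ T - δ/2) ∧
        (∀ t ∈ 𝒯 q χ, ∀ t' ∈ 𝒯 q χ, t ≠ t' → δ ≤ |t - t'|)) →
      (∑ᶠ (q : ℕ) (χ : DirichletCharacter ℂ q) (_ : inFamily 2 Q q χ),
          ∑ t ∈ 𝒯 q χ, ‖LFun q χ ((1/2 : ℂ) + (t : ℂ) * I)‖ ^ 2)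
        ≤ C * (δ⁻¹ + 1) * (Q * T) ^ (1 + ε) := by
  classical
  intro ε hε
  have hη : 0 < min (1 / 4) (ε / 2) := by positivity
  obtain ⟨C₀, hC₀, h₀⟩ := exists_sum_parity_le zero_le_one hη (min_le_left _ _)
  obtain ⟨C₁, hC₁, h₁⟩ := exists_sum_parity_le le_rfl hη (min_le_left _ _)
  refine ⟨C₀ + C₁, by positivity, fun Q T δ hQ hT hδ 𝒯 h𝒯 => ?_⟩
  obtain ⟨F, hF, hsum⟩ := exists_finset_finsum_eq (Q := Q) (by linarith)
  rw [hsum, ← Finset.sum_filter_add_sum_filter_not F fun p => p.2 (-1) = 1]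
  have hsep : ∀ p ∈ F, ∀ t ∈ 𝒯 p.1 p.2, ∀ t' ∈ 𝒯 p.1 p.2, t ≠ t' → δ ≤ |t - t'| :=
    fun p hp => (h𝒯 p.1 p.2 (hF p hp)).2
  have hT' : ∀ p ∈ F, ∀ t ∈ 𝒯 p.1 p.2, |t| ≤ T := fun p hp t ht => by
    have := (h𝒯 p.1 p.2 (hF p hp)).1 t ht
    exact abs_le.2 ⟨by linarith, by linarith⟩
  have hQT : (Q * T) ^ (1 + 2 * min (1 / 4) (ε / 2)) ≤ (Q * T) ^ (1 + ε) :=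
    Real.rpow_le_rpow_of_exponent_le (by nlinarith) (by linarith [min_le_right (1 / 4) (ε / 2)])
  have b₀ := h₀ Q T δ (by linarith) hT hδ (F.filter fun p => p.2 (-1) = 1)
    (fun p hp => ⟨hF p (Finset.mem_filter.1 hp).1, by simpa using (Finset.mem_filter.1 hp).2⟩)
    (fun p => 𝒯 p.1 p.2) (fun p hp => hsep p (Finset.mem_filter.1 hp).1)
    fun p hp => hT' p (Finset.mem_filter.1 hp).1
  have b₁ := h₁ Q T δ (by linarith) hT hδ (F.filter fun p => ¬ p.2 (-1) = 1)
    (fun p hp => ⟨hF p (Finset.mem_filter.1 hp).1, by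
      have h2 : p.2 (-1) ^ 2 = 1 := by rw [← map_pow]; simp
      simpa using (eq_or_eq_neg_of_sq_eq_sq _ 1 (h2.trans (one_pow 2).symm)).resolve_left (Finset.mem_filter.1 hp).2⟩)
    (fun p => 𝒯 p.1 p.2) (fun p hp => hsep p (Finset.mem_filter.1 hp).1)
    fun p hp => hT' p (Finset.mem_filter.1 hp).1
  calc _ ≤ C₀ * (δ⁻¹ + 1) * (Q * T) ^ (1 + 2 * min (1 / 4) (ε / 2)) +
        C₁ * (δ⁻¹ + 1) * (Q * T) ^ (1 + 2 * min (1 / 4) (ε / 2)) := add_le_add b₀ b₁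
    _ = (C₀ + C₁) * (δ⁻¹ + 1) * (Q * T) ^ (1 + 2 * min (1 / 4) (ε / 2)) := by ring
    _ ≤ _ := by gcongr
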